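/- Let p ∈ (1, p_N) and λ > 0, and let Ω ⊂ ℝ^N, N ≥ 2, be either a ball B_R(0) centered at the origin, or (with N = 2) a bounded C³ domain that is symmetric under each coordinate reflection x_i ↦ −x_i (i = 1, 2) and convex in each coordinate direction (any segment parallel to a coordinate axis with endpoints in Ω lies in Ω). Let (α, ψ) be a solution of problem (P)_λ on Ω. Then the eigenvalue σ = 0 of the linearized operator L_λ is simple: if φ₁, φ₂ ∈ C²(Ω̄) both vanish on ∂Ω and satisfy −Δφ_i = pλ V [φ_i] in Ω, then φ₁ and φ₂ are linearly dependent. -/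

import Mathlib

open MeasureTheory Metric Set

noncomputable section

/-- The Laplacian of a function on Euclidean space. -/
def lapl {N : ℕ} (f : EuclideanSpace ℝ (Fin N) → ℝ) (x : EuclideanSpace ℝ (Fin N)) : ℝ :=
  ∑ i : Fin N,
    fderiv ℝ (fun y => fderiv ℝ f y (EuclideanSpace.single i (1 : ℝ))) x
      (EuclideanSpace.single i (1 : ℝ))

/-- `(α, ψ)` is a solution of problem `(P)_λ` on `Ω`:
`ψ ∈ C²`, `-Δψ = (max (α + λψ) 0)^p` in `Ω`, `ψ = 0` on `∂Ω`, and
`∫_Ω (max (α + λψ) 0)^p = 1`. -/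
def IsSol {N : ℕ} (Ω : Set (EuclideanSpace ℝ (Fin N))) (p lam α : ℝ)
    (ψ : EuclideanSpace ℝ (Fin N) → ℝ) : Prop :=
  ContDiff ℝ 2 ψ ∧
  (∀ x ∈ Ω, -lapl ψ x = (max (α + lam * ψ x) 0) ^ p) ∧
  (∀ x ∈ frontier Ω, ψ x = 0) ∧
  (∫ x in Ω, (max (α + lam * ψ x) 0) ^ p) = 1

/-- The weight `V = (max (α + λψ) 0)^(p-1)`. -/
def Vfun {N : ℕ} (p lam α : ℝ) (ψ : EuclideanSpace ℝ (Fin N) → ℝ)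
    (x : EuclideanSpace ℝ (Fin N)) : ℝ :=
  (max (α + lam * ψ x) 0) ^ (p - 1)

/-- `m = ∫_Ω V`. -/
def mV {N : ℕ} (Ω : Set (EuclideanSpace ℝ (Fin N))) (p lam α : ℝ)
    (ψ : EuclideanSpace ℝ (Fin N) → ℝ) : ℝ :=
  ∫ x in Ω, Vfun p lam α ψ x

/-- The weighted average `⟨φ⟩ = (∫_Ω V φ) / m`. -/
def avgV {N : ℕ} (Ω : Set (EuclideanSpace ℝ (Fin N))) (p lam α : ℝ)
    (ψ φ : EuclideanSpace ℝ (Fin N) → ℝ) : ℝ :=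
  (∫ x in Ω, Vfun p lam α ψ x * φ x) / mV Ω p lam α ψ

/-- `σ` is an eigenvalue of the linearized operator `L_λ` at the solution `(α, ψ)`:
there is a nontrivial `φ ∈ C²(Ω̄)` vanishing on `∂Ω` with `-Δφ = (pλ + σ) V [φ]` in `Ω`. -/
def IsEigen {N : ℕ} (Ω : Set (EuclideanSpace ℝ (Fin N))) (p lam α : ℝ)
    (ψ : EuclideanSpace ℝ (Fin N) → ℝ) (σ : ℝ) : Prop :=
  ∃ φ : EuclideanSpace ℝ (Fin N) → ℝ, ContDiff ℝ 2 φ ∧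
    (∃ x ∈ closure Ω, φ x ≠ 0) ∧ (∀ x ∈ frontier Ω, φ x = 0) ∧
    ∀ x ∈ Ω, -lapl φ x = (p * lam + σ) * (Vfun p lam α ψ x * (φ x - avgV Ω p lam α ψ φ))

/-- `Ω` is a bounded domain of class `C³`: open, connected, bounded, and near every
boundary point `Ω` is the sublevel set of a `C³` function with nonvanishing gradient. -/
def IsC3Domain {N : ℕ} (Ω : Set (EuclideanSpace ℝ (Fin N))) : Prop :=
  IsOpen Ω ∧ IsConnected Ω ∧ Bornology.IsBounded Ω ∧
  ∀ x ∈ frontier Ω, ∃ (U : Set (EuclideanSpace ℝ (Fin N)))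
      (f : EuclideanSpace ℝ (Fin N) → ℝ),
    IsOpen U ∧ x ∈ U ∧ ContDiff ℝ 3 f ∧ (∀ y ∈ U, fderiv ℝ f y ≠ 0) ∧
    Ω ∩ U = {y ∈ U | f y < 0}

/-- Reflection of `x ∈ ℝ^N` in the `i`-th coordinate: `x_i ↦ -x_i`. -/
def reflect {N : ℕ} (i : Fin N) (x : EuclideanSpace ℝ (Fin N)) :
    EuclideanSpace ℝ (Fin N) :=
  (EuclideanSpace.equiv (Fin N) ℝ).symm
    (Function.update ((EuclideanSpace.equiv (Fin N) ℝ) x) i (-(x i)))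

/-- Weak form of `-Δv = g` in `U`, tested against compactly supported `C¹` functions. -/
def WeakEq {N : ℕ} (U : Set (EuclideanSpace ℝ (Fin N))) (v g : EuclideanSpace ℝ (Fin N) → ℝ) :
    Prop :=
  ∀ η : EuclideanSpace ℝ (Fin N) → ℝ, ContDiff ℝ 1 η → HasCompactSupport η → tsupport η ⊆ U →
    ∫ x, inner ℝ (gradient v x) (gradient η x) = ∫ x, g x * η x

section Weak

variable {N : ℕ}

local notation "E" => EuclideanSpace ℝ (Fin N)

theorem inner_gradient_eq_sum (u v : E → ℝ) (x : E) :
    inner ℝ (gradient u x) (gradient v x) =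
      ∑ i : Fin N, fderiv ℝ u x (EuclideanSpace.single i 1) *
        fderiv ℝ v x (EuclideanSpace.single i 1) := by
  rw [← (EuclideanSpace.basisFun (Fin N) ℝ).sum_inner_mul_inner]
  refine Finset.sum_congr rfl fun i _ => ?_
  simp only [EuclideanSpace.basisFun_apply]
  rw [real_inner_comm (gradient v x), inner_gradient_left, inner_gradient_left]

theorem inner_gradient_left' (u : E → ℝ) (x y : E) :
    inner ℝ (gradient u x) y = fderiv ℝ u x y := inner_gradient_left

theorem continuous_gradient {v : E → ℝ} (hv : ContDiff ℝ 1 v) : Continuous (gradient v) := by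
  unfold gradient
  exact (LinearIsometryEquiv.continuous _).comp (hv.continuous_fderiv one_ne_zero)

theorem gradient_eq_zero_of_notMem_tsupport {η : E → ℝ} {x : E} (hx : x ∉ tsupport η) :
    gradient η x = 0 := by
  have h : η =ᶠ[nhds x] fun _ => 0 := notMem_tsupport_iff_eventuallyEq.mp hx
  rw [h.gradient_eq]; simp [gradient]

theorem integrable_inner_gradient {v η : E → ℝ} (hv : ContDiff ℝ 1 v) (hη : ContDiff ℝ 1 η)
    (hc : HasCompactSupport η) :
    Integrable (fun x => inner ℝ (gradient v x) (gradient η x)) := by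
  refine Continuous.integrable_of_hasCompactSupport
    ((continuous_gradient hv).inner (continuous_gradient hη)) ?_
  refine hc.mono' fun x hx => ?_
  by_contra h
  exact hx (by simp [gradient_eq_zero_of_notMem_tsupport h])

theorem integrable_mul_test {g η : E → ℝ} (hg : Continuous g) (hη : ContDiff ℝ 1 η)
    (hc : HasCompactSupport η) : Integrable (fun x => g x * η x) :=
  (hg.mul hη.continuous).integrable_of_hasCompactSupport hc.mul_left

theorem gradient_add' {u v : E → ℝ} {x : E} (hu : DifferentiableAt ℝ u x)
    (hv : DifferentiableAt ℝ v x) :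
    gradient (fun y => u y + v y) x = gradient u x + gradient v x := by
  unfold gradient; rw [fderiv_fun_add hu hv, map_add]

theorem gradient_const_mul' {u : E → ℝ} {x : E} (hu : DifferentiableAt ℝ u x) (a : ℝ) :
    gradient (fun y => a * u y) x = a • gradient u x := by
  unfold gradient; rw [fderiv_const_mul hu, map_smul]

theorem gradient_mul' {u v : E → ℝ} {x : E} (hu : DifferentiableAt ℝ u x)
    (hv : DifferentiableAt ℝ v x) :
    gradient (fun y => u y * v y) x = u x • gradient v x + v x • gradient u x := by
  unfold gradient; rw [fderiv_fun_mul hu hv, map_add, map_smul, map_smul]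

theorem gradient_comp_real {u : E → ℝ} {F : ℝ → ℝ} {F' : ℝ} {x : E}
    (hF : HasDerivAt F F' (u x)) (hu : DifferentiableAt ℝ u x) :
    gradient (fun y => F (u y)) x = F' • gradient u x := by
  have h : fderiv ℝ (fun y => F (u y)) x = F' • fderiv ℝ u x :=
    (hF.comp_hasFDerivAt x hu.hasFDerivAt).fderiv
  unfold gradient
  rw [h, map_smul]

theorem WeakEq.mono {U V : Set E} {v g : E → ℝ} (h : WeakEq U v g) (hVU : V ⊆ U) :
    WeakEq V v g := fun η h1 h2 h3 => h η h1 h2 (h3.trans hVU)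

theorem WeakEq.congr {U : Set E} {v g g' : E → ℝ} (h : WeakEq U v g) (hg : ∀ x ∈ U, g x = g' x) :
    WeakEq U v g' := fun η h1 h2 h3 => by
  rw [h η h1 h2 h3]
  congr 1; ext x
  by_cases hx : x ∈ tsupport η
  · rw [hg x (h3 hx)]
  · simp [image_eq_zero_of_notMem_tsupport hx]

theorem WeakEq.add {U : Set E} {v g v' g' : E → ℝ} (h : WeakEq U v g) (h' : WeakEq U v' g')
    (hv : ContDiff ℝ 1 v) (hv' : ContDiff ℝ 1 v') (hg : Continuous g) (hg' : Continuous g') :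
    WeakEq U (fun x => v x + v' x) (fun x => g x + g' x) := fun η h1 h2 h3 => by
  have e1 : (fun x => inner ℝ (gradient (fun x => v x + v' x) x) (gradient η x)) =
      fun x => inner ℝ (gradient v x) (gradient η x) + inner ℝ (gradient v' x) (gradient η x) := by
    ext x
    rw [gradient_add' (hv.differentiable one_ne_zero x) (hv'.differentiable one_ne_zero x),
      inner_add_left]
  simp only [e1, add_mul]
  rw [integral_add (integrable_inner_gradient hv h1 h2) (integrable_inner_gradient hv' h1 h2),
    integral_add (integrable_mul_test hg h1 h2) (integrable_mul_test hg' h1 h2),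
    h η h1 h2 h3, h' η h1 h2 h3]

theorem WeakEq.const_mul {U : Set E} {v g : E → ℝ} (h : WeakEq U v g) (hv : ContDiff ℝ 1 v)
    (a : ℝ) : WeakEq U (fun x => a * v x) (fun x => a * g x) := fun η h1 h2 h3 => by
  have e1 : (fun x => inner ℝ (gradient (fun x => a * v x) x) (gradient η x)) =
      fun x => a * inner ℝ (gradient v x) (gradient η x) := by
    ext x
    rw [gradient_const_mul' (hv.differentiable one_ne_zero x), inner_smul_left]; simp
  simp only [e1, mul_assoc]
  rw [integral_const_mul, integral_const_mul, h η h1 h2 h3]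

theorem WeakEq.neg {U : Set E} {v g : E → ℝ} (h : WeakEq U v g) (hv : ContDiff ℝ 1 v) :
    WeakEq U (fun x => - v x) (fun x => - g x) := by
  simpa using h.const_mul hv (-1)

theorem WeakEq.sub {U : Set E} {v g v' g' : E → ℝ} (h : WeakEq U v g) (h' : WeakEq U v' g')
    (hv : ContDiff ℝ 1 v) (hv' : ContDiff ℝ 1 v') (hg : Continuous g) (hg' : Continuous g') :
    WeakEq U (fun x => v x - v' x) (fun x => g x - g' x) := by
  simpa [sub_eq_add_neg] using h.add (h'.neg hv') hv hv'.neg hg hg'.neg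

theorem weakEq_of_lapl {U : Set E} {f g : E → ℝ} (hf : ContDiff ℝ 2 f)
    (h : ∀ x ∈ U, - lapl f x = g x) : WeakEq U f g := fun η h1 h2 h3 => by
  have hd : ∀ i : Fin N, ContDiff ℝ 1 (fun y => fderiv ℝ f y (EuclideanSpace.single i (1:ℝ))) :=
    fun i => (hf.fderiv_right (m := 1) (by norm_num)).clm_apply contDiff_const
  have hη' : ∀ i : Fin N, Continuous (fun y => fderiv ℝ η y (EuclideanSpace.single i (1:ℝ))) :=
    fun i => (h1.continuous_fderiv one_ne_zero).clm_apply continuous_const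
  have hcη : ∀ i : Fin N, HasCompactSupport
      (fun y => fderiv ℝ η y (EuclideanSpace.single i (1:ℝ))) := fun i =>
    (h2.fderiv (𝕜 := ℝ)).comp_left (g := fun L : E →L[ℝ] ℝ => L (EuclideanSpace.single i (1:ℝ)))
      (by simp)
  have hd' : ∀ i : Fin N, Continuous (fun x => fderiv ℝ (fun y => fderiv ℝ f y
      (EuclideanSpace.single i (1:ℝ))) x (EuclideanSpace.single i (1:ℝ))) :=
    fun i => ((hd i).continuous_fderiv one_ne_zero).clm_apply continuous_const
  have e1 : ∀ x, inner ℝ (gradient f x) (gradient η x) = _ := inner_gradient_eq_sum f η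
  simp only [e1]
  rw [integral_finsetSum]
  swap
  · intro i _
    exact ((hd i).continuous.mul (hη' i)).integrable_of_hasCompactSupport (hcη i).mul_left
  have e2 : ∀ i : Fin N, ∫ x, fderiv ℝ f x (EuclideanSpace.single i 1) *
        fderiv ℝ η x (EuclideanSpace.single i 1) = - ∫ x, fderiv ℝ (fun y => fderiv ℝ f y
      (EuclideanSpace.single i (1:ℝ))) x (EuclideanSpace.single i (1:ℝ)) * η x := by
    intro i
    refine integral_mul_fderiv_eq_neg_fderiv_mul_of_integrable ?_ ?_ ?_ ?_ ?_
    · exact ((hd' i).mul h1.continuous).integrable_of_hasCompactSupport h2.mul_left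
    · exact ((hd i).continuous.mul (hη' i)).integrable_of_hasCompactSupport (hcη i).mul_left
    · exact ((hd i).continuous.mul h1.continuous).integrable_of_hasCompactSupport h2.mul_left
    · exact fun x _ => (hd i).differentiable one_ne_zero x
    · exact fun x _ => h1.differentiable one_ne_zero x
  simp only [e2]
  rw [Finset.sum_neg_distrib, ← integral_finsetSum, ← integral_neg]
  · congr 1; ext x
    rw [← Finset.sum_mul]
    by_cases hx : x ∈ tsupport η
    · rw [← h x (h3 hx)]; simp [lapl]
    · simp [image_eq_zero_of_notMem_tsupport hx]
  · intro i _
    exact ((hd' i).mul h1.continuous).integrable_of_hasCompactSupport h2.mul_left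

theorem indicator_support_subset {U K : Set E} {f : E → ℝ} (hK : IsClosed K)
    (h0 : ∀ x ∈ U, x ∉ K → f x = 0) : tsupport (U.indicator f) ⊆ K := by
  refine closure_minimal (fun x hx => ?_) hK
  by_contra h
  by_cases hxU : x ∈ U
  · exact hx (by simp [hxU, h0 x hxU h])
  · exact hx (by simp [hxU])

theorem contDiff_indicator {U K : Set E} {f : E → ℝ} {n : WithTop ℕ∞} (hU : IsOpen U)
    (hK : IsClosed K) (hKU : K ⊆ U) (h0 : ∀ x ∈ U, x ∉ K → f x = 0) (hf : ContDiff ℝ n f) :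
    ContDiff ℝ n (U.indicator f) := by
  rw [contDiff_iff_contDiffAt]
  intro x
  by_cases hx : x ∈ U
  · refine hf.contDiffAt.congr_of_eventuallyEq ?_
    filter_upwards [hU.mem_nhds hx] with y hy using by simp [hy]
  · have : U.indicator f =ᶠ[nhds x] fun _ => 0 :=
      notMem_tsupport_iff_eventuallyEq.mp
        fun h => hx (hKU (indicator_support_subset hK h0 h))
    exact contDiffAt_const.congr_of_eventuallyEq this

theorem gradient_indicator {U : Set E} {f : E → ℝ} (hU : IsOpen U) {x : E} (hx : x ∈ U) :
    gradient (U.indicator f) x = gradient f x := by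
  refine Filter.EventuallyEq.gradient_eq ?_
  filter_upwards [hU.mem_nhds hx] with y hy using by simp [hy]

theorem integral_inner_indicator {U K : Set E} {v f : E → ℝ} (hU : IsOpen U)
    (hK : IsClosed K) (hKU : K ⊆ U) (h0 : ∀ x ∈ U, x ∉ K → f x = 0) :
    ∫ x, inner ℝ (gradient v x) (gradient (U.indicator f) x) =
      ∫ x in U, inner ℝ (gradient v x) (gradient f x) := by
  rw [← integral_indicator hU.measurableSet]
  congr 1; ext x
  by_cases hx : x ∈ U
  · simp [hx, gradient_indicator hU hx]
  · rw [gradient_eq_zero_of_notMem_tsupport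
      (fun h => hx (hKU (indicator_support_subset hK h0 h)))]
    simp [hx]

/-- The weak equation tested against a `C¹` function vanishing off a compact part of `U`. -/
theorem WeakEq.test {U K : Set E} {v g f : E → ℝ} (h : WeakEq U v g) (hU : IsOpen U)
    (hK : IsCompact K) (hKU : K ⊆ U) (h0 : ∀ x ∈ U, x ∉ K → f x = 0) (hf : ContDiff ℝ 1 f) :
    ∫ x in U, inner ℝ (gradient v x) (gradient f x) = ∫ x in U, g x * f x := by
  rw [← integral_inner_indicator hU hK.isClosed hKU h0,
    h _ (contDiff_indicator hU hK.isClosed hKU h0 hf)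
      (hK.of_isClosed_subset (isClosed_tsupport _) (indicator_support_subset hK.isClosed h0))
      ((indicator_support_subset hK.isClosed h0).trans hKU),
    ← integral_indicator hU.measurableSet]
  congr 1; ext x
  by_cases hx : x ∈ U <;> simp [hx]

end Weak

section MaxPrinciple
variable {N : ℕ}
local notation "E" => EuclideanSpace ℝ (Fin N)

/-- `L¹` Poincaré inequality with a constant that is small on sets of small measure. -/
theorem exists_poincare (hN : 2 ≤ N) : ∃ C : ℝ, 0 ≤ C ∧ ∀ (U : Set (EuclideanSpace ℝ (Fin N)))
    (ζ : EuclideanSpace ℝ (Fin N) → ℝ), MeasurableSet U → volume U ≠ ⊤ → ContDiff ℝ 1 ζ →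
    HasCompactSupport ζ → tsupport ζ ⊆ U →
    ∫ x, |ζ x| ≤ C * (volume.real U) ^ (1 / (N : ℝ)) * ∫ x, ‖gradient ζ x‖ := by
  have hN0 : (0:ℝ) < N := by positivity
  have hN1 : (1:ℝ) < N := by exact_mod_cast hN
  obtain ⟨q, hq⟩ : ∃ q : NNReal, NNReal.HolderConjugate (N : NNReal) q :=
    ⟨_, NNReal.HolderConjugate.conjExponent (by exact_mod_cast hN)⟩
  refine ⟨eLpNormLESNormFDerivOneConst (volume : Measure E) q, NNReal.coe_nonneg _, ?_⟩
  intro U ζ hU hfin h1 h2 h3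
  have hq' : NNReal.HolderConjugate (Module.finrank ℝ E) q := by simpa using hq
  have hS := eLpNorm_le_eLpNorm_fderiv_one (volume : Measure E) h1 h2 hq'
  have hq1 : (1 : ENNReal) ≤ q := by exact_mod_cast hq.symm.lt.le
  have hz : ∀ x, x ∉ U → ζ x = 0 := fun x hx =>
    image_eq_zero_of_notMem_tsupport fun h => hx (h3 h)
  have hH := eLpNorm_le_eLpNorm_mul_rpow_measure_univ (μ := volume.restrict U) (f := ζ) hq1
    h1.continuous.aestronglyMeasurable
  have hexp : (1 / (1 : ENNReal).toReal - 1 / (q : ENNReal).toReal) = 1 / (N:ℝ) := by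
    have := hq.coe.inv_add_inv_eq_one
    simp only [NNReal.coe_natCast] at this
    simp; linarith
  rw [hexp, Measure.restrict_apply_univ] at hH
  have hle : eLpNorm ζ q (volume.restrict U) ≤ eLpNorm ζ q volume :=
    eLpNorm_mono_measure _ Measure.restrict_le_self
  have e1 : eLpNorm ζ 1 (volume.restrict U) = ENNReal.ofReal (∫ x, |ζ x|) := by
    rw [eLpNorm_one_eq_lintegral_enorm, ← setIntegral_eq_integral_of_forall_compl_eq_zero
      (s := U) (fun x hx => by simp [hz x hx])]
    have hi : Integrable ζ := h1.continuous.integrable_of_hasCompactSupport h2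
    rw [← ofReal_integral_norm_eq_lintegral_enorm hi.restrict]
    simp
  have e2 : eLpNorm (fderiv ℝ ζ) 1 volume = ENNReal.ofReal (∫ x, ‖gradient ζ x‖) := by
    have hi : Integrable (fderiv ℝ ζ) :=
      (h1.continuous_fderiv one_ne_zero).integrable_of_hasCompactSupport (h2.fderiv (𝕜 := ℝ))
    rw [eLpNorm_one_eq_lintegral_enorm, ← ofReal_integral_norm_eq_lintegral_enorm hi]
    simp [gradient]
  have hfinal : ENNReal.ofReal (∫ x, |ζ x|) ≤ ENNReal.ofReal
      (eLpNormLESNormFDerivOneConst (volume : Measure E) q *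
        (volume.real U) ^ (1 / (N : ℝ)) * ∫ x, ‖gradient ζ x‖) := by
    rw [← e1, ENNReal.ofReal_mul (by positivity), ENNReal.ofReal_mul (by positivity), ← e2,
      ← ENNReal.ofReal_rpow_of_nonneg (by positivity) (by positivity), Measure.real,
      ENNReal.ofReal_toReal hfin, ENNReal.ofReal_coe_nnreal]
    calc _ ≤ _ := hH
      _ ≤ _ := mul_le_mul_left (hle.trans hS) _
      _ = _ := by ring
  exact (ENNReal.ofReal_le_ofReal_iff (by positivity)).mp hfinal

theorem isBounded_volume_ne_top {U : Set E} (h : Bornology.IsBounded U) : volume U ≠ ⊤ :=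
  h.measure_lt_top.ne

theorem integrableOn_of_continuous_of_isBounded {U : Set E} {f : E → ℝ}
    (hU : Bornology.IsBounded U) (hf : Continuous f) : IntegrableOn f U :=
  (hf.continuousOn.integrableOn_compact hU.isCompact_closure).mono_set subset_closure

theorem hasDerivAt_max_pow (n : ℕ) (t : ℝ) :
    HasDerivAt (fun t : ℝ => (max t 0) ^ (n + 2)) ((n + 2) * (max t 0) ^ (n + 1)) t := by
  rcases lt_trichotomy t 0 with h | h | h
  · rw [max_eq_right h.le]
    simp only [ne_eq, Nat.add_eq_zero_iff, one_ne_zero, and_false, not_false_eq_true, zero_pow,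
      mul_zero]
    refine (hasDerivAt_const t (0:ℝ)).congr_of_eventuallyEq ?_
    filter_upwards [Iio_mem_nhds h] with y hy
    rw [max_eq_right (le_of_lt hy)]; simp
  · subst h
    simp only [max_self, ne_eq, Nat.add_eq_zero_iff, one_ne_zero, and_false, not_false_eq_true,
      zero_pow, mul_zero]
    rw [hasDerivAt_iff_isLittleO_nhds_zero]
    simp only [zero_add, max_self, ne_eq, Nat.add_eq_zero_iff, OfNat.ofNat_ne_zero, and_false,
      not_false_eq_true, zero_pow, sub_zero, smul_zero]
    refine Asymptotics.IsBigO.trans_isLittleO (g := fun h : ℝ => h ^ (n + 2)) ?_ ?_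
    · refine Asymptotics.IsBigO.of_bound 1 (Filter.Eventually.of_forall fun h => ?_)
      rw [one_mul, norm_pow, norm_pow]
      gcongr
      simp only [Real.norm_eq_abs]
      rcases le_total h 0 with h0 | h0
      · simp [max_eq_right h0]
      · simp [max_eq_left h0]
    · simpa using Asymptotics.isLittleO_pow_pow (𝕜 := ℝ) (m := 1) (n := n + 2) (by omega)
  · rw [max_eq_left h.le]
    have h2 := hasDerivAt_pow (n + 2) t
    simp only [Nat.cast_add, Nat.cast_ofNat] at h2
    refine h2.congr_of_eventuallyEq ?_
    filter_upwards [Ioi_mem_nhds h] with y hy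
    rw [max_eq_left (le_of_lt hy)]

theorem contDiff_max_pow (n : ℕ) : ContDiff ℝ 1 (fun t : ℝ => (max t 0) ^ (n + 2)) := by
  rw [contDiff_one_iff_deriv]
  refine ⟨fun t => (hasDerivAt_max_pow n t).differentiableAt, ?_⟩
  rw [funext fun t => (hasDerivAt_max_pow n t).deriv]
  fun_prop

set_option maxHeartbeats 400000 in
theorem weak_max_principle_core {C M : ℝ} {U : Set E} {v g : E → ℝ}
    (hP : ∀ ζ : E → ℝ, ContDiff ℝ 1 ζ → HasCompactSupport ζ → tsupport ζ ⊆ U →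
      ∫ x, |ζ x| ≤ C * ∫ x, ‖gradient ζ x‖)
    (hCM : 9 * C ^ 2 * M ≤ 1) (hU : IsOpen U) (hb : Bornology.IsBounded U)
    (hv : ContDiff ℝ 1 v) (hg : Continuous g) (hw : WeakEq U v g)
    (hneg : ∀ x ∈ U, v x < 0 → M * v x ≤ g x) (hbd : ∀ x ∈ frontier U, 0 ≤ v x) :
    ∀ x ∈ U, 0 ≤ v x := by
  have hvd : Differentiable ℝ v := hv.differentiable one_ne_zero
  have key : ∀ ε > 0, ∫ x in U, (max (-ε - v x) 0) ^ 3 ≤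
      ε * ∫ x in U, (max (-ε - v x) 0) ^ 2 := by
    intro ε hε
    set s : E → ℝ := fun x => max (-ε - v x) 0 with hs
    have hs0 : ∀ x, 0 ≤ s x := fun x => le_max_right _ _
    have hsc : Continuous s := by have := hv.continuous; fun_prop
    have hgc := continuous_gradient hv
    have hin : ∀ {f : E → ℝ}, Continuous f → IntegrableOn f U :=
      fun hf => integrableOn_of_continuous_of_isBounded hb hf
    have hinner : ContDiff ℝ 1 (fun x => -ε - v x) := contDiff_const.sub hv
    have hgi : ∀ x, gradient (fun x => -ε - v x) x = - gradient v x := by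
      intro x
      simp only [gradient, fderiv_const_sub, map_neg]
    have hpow : ∀ n : ℕ, ContDiff ℝ 1 (fun x => s x ^ (n + 2)) := fun n =>
      (contDiff_max_pow n).comp hinner
    have hgr : ∀ (n : ℕ) x, gradient (fun x => s x ^ (n + 2)) x =
        (-((n + 2) * s x ^ (n + 1))) • gradient v x := by
      intro n x
      have := gradient_comp_real (u := fun x => -ε - v x) (x := x)
        (hasDerivAt_max_pow n (-ε - v x)) (hinner.differentiable one_ne_zero x)
      rw [this, hgi, smul_neg, neg_smul]
    set K : Set E := closure U ∩ {x | v x ≤ -ε} with hK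
    have hKc : IsCompact K :=
      hb.isCompact_closure.inter_right (isClosed_le hv.continuous continuous_const)
    have hKU : K ⊆ U := by
      rintro x ⟨hx1, hx2⟩
      by_contra hxU
      have := hbd x ⟨hx1, fun h => hxU (interior_subset h)⟩
      simp only [mem_ofPred_eq] at hx2
      linarith
    have h0 : ∀ n : ℕ, ∀ x ∈ U, x ∉ K → s x ^ (n + 2) = 0 := by
      intro n x hx hxK
      have : ¬ v x ≤ -ε := fun h => hxK ⟨subset_closure hx, h⟩
      have : s x = 0 := max_eq_right (by linarith)
      simp [this]
    have t1 := hw.test hU hKc hKU (h0 0) (hpow 0)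
    simp only [hgr, inner_smul_right, real_inner_self_eq_norm_sq] at t1
    simp only [CharP.cast_eq_zero, zero_add, pow_one] at t1
    have t2 : - (M * ∫ x in U, (s x ^ 3 + ε * s x ^ 2)) ≤ ∫ x in U, g x * s x ^ 2 := by
      rw [← integral_const_mul, ← integral_neg]
      refine setIntegral_mono_on (hin (by fun_prop)) (hin (by fun_prop)) hU.measurableSet ?_
      intro x hx
      rcases (hs0 x).eq_or_lt with h | h
      · rw [← h]; simp
      · have hsx : s x = -ε - v x := by
          rcases max_choice (-ε - v x) 0 with h' | h'
          · exact h'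
          · exact absurd (h' : s x = 0) h.ne'
        have hvx : v x = -(s x + ε) := by linarith
        have := hneg x hx (by linarith)
        have h4 : M * v x * s x ^ 2 ≤ g x * s x ^ 2 := by gcongr
        calc _ = M * v x * s x ^ 2 := by rw [hvx]; ring
          _ ≤ _ := h4
    have hI3 : IntegrableOn (fun x => s x ^ 3) U := hin (by fun_prop)
    have hI2 : IntegrableOn (fun x => s x ^ 2) U := hin (by fun_prop)
    have hIg : IntegrableOn (fun x => s x * ‖gradient v x‖ ^ 2) U := hin (by fun_prop)
    have t3 : 2 * ∫ x in U, s x * ‖gradient v x‖ ^ 2 ≤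
        M * (∫ x in U, s x ^ 3) + M * ε * ∫ x in U, s x ^ 2 := by
      rw [integral_add hI3 (hI2.const_mul ε), integral_const_mul] at t2
      have : ∫ x in U, -(2 * s x) * ‖gradient v x‖ ^ 2 =
          -(2 * ∫ x in U, s x * ‖gradient v x‖ ^ 2) := by
        rw [← integral_const_mul, ← integral_neg]; congr 1; ext x; ring
      rw [this] at t1
      nlinarith
    have h03 : ∀ x ∈ U, x ∉ K → s x ^ 3 = 0 := h0 1
    have hc3 : ContDiff ℝ 1 (fun x => s x ^ 3) := hpow 1
    have hind := indicator_support_subset hKc.isClosed h03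
    have p1 := hP (U.indicator fun x => s x ^ 3)
      (contDiff_indicator hU hKc.isClosed hKU h03 hc3)
      (hKc.of_isClosed_subset (isClosed_tsupport _) hind) (hind.trans hKU)
    have e1 : ∫ x, |U.indicator (fun x => s x ^ 3) x| = ∫ x in U, s x ^ 3 := by
      rw [← integral_indicator hU.measurableSet]
      congr 1; ext x
      by_cases hx : x ∈ U
      · simp [hx, abs_of_nonneg (hs0 x)]
      · simp [hx]
    have e2 : ∫ x, ‖gradient (U.indicator fun x => s x ^ 3) x‖ =
        ∫ x in U, 3 * (s x ^ 2 * ‖gradient v x‖) := by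
      rw [← integral_indicator hU.measurableSet]
      congr 1; ext x
      by_cases hx : x ∈ U
      · rw [gradient_indicator hU hx, hgr 1, norm_smul]
        simp [hx, abs_of_nonneg (hs0 x)]; ring_nf
      · rw [gradient_eq_zero_of_notMem_tsupport (fun h => hx (hKU (hind h)))]
        simp [hx]
    rw [e1, e2] at p1
    have p2 : ∫ x in U, C * (3 * (s x ^ 2 * ‖gradient v x‖)) ≤
        ∫ x in U, (1 / 2 * s x ^ 3 + 9 * C ^ 2 / 2 * (s x * ‖gradient v x‖ ^ 2)) := by
      refine setIntegral_mono_on (hin (by fun_prop)) (hin (by fun_prop)) hU.measurableSet ?_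
      intro x _
      nlinarith [mul_nonneg (hs0 x) (sq_nonneg (s x - 3 * C * ‖gradient v x‖))]
    rw [integral_add (hI3.const_mul _) (hIg.const_mul _)] at p2
    simp only [integral_const_mul] at p1 p2
    have n3 : 0 ≤ ∫ x in U, s x ^ 3 := integral_nonneg fun x => pow_nonneg (hs0 x) _
    have n2 : 0 ≤ ∫ x in U, s x ^ 2 := integral_nonneg fun x => pow_nonneg (hs0 x) _
    have q1 : 9 * C ^ 2 / 2 * ∫ x in U, s x * ‖gradient v x‖ ^ 2 ≤
        1 / 4 * (∫ x in U, s x ^ 3) + ε / 4 * ∫ x in U, s x ^ 2 := by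
      have a1 : 9 * C ^ 2 / 4 * (2 * ∫ x in U, s x * ‖gradient v x‖ ^ 2) ≤
        9 * C ^ 2 / 4 * (M * (∫ x in U, s x ^ 3) + M * ε * ∫ x in U, s x ^ 2) := by gcongr
      have a2 : 9 * C ^ 2 * M * ((∫ x in U, s x ^ 3) + ε * ∫ x in U, s x ^ 2) ≤
          1 * ((∫ x in U, s x ^ 3) + ε * ∫ x in U, s x ^ 2) := by gcongr
      nlinarith
    linarith
  intro x0 hx0
  by_contra hlt
  push Not at hlt
  set e0 : ℝ := -v x0 / 2 with he0
  have he0' : 0 < e0 := by linarith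
  have hsc : ∀ ε : ℝ, Continuous fun x => max (-ε - v x) 0 := fun ε => by
    have := hv.continuous; fun_prop
  have hpos : 0 < ∫ x in U, (max (-e0 - v x) 0) ^ 3 := by
    rw [setIntegral_pos_iff_support_of_nonneg_ae]
    · refine IsOpen.measure_pos volume ?_ ⟨x0, ?_, hx0⟩
      · exact (((hsc e0).pow 3).isOpen_support).inter hU
      · simp only [Function.mem_support]
        have : 0 < max (-e0 - v x0) 0 := lt_max_of_lt_left (by linarith)
        positivity
    · exact Filter.Eventually.of_forall fun x => pow_nonneg (le_max_right _ _) _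
    · exact integrableOn_of_continuous_of_isBounded hb ((hsc e0).pow 3)
  set I := ∫ x in U, (max (-e0 - v x) 0) ^ 3
  set J := ∫ x in U, (max (-0 - v x) 0) ^ 2
  have hJ : 0 ≤ J := integral_nonneg fun x => sq_nonneg _
  have main : ∀ ε > 0, ε ≤ e0 → I ≤ ε * J := by
    intro ε hε hεe
    have a1 : I ≤ ∫ x in U, (max (-ε - v x) 0) ^ 3 := by
      refine setIntegral_mono (integrableOn_of_continuous_of_isBounded hb ((hsc _).pow 3))
        (integrableOn_of_continuous_of_isBounded hb ((hsc _).pow 3)) fun x => ?_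
      simp only
      gcongr
    have a2 : ∫ x in U, (max (-ε - v x) 0) ^ 2 ≤ J := by
      refine setIntegral_mono (integrableOn_of_continuous_of_isBounded hb ((hsc _).pow 2))
        (integrableOn_of_continuous_of_isBounded hb ((hsc _).pow 2)) fun x => ?_
      simp only
      gcongr
    calc I ≤ _ := a1
      _ ≤ _ := key ε hε
      _ ≤ ε * J := by gcongr
  have h1 := main (min e0 (I / (2 * (J + 1)))) (by positivity) (min_le_left _ _)
  have h2 : min e0 (I / (2 * (J + 1))) * J ≤ I / (2 * (J + 1)) * (J + 1) := by
    gcongr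
    · exact min_le_right _ _
    · linarith
  have h3 : I / (2 * (J + 1)) * (J + 1) = I / 2 := by field_simp
  linarith

/-- Weak maximum principle for superharmonic functions on bounded open sets. -/
theorem weak_max_principle (hN : 2 ≤ N) {U : Set E} {v g : E → ℝ} (hU : IsOpen U)
    (hb : Bornology.IsBounded U) (hv : ContDiff ℝ 1 v) (hg : Continuous g) (hw : WeakEq U v g)
    (hneg : ∀ x ∈ U, v x < 0 → 0 ≤ g x) (hbd : ∀ x ∈ frontier U, 0 ≤ v x) :
    ∀ x ∈ U, 0 ≤ v x := by
  obtain ⟨C, hC, hP⟩ := exists_poincare hN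
  exact weak_max_principle_core (C := C * (volume.real U) ^ (1 / (N : ℝ))) (M := 0)
    (fun ζ h1 h2 h3 => hP U ζ hU.measurableSet (isBounded_volume_ne_top hb) h1 h2 h3)
    (by simp) hU hb hv hg hw (by simpa using hneg) hbd

/-- Maximum principle on bounded open sets of small measure. -/
theorem small_max_principle (hN : 2 ≤ N) (M : ℝ) : ∃ δ : ℝ, 0 < δ ∧
    ∀ (U : Set (EuclideanSpace ℝ (Fin N))) (v g : EuclideanSpace ℝ (Fin N) → ℝ), IsOpen U →
    Bornology.IsBounded U → volume.real U < δ → ContDiff ℝ 1 v → Continuous g → WeakEq U v g →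
    (∀ x ∈ U, v x < 0 → M * v x ≤ g x) → (∀ x ∈ frontier U, 0 ≤ v x) → ∀ x ∈ U, 0 ≤ v x := by
  obtain ⟨C, hC, hP⟩ := exists_poincare hN
  have hN0 : (0:ℝ) < N := by positivity
  set M' := |M| with hM'
  have hM0 : 0 ≤ M' := abs_nonneg M
  set r : ℝ := 1 / (3 * (C + 1) * (M' + 1)) with hr
  have hr0 : 0 < r := by positivity
  refine ⟨r ^ (N : ℝ), by positivity, ?_⟩
  intro U v g hU hb hsm hv hg hw hneg hbd
  have hκ : (volume.real U) ^ (1 / (N : ℝ)) ≤ r := by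
    calc (volume.real U) ^ (1 / (N : ℝ)) ≤ (r ^ (N:ℝ)) ^ (1 / (N:ℝ)) := by gcongr
      _ = r := by rw [← Real.rpow_mul hr0.le]; field_simp; simp
  have hκ0 : 0 ≤ (volume.real U) ^ (1 / (N : ℝ)) := by positivity
  refine weak_max_principle_core (C := C * (volume.real U) ^ (1 / (N : ℝ))) (M := M')
    (fun ζ h1 h2 h3 => hP U ζ hU.measurableSet (isBounded_volume_ne_top hb) h1 h2 h3)
    ?_ hU hb hv hg hw ?_ hbd
  · have h1 : C * (volume.real U) ^ (1 / (N : ℝ)) ≤ 1 / (3 * (M' + 1)) := by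
      calc _ ≤ (C + 1) * r := by gcongr; linarith
        _ = _ := by rw [hr]; field_simp
    calc 9 * (C * (volume.real U) ^ (1 / (N : ℝ))) ^ 2 * M'
        ≤ 9 * (1 / (3 * (M' + 1))) ^ 2 * M' := by gcongr
      _ = M' / (M' + 1) ^ 2 := by field_simp; norm_num
      _ ≤ 1 := by rw [div_le_one (by positivity)]; nlinarith
  · intro x hx hvx
    refine le_trans ?_ (hneg x hx hvx)
    nlinarith [le_abs_self M]

end MaxPrinciple

section Hopf
variable {N : ℕ}
local notation "E" => EuclideanSpace ℝ (Fin N)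

theorem hasFDerivAt_barrier_base (y : E) (R : ℝ) (x : E) :
    HasFDerivAt (fun x : E => R ^ 2 - ‖x - y‖ ^ 2) (-(2 • innerSL ℝ (x - y))) x := by
  have h1 : HasFDerivAt (fun x : E => x - y) (ContinuousLinearMap.id ℝ E) x :=
    (hasFDerivAt_id x).sub_const y
  simpa using (h1.norm_sq).const_sub (R ^ 2)

theorem fderiv_barrier (y : E) (R K : ℝ) (x w : E) :
    fderiv ℝ (fun x : E => (R ^ 2 - ‖x - y‖ ^ 2) + K * (R ^ 2 - ‖x - y‖ ^ 2) ^ 2) x w =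
      (1 + 2 * K * (R ^ 2 - ‖x - y‖ ^ 2)) * (-(2 * inner ℝ (x - y) w)) := by
  have h := hasFDerivAt_barrier_base y R x
  have h2 : HasFDerivAt (fun x : E => (R ^ 2 - ‖x - y‖ ^ 2) + K * (R ^ 2 - ‖x - y‖ ^ 2) ^ 2) _ x :=
    h.add ((h.pow 2).const_mul K)
  rw [h2.fderiv]
  simp [inner_sub_left]
  ring

theorem contDiff_barrier (y : E) (R K : ℝ) : ContDiff ℝ 2
    (fun x : E => (R ^ 2 - ‖x - y‖ ^ 2) + K * (R ^ 2 - ‖x - y‖ ^ 2) ^ 2) := by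
  have : ContDiff ℝ 2 (fun x : E => ‖x - y‖ ^ 2) := (contDiff_id.sub contDiff_const).norm_sq ℝ
  fun_prop

theorem lapl_barrier (y : E) (R K : ℝ) (x : E) :
    lapl (fun x : E => (R ^ 2 - ‖x - y‖ ^ 2) + K * (R ^ 2 - ‖x - y‖ ^ 2) ^ 2) x =
      -2 * N * (1 + 2 * K * (R ^ 2 - ‖x - y‖ ^ 2)) + 8 * K * ‖x - y‖ ^ 2 := by
  unfold lapl
  simp only [fderiv_barrier]
  have h : ∀ i : Fin N, fderiv ℝ (fun x : E => (1 + 2 * K * (R ^ 2 - ‖x - y‖ ^ 2)) *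
      (-(2 * inner ℝ (x - y) (EuclideanSpace.single i (1:ℝ))))) x (EuclideanSpace.single i 1) =
      8 * K * (x i - y i) ^ 2 - 2 * (1 + 2 * K * (R ^ 2 - ‖x - y‖ ^ 2)) := by
    intro i
    have h1 := ((hasFDerivAt_barrier_base y R x).const_mul (2 * K)).const_add 1
    have h2 : HasFDerivAt (fun x : E => -(2 * (x i - y i)))
        (-((2:ℝ) • EuclideanSpace.proj (𝕜 := ℝ) i)) x :=
      (((EuclideanSpace.proj (𝕜 := ℝ) i).hasFDerivAt.sub_const (y i)).const_mul 2).neg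
    have h3 : HasFDerivAt (fun x : E => (1 + 2 * K * (R ^ 2 - ‖x - y‖ ^ 2)) *
      (-(2 * (x i - y i)))) _ x := h1.mul h2
    have h4 : (fun x : E => (1 + 2 * K * (R ^ 2 - ‖x - y‖ ^ 2)) *
      (-(2 * inner ℝ (x - y) (EuclideanSpace.single i (1:ℝ))))) =
      fun x : E => (1 + 2 * K * (R ^ 2 - ‖x - y‖ ^ 2)) * (-(2 * (x i - y i))) := by
      ext x; simp [EuclideanSpace.inner_single_right]
    rw [h4, h3.fderiv]
    simp [EuclideanSpace.inner_single_right]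
    ring
  simp only [h]
  rw [Finset.sum_sub_distrib, ← Finset.mul_sum, EuclideanSpace.real_norm_sq_eq]
  simp
  ring

/-- Hopf boundary point lemma on balls. -/
theorem hopf_lemma (hN : 2 ≤ N) {y z : E} {R : ℝ} (hR : 0 < R) {v g : E → ℝ}
    (hv : ContDiff ℝ 1 v) (hg : Continuous g) (hw : WeakEq (ball y R) v g)
    (hg0 : ∀ x ∈ ball y R, 0 ≤ g x) (hpos : ∀ x ∈ ball y R, 0 < v x) (hz : v z = 0)
    (hzR : dist z y = R) : 0 < fderiv ℝ v z (y - z) := by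
  have hN0 : (0:ℝ) < N := by positivity
  set θ : ℝ := 1 / (N + 2) with hθ
  have hθ0 : 0 < θ := by positivity
  have hθN : θ * (N + 2) = 1 := by rw [hθ]; field_simp
  have hθ1 : θ < 1 := by nlinarith
  set K : ℝ := N / (2 * R ^ 2) with hK
  have hK0 : 0 < K := by positivity
  have hKR : K * R ^ 2 = N / 2 := by rw [hK]; field_simp
  set s : E → ℝ := fun x => R ^ 2 - ‖x - y‖ ^ 2 with hs
  set b : E → ℝ := fun x => s x + K * s x ^ 2 with hb
  have hsc : Continuous s := by fun_prop
  have hb2 : ContDiff ℝ 2 b := contDiff_barrier y R K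
  set A : Set E := {x | 0 < s x ∧ s x < θ * R ^ 2} with hA
  have hAo : IsOpen A :=
    (isOpen_lt continuous_const hsc).inter (isOpen_lt hsc continuous_const)
  have hAB : A ⊆ ball y R := by
    rintro x ⟨hx, -⟩
    rw [mem_ball, dist_eq_norm]
    simp only [hs] at hx
    nlinarith [norm_nonneg (x - y)]
  have hcl : ∀ x ∈ closedBall y R, 0 ≤ v x := by
    rw [← closure_ball y hR.ne']
    intro x hx
    have : closure (ball y R) ⊆ {x | 0 ≤ v x} :=
      closure_minimal (fun x hx => (hpos x hx).le) (isClosed_le continuous_const hv.continuous)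
    exact this hx
  obtain ⟨m, hm, hmin⟩ : ∃ m : ℝ, 0 < m ∧ ∀ x, s x = θ * R ^ 2 → m ≤ v x := by
    have hsub : {x | s x = θ * R ^ 2} ⊆ ball y R := by
      intro x hx
      rw [mem_ofPred_eq] at hx
      rw [mem_ball, dist_eq_norm]
      simp only [hs] at hx
      have : 0 < θ * R ^ 2 := by positivity
      nlinarith [norm_nonneg (x - y)]
    have hc : IsCompact {x | s x = θ * R ^ 2} :=
      (isCompact_closedBall y R).of_isClosed_subset (isClosed_eq hsc continuous_const)
        (hsub.trans ball_subset_closedBall)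
    rcases ({x | s x = θ * R ^ 2}).eq_empty_or_nonempty with h | h
    · exact ⟨1, one_pos, fun x hx => absurd (show x ∈ {x | s x = θ * R ^ 2} from hx) (by simp [h])⟩
    · obtain ⟨x0, hx0, hmn⟩ := hc.exists_isMinOn h hv.continuous.continuousOn
      exact ⟨v x0, hpos _ (hsub hx0), fun x hx => hmn hx⟩
  set B : ℝ := θ * R ^ 2 + K * (θ * R ^ 2) ^ 2 with hB
  have hB0 : 0 < B := by positivity
  set ε : ℝ := m / B with hε
  have hε0 : 0 < ε := by positivity
  have hlb : ∀ x ∈ A, 0 ≤ lapl b x := by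
    rintro x ⟨hx1, hx2⟩
    have e : lapl b x = -2 * N * (1 + 2 * K * s x) + 8 * K * ‖x - y‖ ^ 2 := lapl_barrier y R K x
    have e2 : ‖x - y‖ ^ 2 = R ^ 2 - s x := by simp [hs]
    rw [e, e2]
    have : K * s x ≤ K * (θ * R ^ 2) := by gcongr
    have h3 : K * (θ * R ^ 2) = θ * N / 2 := by rw [mul_left_comm, hKR]; ring
    nlinarith
  have hlc : Continuous (lapl b) := by
    have : lapl b = fun x => -2 * N * (1 + 2 * K * s x) + 8 * K * ‖x - y‖ ^ 2 :=
      funext (lapl_barrier y R K)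
    rw [this]; fun_prop
  have hbw : WeakEq A (fun x => ε * b x) (fun x => ε * - lapl b x) :=
    (weakEq_of_lapl (g := fun x => - lapl b x) hb2 fun x _ => rfl).const_mul
      (hb2.of_le (by norm_num)) ε
  have hb1 : ContDiff ℝ 1 (fun x => ε * b x) := contDiff_const.mul (hb2.of_le (by norm_num))
  have hcomp : ∀ x ∈ A, 0 ≤ v x - ε * b x := by
    refine weak_max_principle hN hAo (isBounded_ball.subset hAB) (hv.sub hb1)
      (hg.sub (continuous_const.mul hlc.neg))
      ((hw.mono hAB).sub hbw hv hb1 hg (continuous_const.mul hlc.neg)) ?_ ?_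
    · intro x hx _
      have := hg0 x (hAB hx)
      have := mul_nonneg hε0.le (hlb x hx)
      rw [mul_neg, sub_neg_eq_add]
      exact add_nonneg ‹_› ‹_›
    · intro x hx
      have hxc : x ∈ closure A := frontier_subset_closure hx
      have h1 : 0 ≤ s x ∧ s x ≤ θ * R ^ 2 := by
        have : closure A ⊆ {x | 0 ≤ s x ∧ s x ≤ θ * R ^ 2} :=
          closure_minimal (fun x hx => ⟨hx.1.le, hx.2.le⟩)
            ((isClosed_le continuous_const hsc).inter (isClosed_le hsc continuous_const))
        exact this hxc
      have h2 : x ∉ A := by rw [hAo.frontier_eq] at hx; exact hx.2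
      have h3 : s x = 0 ∨ s x = θ * R ^ 2 := by
        by_contra! h
        exact h2 ⟨lt_of_le_of_ne h1.1 h.1.symm, lt_of_le_of_ne h1.2 h.2⟩
      rcases h3 with h3 | h3
      · have : 0 ≤ v x := by
          have h4 : closure A ⊆ closedBall y R :=
            closure_minimal (hAB.trans ball_subset_closedBall) isClosed_closedBall
          exact hcl x (h4 hxc)
        simp only [hb, h3]; simpa using this
      · have := hmin x h3
        have h5 : ε * b x = m := by
          have : b x = B := by simp only [hb, h3, hB]
          rw [this, hε]; field_simp
        linarith
  have hzn : ‖z - y‖ = R := by rw [← dist_eq_norm]; exact hzR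
  have hbz : b z = 0 := by simp [hb, hs, hzn]
  have hder : HasDerivAt (fun t : ℝ => v (z + t • (y - z)) - ε * b (z + t • (y - z)))
      (fderiv ℝ v z (y - z) - ε * fderiv ℝ b z (y - z)) 0 := by
    have hl : HasDerivAt (fun t : ℝ => z + t • (y - z)) (y - z) 0 := by
      simpa using ((hasDerivAt_id (0:ℝ)).smul_const (y - z)).const_add z
    have h1 : HasFDerivAt v (fderiv ℝ v z) (z + (0:ℝ) • (y - z)) := by
      simpa using (hv.differentiable one_ne_zero z).hasFDerivAt
    have h2 : HasFDerivAt b (fderiv ℝ b z) (z + (0:ℝ) • (y - z)) := by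
      simpa using (hb2.differentiable two_ne_zero z).hasFDerivAt
    have h3 : HasDerivAt (fun t : ℝ => b (z + t • (y - z))) (fderiv ℝ b z (y - z)) 0 := by
      have h4 := HasFDerivAt.comp_hasDerivAt (l := b) (0 : ℝ) h2 hl
      exact h4
    exact (h1.comp_hasDerivAt 0 hl).sub (h3.const_mul ε)
  have hge : 0 ≤ fderiv ℝ v z (y - z) - ε * fderiv ℝ b z (y - z) := by
    have htend := hder.hasDerivWithinAt (s := Ioi 0)
    rw [hasDerivWithinAt_iff_tendsto_slope' (by simp)] at htend
    refine ge_of_tendsto htend ?_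
    have hev : ∀ᶠ t in nhdsWithin (0:ℝ) (Ioi 0), t < θ / 2 :=
      mem_nhdsWithin_of_mem_nhds (Iio_mem_nhds (by positivity))
    filter_upwards [hev, self_mem_nhdsWithin] with t ht1 ht0
    rw [mem_Ioi] at ht0
    have hmem : z + t • (y - z) ∈ A := by
      have e : z + t • (y - z) - y = (1 - t) • (z - y) := by module
      have e2 : s (z + t • (y - z)) = R ^ 2 * (t * (2 - t)) := by
        simp only [hs]
        rw [e, norm_smul, mul_pow, hzn, Real.norm_eq_abs, sq_abs]; ring
      have hR2 : 0 < R ^ 2 := by positivity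
      refine ⟨?_, ?_⟩
      · rw [e2]; exact mul_pos hR2 (by nlinarith)
      · rw [e2, mul_comm θ]
        refine mul_lt_mul_of_pos_left ?_ hR2
        nlinarith
    have := hcomp _ hmem
    rw [slope_def_field]
    refine div_nonneg ?_ (by linarith)
    simp [hz, hbz]
    linarith
  have hfb : fderiv ℝ b z (y - z) = 2 * R ^ 2 := by
    have := fderiv_barrier y R K z (y - z)
    rw [hzn] at this
    have e : inner ℝ (z - y) (y - z) = - R ^ 2 := by
      rw [← neg_sub z y, inner_neg_right, real_inner_self_eq_norm_sq, hzn]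
    rw [e] at this
    simp only [hb, hs]
    rw [this]; ring
  rw [hfb] at hge
  have : 0 < ε * (2 * R ^ 2) := by positivity
  linarith

/-- Local strong maximum principle. -/
theorem eq_zero_near_of_superharmonic (hN : 2 ≤ N) {U : Set E} {v g : E → ℝ}
    (hU : IsOpen U) (hv : ContDiff ℝ 1 v) (hg : Continuous g) (hw : WeakEq U v g)
    (hv0 : ∀ x ∈ U, 0 ≤ v x) (hg0 : ∀ x ∈ U, 0 ≤ g x) :
    IsOpen {x | x ∈ U ∧ v x = 0} := by
  rw [Metric.isOpen_iff]
  rintro x ⟨hxU, hx⟩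
  obtain ⟨r, hr, hball⟩ := Metric.isOpen_iff.mp hU x hxU
  refine ⟨r / 2, by positivity, fun y hy => ⟨hball (ball_subset_ball (by linarith) hy), ?_⟩⟩
  have hyU := hball (ball_subset_ball (by linarith) hy)
  by_contra hne
  have hyp : 0 < v y := lt_of_le_of_ne (hv0 y hyU) (Ne.symm hne)
  rw [mem_ball, dist_comm] at hy
  set Z : Set E := closedBall y (dist x y) ∩ {x | v x = 0} with hZ
  have hZc : IsCompact Z :=
    (isCompact_closedBall _ _).inter_right (isClosed_eq hv.continuous continuous_const)
  obtain ⟨z, hz, hmin⟩ := hZc.exists_isMinOn (f := fun w => dist w y) ⟨x, by simp, hx⟩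
    (by fun_prop)
  have hzx : dist z y ≤ dist x y := mem_closedBall.mp hz.1
  have hzy : 0 < dist z y := by
    rw [dist_pos]; rintro rfl; exact hne hz.2
  have hsubU : closedBall y (dist z y) ⊆ U := fun w hw => by
    refine hball ?_
    rw [mem_closedBall] at hw
    rw [mem_ball]
    calc dist w x ≤ dist w y + dist y x := dist_triangle _ _ _
      _ < r := by rw [dist_comm y x]; linarith
  have hballU : ball y (dist z y) ⊆ U := ball_subset_closedBall.trans hsubU
  have hh := hopf_lemma hN hzy hv hg (hw.mono hballU) (fun w hw => hg0 w (hballU hw))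
    (fun w hw => by
      refine lt_of_le_of_ne (hv0 w (hballU hw)) fun h => ?_
      rw [mem_ball] at hw
      have := hmin (show w ∈ Z from ⟨mem_closedBall.mpr (hw.le.trans hzx), h.symm⟩)
      simp only [mem_ofPred_eq] at this
      linarith) hz.2 rfl
  have hzU : z ∈ U := hsubU (by simp)
  have hloc : IsLocalMin v z := by
    filter_upwards [hU.mem_nhds hzU] with w hw
    rw [show v z = 0 from hz.2]; exact hv0 w hw
  rw [hloc.fderiv_eq_zero] at hh
  simp at hh

/-- Strong maximum principle: zeros propagate along connected subsets. -/
theorem eq_zero_of_superharmonic (hN : 2 ≤ N) {U S : Set E} {v g : E → ℝ}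
    (hU : IsOpen U) (hS : IsPreconnected S) (hSU : S ⊆ U) (hv : ContDiff ℝ 1 v)
    (hg : Continuous g) (hw : WeakEq U v g) (hv0 : ∀ x ∈ U, 0 ≤ v x) (hg0 : ∀ x ∈ U, 0 ≤ g x)
    {x0 : E} (hx0 : x0 ∈ S) (h0 : v x0 = 0) : ∀ x ∈ S, v x = 0 := by
  have ho := eq_zero_near_of_superharmonic hN hU hv hg hw hv0 hg0
  have := hS.subset_of_closure_inter_subset ho ⟨x0, hx0, hSU hx0, h0⟩ (by
    rintro x ⟨hx, hxS⟩
    refine ⟨hSU hxS, ?_⟩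
    have : closure {x | x ∈ U ∧ v x = 0} ⊆ {x | v x = 0} :=
      closure_minimal (fun x hx => hx.2) (isClosed_eq hv.continuous continuous_const)
    exact this hx)
  exact fun x hx => (this hx).2

end Hopf

section Reflection
variable {N : ℕ}
local notation "E" => EuclideanSpace ℝ (Fin N)

theorem gradient_comp_isometry (A : E ≃ₗᵢ[ℝ] E) (b : E) {v : E → ℝ} {x : E}
    (hv : DifferentiableAt ℝ v (A x + b)) :
    gradient (fun x => v (A x + b)) x = A.symm (gradient v (A x + b)) := by
  refine ext_inner_right ℝ fun w => ?_
  have h1 : HasFDerivAt (fun x => A x + b) (A.toContinuousLinearEquiv : E →L[ℝ] E) x :=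
    A.toContinuousLinearEquiv.hasFDerivAt.add_const b
  have h2 : HasFDerivAt (fun x => v (A x + b)) _ x := hv.hasFDerivAt.comp x h1
  rw [inner_gradient_left', h2.fderiv, A.symm.inner_map_eq_flip, LinearIsometryEquiv.symm_symm,
    inner_gradient_left']
  rfl

theorem WeakEq.comp_isometry {U : Set E} {v g : E → ℝ} (h : WeakEq U v g)
    (hv : ContDiff ℝ 1 v) (A : E ≃ₗᵢ[ℝ] E) (b : E) :
    WeakEq ((fun x => A x + b) ⁻¹' U) (fun x => v (A x + b)) (fun x => g (A x + b)) := by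
  intro η h1 h2 h3
  set T : E ≃ₜ E := A.toHomeomorph.trans (Homeomorph.addRight b) with hT
  have hTx : ∀ x, T x = A x + b := fun x => rfl
  have hTs : ∀ x, T.symm x = A.symm (x - b) := fun x => by
    rw [Homeomorph.symm_apply_eq, hTx, A.apply_symm_apply, sub_add_cancel]
  set ζ : E → ℝ := fun x => η (A.symm x + (- A.symm b)) with hζ
  have hζT : ∀ x, η x = ζ (A x + b) := fun x => by simp [hζ]
  have hζc : ContDiff ℝ 1 ζ := h1.comp (A.symm.contDiff.add contDiff_const)
  have hζs : ζ = η ∘ T.symm := by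
    ext x; simp only [hζ, Function.comp, hTs, map_sub]; rw [sub_eq_add_neg]
  have hts : tsupport ζ = T.symm ⁻¹' tsupport η := by
    rw [hζs]; exact tsupport_comp_eq_preimage η T.symm
  have key := h ζ hζc (by rw [hζs]; exact h2.comp_homeomorph T.symm) (by
    rw [hts]
    intro x hx
    have := h3 hx
    simp only [mem_preimage, ← hTx, T.apply_symm_apply] at this
    exact this)
  have hmp : MeasurePreserving (fun x : E => A x + b) volume volume :=
    (measurePreserving_add_right volume b).comp A.measurePreserving
  have hme : MeasurableEmbedding (fun x : E => A x + b) := T.measurableEmbedding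
  rw [← hmp.integral_comp hme, ← hmp.integral_comp hme (fun x => g x * ζ x)] at key
  have e1 : gradient η = fun x => A.symm (gradient ζ (A x + b)) := by
    rw [funext hζT]
    ext1 x
    exact gradient_comp_isometry A b (hζc.differentiable one_ne_zero _)
  have e2 : ∀ x, gradient (fun x => v (A x + b)) x = A.symm (gradient v (A x + b)) :=
    fun x => gradient_comp_isometry A b (hv.differentiable one_ne_zero _)
  simp only [e1, e2, A.symm.inner_map_map]
  rw [key]
  simp only [← hζT]

/-- Reflection of `x` in the hyperplane `⟪x, e⟫ = μ`, for a unit vector `e`. -/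
def planeRefl (e : E) (μ : ℝ) (x : E) : E := x + (2 * (μ - inner ℝ x e)) • e

theorem planeRefl_eq {e : E} (he : ‖e‖ = 1) (μ : ℝ) (x : E) :
    planeRefl e μ x = (Submodule.span ℝ {e})ᗮ.reflection x + (2 * μ) • e := by
  rw [Submodule.reflection_orthogonal_apply, Submodule.reflection_singleton_apply, he,
    real_inner_comm, planeRefl]
  simp only [one_pow, div_one, RCLike.ofReal_real_eq_id, id_eq]
  module

theorem WeakEq.comp_planeRefl {U : Set E} {v g : E → ℝ} (h : WeakEq U v g)
    (hv : ContDiff ℝ 1 v) {e : E} (he : ‖e‖ = 1) (μ : ℝ) :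
    WeakEq (planeRefl e μ ⁻¹' U) (fun x => v (planeRefl e μ x))
      (fun x => g (planeRefl e μ x)) := by
  have h1 := h.comp_isometry hv (Submodule.span ℝ {e})ᗮ.reflection ((2 * μ) • e)
  simp only [← planeRefl_eq he] at h1
  exact h1

theorem contDiff_planeRefl (e : E) (μ : ℝ) {n : WithTop ℕ∞} : ContDiff ℝ n (planeRefl e μ) := by
  unfold planeRefl
  have : ContDiff ℝ n fun x : E => inner ℝ x e := contDiff_id.inner ℝ contDiff_const
  fun_prop

theorem continuous_planeRefl (e : E) :
    Continuous fun q : ℝ × E => planeRefl e q.1 q.2 := by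
  unfold planeRefl
  fun_prop

theorem inner_planeRefl {e : E} (he : ‖e‖ = 1) (μ : ℝ) (x : E) :
    inner ℝ (planeRefl e μ x) e = 2 * μ - inner ℝ x e := by
  rw [planeRefl, inner_add_left, inner_smul_left, real_inner_self_eq_norm_sq, he]
  simp; ring

theorem planeRefl_planeRefl {e : E} (he : ‖e‖ = 1) (μ : ℝ) (x : E) :
    planeRefl e μ (planeRefl e μ x) = x := by
  rw [planeRefl, inner_planeRefl he, planeRefl]
  module

theorem planeRefl_of_inner_eq {e : E} {μ : ℝ} {x : E} (h : inner ℝ x e = μ) :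
    planeRefl e μ x = x := by simp [planeRefl, h]

theorem planeRefl_neg (e : E) (x : E) : planeRefl (-e) 0 x = planeRefl e 0 x := by
  simp [planeRefl]

theorem volume_hyperplane {e : E} (he : ‖e‖ = 1) (μ : ℝ) :
    volume {x : E | inner ℝ x e = μ} = 0 := by
  set S : AffineSubspace ℝ E := AffineSubspace.mk' (μ • e) (Submodule.span ℝ {e})ᗮ with hS
  have hmem : ∀ x, x ∈ S ↔ inner ℝ x e = μ := by
    intro x
    rw [hS, AffineSubspace.mem_mk', Submodule.mem_orthogonal_singleton_iff_inner_left,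
      vsub_eq_sub, inner_sub_left, inner_smul_left, real_inner_self_eq_norm_sq, he]
    simp [sub_eq_zero]
  have hne : S ≠ ⊤ := by
    intro h
    have : (μ + 1) • e ∈ S := by rw [h]; trivial
    rw [hmem, inner_smul_left, real_inner_self_eq_norm_sq, he] at this
    simp at this
  have := Measure.addHaar_affineSubspace (volume : Measure E) S hne
  convert this using 2
  ext x
  exact (hmem x).symm

/-- `Ω` is symmetric and convex in the direction `e`. -/
def SymDir (Ω : Set E) (e : E) : Prop :=
  ∀ x ∈ Ω, ∀ t : ℝ, |t| ≤ |inner ℝ x e| → x + (t - inner ℝ x e) • e ∈ Ω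

theorem SymDir.neg {Ω : Set E} {e : E} (h : SymDir Ω e) : SymDir Ω (-e) := by
  intro x hx t ht
  rw [inner_neg_right, abs_neg] at ht
  have := h x hx (-t) (by rwa [abs_neg])
  convert this using 1
  rw [inner_neg_right]; module

theorem SymDir.planeRefl_mem {Ω : Set E} {e : E} (h : SymDir Ω e) {x : E} (hx : x ∈ Ω) {μ : ℝ}
    (hμ : 0 ≤ μ) (hxμ : μ ≤ inner ℝ x e) : planeRefl e μ x ∈ Ω := by
  have := h x hx (2 * μ - inner ℝ x e) (by
    rw [abs_of_nonneg (hμ.trans hxμ), abs_le]; constructor <;> linarith)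
  convert this using 1
  rw [planeRefl]; module

theorem SymDir.planeRefl_zero_mem {Ω : Set E} {e : E} (h : SymDir Ω e) {x : E} (hx : x ∈ Ω) :
    planeRefl e 0 x ∈ Ω := by
  have := h x hx (- inner ℝ x e) (by rw [abs_neg])
  convert this using 1
  rw [planeRefl]; module

/-- The first exit point of a ray from a bounded open set. -/
theorem exists_exit {Ω : Set E} (hΩ : IsOpen Ω) (hb : Bornology.IsBounded Ω) {x e : E}
    (hx : x ∈ Ω) (he : ‖e‖ = 1) : ∃ t : ℝ, 0 < t ∧ (∀ s ∈ Ico 0 t, x + s • e ∈ Ω) ∧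
      x + t • e ∈ frontier Ω := by
  have hc : Continuous fun s : ℝ => x + s • e := by fun_prop
  set S : Set ℝ := {s | 0 ≤ s ∧ x + s • e ∉ Ω} with hS
  have hSc : IsClosed S := isClosed_Ici.inter (hΩ.isClosed_compl.preimage hc)
  have hSn : S.Nonempty := by
    obtain ⟨R, hR⟩ := hb.subset_closedBall x
    refine ⟨|R| + 1, by positivity, fun h => ?_⟩
    have := hR h
    rw [mem_closedBall, dist_eq_norm, add_sub_cancel_left, norm_smul, he, mul_one,
      Real.norm_eq_abs, abs_of_nonneg (by positivity)] at this
    linarith [le_abs_self R]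
  have hbd : BddBelow S := ⟨0, fun s hs => hs.1⟩
  have hm := hSc.csInf_mem hSn hbd
  have hin : ∀ s ∈ Ico 0 (sInf S), x + s • e ∈ Ω := by
    intro s hs
    by_contra h
    exact absurd (csInf_le hbd ⟨hs.1, h⟩) (not_le.mpr hs.2)
  have hpos : 0 < sInf S := by
    refine lt_of_le_of_ne hm.1 fun h => hm.2 ?_
    rw [← h]; simpa using hx
  refine ⟨sInf S, hpos, hin, ?_⟩
  rw [hΩ.frontier_eq]
  refine ⟨?_, hm.2⟩
  have h1 : sInf S ∈ closure (Ico 0 (sInf S)) := by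
    rw [closure_Ico hpos.ne]; exact ⟨hpos.le, le_rfl⟩
  have h2 := image_closure_subset_closure_image (f := fun s : ℝ => x + s • e) hc
    (mem_image_of_mem _ h1)
  refine closure_mono ?_ h2
  rintro _ ⟨s, hs, rfl⟩
  exact hin s hs

/-- A positive solution of `-Δψ = f(ψ)` with zero boundary values on a bounded open set. -/
structure SemilinearSol (Ω : Set (EuclideanSpace ℝ (Fin N)))
    (ψ : EuclideanSpace ℝ (Fin N) → ℝ) (f : ℝ → ℝ) : Prop where
  dim : 2 ≤ N
  isOpen : IsOpen Ω
  bdd : Bornology.IsBounded Ω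
  reg : ContDiff ℝ 2 ψ
  freg : ContDiff ℝ 1 f
  mono : Monotone f
  fnonneg : ∀ t, 0 ≤ f t
  weq : WeakEq Ω ψ (fun x => f (ψ x))
  zero : ∀ x ∈ frontier Ω, ψ x = 0
  pos : ∀ x ∈ Ω, 0 < ψ x

namespace SemilinearSol

variable {Ω : Set (EuclideanSpace ℝ (Fin N))} {ψ : EuclideanSpace ℝ (Fin N) → ℝ} {f : ℝ → ℝ}
variable {e : EuclideanSpace ℝ (Fin N)}

theorem reg1 (S : SemilinearSol Ω ψ f) : ContDiff ℝ 1 ψ := S.reg.of_le (by norm_num)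

theorem nonneg (S : SemilinearSol Ω ψ f) : ∀ x ∈ closure Ω, 0 ≤ ψ x := fun x hx => by
  by_cases h : x ∈ Ω
  · exact (S.pos x h).le
  · rw [S.zero x]
    rw [S.isOpen.frontier_eq]; exact ⟨hx, h⟩

theorem exists_lipschitz (S : SemilinearSol Ω ψ f) : ∃ M : ℝ, 0 ≤ M ∧
    ∀ x ∈ Ω, ∀ y ∈ Ω, f (ψ y) - f (ψ x) ≤ M * |ψ y - ψ x| := by
  obtain ⟨B, hB⟩ := (S.bdd.isCompact_closure.image S.reg.continuous).isBounded.subset_closedBall 0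
  obtain ⟨K, hK⟩ := S.freg.contDiffOn.exists_lipschitzOnWith (n := 1) (s := closedBall (0:ℝ) B)
    one_ne_zero (convex_closedBall _ _) (isCompact_closedBall _ _)
  refine ⟨K, K.2, fun x hx y hy => ?_⟩
  have := hK.dist_le_mul _ (hB (mem_image_of_mem ψ (subset_closure hy))) _
    (hB (mem_image_of_mem ψ (subset_closure hx)))
  rw [Real.dist_eq, Real.dist_eq] at this
  exact (le_abs_self _).trans this

theorem reflected_reg (S : SemilinearSol Ω ψ f) (μ : ℝ) :
    ContDiff ℝ 1 (fun x => ψ (planeRefl e μ x) - ψ x) :=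
  (S.reg1.comp (contDiff_planeRefl e μ)).sub S.reg1

theorem reflected_rhs_continuous (S : SemilinearSol Ω ψ f) (μ : ℝ) :
    Continuous (fun x => f (ψ (planeRefl e μ x)) - f (ψ x)) := by
  have h1 := S.freg.continuous
  have h2 := S.reg.continuous
  have h3 := (contDiff_planeRefl (n := 0) e μ).continuous
  fun_prop

theorem reflected_weq (S : SemilinearSol Ω ψ f) (he : ‖e‖ = 1) (hs : SymDir Ω e) {μ : ℝ}
    (hμ : 0 < μ) : WeakEq {x | x ∈ Ω ∧ μ < inner ℝ x e} (fun x => ψ (planeRefl e μ x) - ψ x)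
      (fun x => f (ψ (planeRefl e μ x)) - f (ψ x)) := by
  have h1 := S.freg.continuous
  have h2 := S.reg.continuous
  have h3 := (contDiff_planeRefl (n := 0) e μ).continuous
  exact ((S.weq.comp_planeRefl S.reg1 he μ).mono
    (fun x hx => hs.planeRefl_mem hx.1 hμ.le hx.2.le)).sub (S.weq.mono fun x hx => hx.1)
    (S.reg1.comp (contDiff_planeRefl e μ)) S.reg1 (by fun_prop) (by fun_prop)

theorem isOpen_cap (S : SemilinearSol Ω ψ f) (e : EuclideanSpace ℝ (Fin N)) (μ : ℝ) :
    IsOpen {x | x ∈ Ω ∧ μ < inner ℝ x e} := by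
  have h : IsOpen {x : E | μ < inner ℝ x e} :=
    isOpen_lt continuous_const (continuous_id.inner continuous_const)
  exact S.isOpen.inter h

theorem reflected_boundary (S : SemilinearSol Ω ψ f) (hs : SymDir Ω e)
    {μ : ℝ} (hμ : 0 < μ) : ∀ x ∈ frontier {x | x ∈ Ω ∧ μ < inner ℝ x e},
      0 ≤ ψ (planeRefl e μ x) - ψ x := by
  intro x hx
  rw [(S.isOpen_cap e μ).frontier_eq] at hx
  obtain ⟨hxc, hxn⟩ := hx
  have h1 : μ ≤ inner ℝ x e := by
    have : closure {x | x ∈ Ω ∧ μ < inner ℝ x e} ⊆ {x | μ ≤ inner ℝ x e} :=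
      closure_minimal (fun x hx => hx.2.le)
        (isClosed_le continuous_const (continuous_id.inner continuous_const))
    exact this hxc
  rcases h1.eq_or_lt with h2 | h2
  · rw [planeRefl_of_inner_eq h2.symm, sub_self]
  · have hxΩ : x ∉ Ω := fun h => hxn ⟨h, h2⟩
    have hxcl : x ∈ closure Ω := closure_mono (fun y hy => hy.1) hxc
    rw [S.zero x (by rw [S.isOpen.frontier_eq]; exact ⟨hxcl, hxΩ⟩), sub_zero]
    refine S.nonneg _ ?_
    have h3 := image_closure_subset_closure_image
      (contDiff_planeRefl (n := 0) e μ).continuous (mem_image_of_mem _ hxc)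
    refine closure_mono ?_ h3
    rintro _ ⟨y, hy, rfl⟩
    exact hs.planeRefl_mem hy.1 hμ.le hy.2.le

/-- In a cap where the reflected difference is nonnegative it is positive. -/
theorem reflected_pos (S : SemilinearSol Ω ψ f) (he : ‖e‖ = 1) (hs : SymDir Ω e) {μ : ℝ}
    (hμ : 0 < μ) (h : ∀ x ∈ Ω, μ < inner ℝ x e → ψ x ≤ ψ (planeRefl e μ x)) :
    ∀ x ∈ Ω, μ < inner ℝ x e → ψ x < ψ (planeRefl e μ x) := by
  intro x hx hxμ
  refine lt_of_le_of_ne (h x hx hxμ) fun heq => ?_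
  obtain ⟨t, ht, hin, hfr⟩ := exists_exit S.isOpen S.bdd hx he
  have hinner : ∀ s : ℝ, inner ℝ (x + s • e) e = inner ℝ x e + s := by
    intro s
    rw [inner_add_left, inner_smul_left, real_inner_self_eq_norm_sq, he]; simp
  have hc : Continuous fun s : ℝ => x + s • e := by fun_prop
  have hz := eq_zero_of_superharmonic (S := (fun s : ℝ => x + s • e) '' Ico 0 t) S.dim
    (S.isOpen_cap e μ) (isPreconnected_Ico.image _ hc.continuousOn)
    (by
      rintro _ ⟨s, hs, rfl⟩
      refine ⟨hin s hs, ?_⟩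
      rw [hinner]; linarith [hs.1])
    (S.reflected_reg μ) (S.reflected_rhs_continuous μ) (S.reflected_weq he hs hμ)
    (fun y hy => sub_nonneg.mpr (h y hy.1 hy.2))
    (fun y hy => sub_nonneg.mpr (S.mono (h y hy.1 hy.2)))
    (x0 := x) ⟨0, ⟨le_rfl, ht⟩, by simp⟩ (by rw [heq, sub_self])
  have hzt : ψ (planeRefl e μ (x + t • e)) - ψ (x + t • e) = 0 := by
    have hcl : t ∈ closure (Ico 0 t) := by
      rw [closure_Ico ht.ne]; exact ⟨ht.le, le_rfl⟩
    have hcc : IsClosed {s : ℝ | ψ (planeRefl e μ (x + s • e)) - ψ (x + s • e) = 0} := by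
      refine isClosed_eq ?_ continuous_const
      exact (S.reflected_reg (e := e) μ).continuous.comp hc
    exact closure_minimal (fun s hs => hz _ ⟨s, hs, rfl⟩) hcc hcl
  rw [S.zero _ hfr, sub_zero] at hzt
  have hmem : planeRefl e μ (x + t • e) ∈ Ω := by
    set a := inner ℝ x e with ha
    set τ : ℝ := max 0 (t - μ) with hτ
    have hτ0 : 0 ≤ τ := le_max_left _ _
    have hτt : τ < t := max_lt ht (by linarith)
    have hτ2 : t - μ ≤ τ := le_max_right _ _
    have := hs _ (hin τ ⟨hτ0, hτt⟩) (2 * μ - (a + t)) (by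
      rw [hinner, abs_of_nonneg (show 0 ≤ a + τ by linarith), abs_le]
      constructor
      · linarith
      · linarith)
    convert this using 1
    rw [planeRefl, hinner, hinner]; module
  exact absurd hzt (S.pos _ hmem).ne'

theorem moving_planes (S : SemilinearSol Ω ψ f) (he : ‖e‖ = 1) (hs : SymDir Ω e) {μ : ℝ}
    (hμ : 0 < μ) : ∀ x ∈ Ω, μ < inner ℝ x e → ψ x ≤ ψ (planeRefl e μ x) := by
  set P : ℝ → Prop := fun μ => ∀ x ∈ Ω, μ < inner ℝ x e → ψ x ≤ ψ (planeRefl e μ x) with hP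
  obtain ⟨M, hM, hL⟩ := S.exists_lipschitz
  obtain ⟨δ, hδ, hW⟩ := small_max_principle S.dim M
  have hopen : ∀ μ, 0 < μ → P μ → ∃ ν < μ, ∀ ξ, ν < ξ → ξ ≤ μ → P ξ := by
    intro μ hμ hPμ
    have hpos := S.reflected_pos he hs hμ hPμ
    have hfin : volume {x | x ∈ Ω ∧ μ < inner ℝ x e} ≠ ⊤ :=
      isBounded_volume_ne_top (S.bdd.subset fun x hx => hx.1)
    obtain ⟨K, hKs, hKc, hKm⟩ := (S.isOpen_cap e μ).measurableSet.exists_isCompact_sdiff_lt hfin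
      (ε := ENNReal.ofReal δ) (by simpa using hδ)
    have hmeas : ∀ᶠ r in nhdsWithin (-μ) (Ioi (-μ)),
        volume ({x | x ∈ Ω ∧ -r < inner ℝ x e} \ K) < ENNReal.ofReal δ := by
      have htend := tendsto_measure_biInter_gt (μ := (volume : Measure E)) (a := -μ)
        (s := fun r => {x | x ∈ Ω ∧ -r < inner ℝ x e} \ K)
        (fun r _ => ((S.isOpen_cap e (-r)).measurableSet.diff
          hKc.isClosed.measurableSet).nullMeasurableSet)
        (fun i j _ hij x hx => ⟨⟨hx.1.1, by linarith [hx.1.2]⟩, hx.2⟩)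
        ⟨-μ + 1, by simp, isBounded_volume_ne_top (S.bdd.subset fun x hx => hx.1.1)⟩
      refine htend.eventually_lt_const ?_
      refine lt_of_le_of_lt ?_ hKm
      refine (measure_mono (t := ({x | x ∈ Ω ∧ μ < inner ℝ x e} \ K) ∪
        {x : E | inner ℝ x e = μ}) ?_).trans ?_
      · intro x hx
        simp only [mem_iInter] at hx
        have h1 := hx (-μ + 1) (by simp)
        have h2 : μ ≤ inner ℝ x e := by
          refine le_of_forall_pos_le_add fun ε hε => ?_
          have := (hx (-μ + ε) (by simpa using hε)).1.2
          linarith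
        rcases h2.eq_or_lt with h3 | h3
        · exact Or.inr h3.symm
        · exact Or.inl ⟨⟨h1.1.1, h3⟩, h1.2⟩
      · refine (measure_union_le _ _).trans ?_
        rw [volume_hyperplane he, add_zero]
    have hK2 : ∀ᶠ ξ in nhds μ, ∀ x ∈ K, ψ x < ψ (planeRefl e ξ x) := by
      have hcont : Continuous fun q : ℝ × E => ψ (planeRefl e q.1 q.2) - ψ q.2 := by
        have := S.reg.continuous
        have := continuous_planeRefl (N := N) e
        fun_prop
      have ho : IsOpen {q : ℝ × E | 0 < ψ (planeRefl e q.1 q.2) - ψ q.2} :=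
        isOpen_lt continuous_const hcont
      have := hKc.eventually_forall_of_forall_eventually (x₀ := μ)
        (P := fun ξ x => ψ x < ψ (planeRefl e ξ x)) (fun x hx => by
          have hx0 : (μ, x) ∈ {q : ℝ × E | 0 < ψ (planeRefl e q.1 q.2) - ψ q.2} :=
            sub_pos.mpr (hpos x (hKs hx).1 (hKs hx).2)
          filter_upwards [ho.mem_nhds hx0] with z hz
          exact sub_pos.mp hz)
      exact this
    obtain ⟨r, hr, hrm⟩ := (mem_nhdsGT_iff_exists_Ioo_subset).mp hmeas
    obtain ⟨ε, hε, hεb⟩ := Metric.eventually_nhds_iff.mp hK2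
    rw [mem_Ioi] at hr
    refine ⟨max (max (-r) (μ - ε)) 0, max_lt (max_lt (by linarith) (by linarith)) hμ, ?_⟩
    intro ξ hξ hξμ
    rcases hξμ.eq_or_lt with rfl | hξμ
    · exact hPμ
    have hξ0 : 0 < ξ := lt_of_le_of_lt (le_max_right _ _) hξ
    have hξr : -r < ξ := lt_of_le_of_lt ((le_max_left _ _).trans (le_max_left _ _)) hξ
    have hξε : μ - ε < ξ := lt_of_le_of_lt ((le_max_right _ _).trans (le_max_left _ _)) hξ
    have hKξ := hεb (y := ξ) (by rw [Real.dist_eq, abs_lt]; constructor <;> linarith)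
    have hsm : volume ({x | x ∈ Ω ∧ ξ < inner ℝ x e} \ K) < ENNReal.ofReal δ := by
      have := hrm (show -ξ ∈ Ioo (-μ) r by constructor <;> linarith)
      simpa using this
    have hUo : IsOpen ({x | x ∈ Ω ∧ ξ < inner ℝ x e} \ K) :=
      (S.isOpen_cap e ξ).sdiff hKc.isClosed
    have hUb : Bornology.IsBounded ({x | x ∈ Ω ∧ ξ < inner ℝ x e} \ K) :=
      S.bdd.subset fun x hx => hx.1.1
    have hres := hW ({x | x ∈ Ω ∧ ξ < inner ℝ x e} \ K) _ _ hUo hUb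
      (by
        rw [Measure.real]
        exact (ENNReal.lt_ofReal_iff_toReal_lt (isBounded_volume_ne_top hUb)).mp hsm)
      (S.reflected_reg (e := e) ξ) (S.reflected_rhs_continuous (e := e) ξ)
      ((S.reflected_weq he hs hξ0).mono sdiff_subset)
      (fun x hx hlt => by
        have := hL _ (hs.planeRefl_mem hx.1.1 hξ0.le hx.1.2.le) x hx.1.1
        rw [abs_of_pos (by linarith)] at this
        linarith)
      (fun x hx => by
        by_cases hxK : x ∈ K
        · exact sub_nonneg.mpr (hKξ x hxK).le
        · refine S.reflected_boundary hs hξ0 x ?_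
          rw [hUo.frontier_eq] at hx
          rw [(S.isOpen_cap e ξ).frontier_eq]
          exact ⟨closure_mono sdiff_subset hx.1, fun h => hx.2 ⟨h, hxK⟩⟩)
    intro x hx hxξ
    by_cases hxK : x ∈ K
    · exact (hKξ x hxK).le
    · exact sub_nonneg.mp (hres x ⟨⟨hx, hxξ⟩, hxK⟩)
  by_contra hnot
  obtain ⟨R, hR⟩ := S.bdd.subset_closedBall 0
  have hlarge : ∀ ν, R ≤ ν → P ν := by
    intro ν hν x hx hxν
    have h1 := hR hx
    rw [mem_closedBall, dist_zero_right] at h1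
    have := real_inner_le_norm x e
    rw [he, mul_one] at this
    linarith
  set T : Set ℝ := {ν | μ ≤ ν ∧ ¬ P ν} with hT
  have hTb : BddAbove T := ⟨R, fun ν hν => by
    by_contra h
    exact hν.2 (hlarge ν (not_le.mp h).le)⟩
  have hμT : μ ∈ T := ⟨le_rfl, hnot⟩
  have hμs : μ ≤ sSup T := le_csSup hTb hμT
  have hPgt : ∀ ν, sSup T < ν → P ν := by
    intro ν hν
    by_contra h
    exact absurd (le_csSup hTb ⟨hμs.trans hν.le, h⟩) (not_le.mpr hν)
  have hPs : P (sSup T) := by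
    intro x hx hxs
    have hc : Continuous fun ν : ℝ => ψ (planeRefl e ν x) := by
      have := S.reg.continuous
      have := continuous_planeRefl (N := N) e
      fun_prop
    have ht : Filter.Tendsto (fun ν : ℝ => ψ (planeRefl e ν x)) (nhdsWithin (sSup T) (Ioi (sSup T)))
        (nhds (ψ (planeRefl e (sSup T) x))) := (hc.tendsto _).mono_left nhdsWithin_le_nhds
    refine ge_of_tendsto ht ?_
    filter_upwards [Ioo_mem_nhdsGT hxs] with ν hν
    exact hPgt ν hν.1 x hx hν.2
  obtain ⟨ν, hν, hνP⟩ := hopen _ (hμ.trans_le hμs) hPs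
  obtain ⟨ξ, hξ, hξν⟩ := exists_lt_of_lt_csSup ⟨μ, hμT⟩ hν
  exact hξ.2 (hνP ξ hξν (le_csSup hTb hξ))

end SemilinearSol
end Reflection

section Derivative
variable {N : ℕ}
local notation "E" => EuclideanSpace ℝ (Fin N)

theorem hasDerivAt_integral_translate {u k : E → ℝ} (hu : ContDiff ℝ 1 u) (hk : Continuous k)
    (hc : HasCompactSupport k) (e : E) :
    HasDerivAt (fun τ : ℝ => ∫ x, u (x + τ • e) * k x) (∫ x, fderiv ℝ u x e * k x) 0 := by
  have hfc : Continuous fun y => fderiv ℝ u y e :=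
    (hu.continuous_fderiv one_ne_zero).clm_apply continuous_const
  have hcpt : IsCompact ((fun q : ℝ × E => q.2 + q.1 • e) '' (closedBall (0:ℝ) 1 ×ˢ tsupport k)) :=
    ((isCompact_closedBall _ _).prod hc).image (by fun_prop)
  obtain ⟨B, hB⟩ := (hcpt.image hfc).isBounded.subset_closedBall 0
  have hmain := hasDerivAt_integral_of_dominated_loc_of_deriv_le (μ := (volume : Measure E))
    (F := fun τ x => u (x + τ • e) * k x) (F' := fun τ x => fderiv ℝ u (x + τ • e) e * k x)
    (x₀ := (0:ℝ)) (s := ball 0 1) (bound := fun x => B * |k x|) (ball_mem_nhds _ one_pos)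
    (Filter.Eventually.of_forall fun τ => by
      have := hu.continuous
      exact Continuous.aestronglyMeasurable (by fun_prop))
    (by
      have := hu.continuous
      refine Continuous.integrable_of_hasCompactSupport (by fun_prop) hc.mul_left)
    (Continuous.aestronglyMeasurable (by fun_prop))
    (Filter.Eventually.of_forall fun x τ hτ => by
      rw [norm_mul, Real.norm_eq_abs (k x)]
      by_cases hx : x ∈ tsupport k
      · gcongr
        have := hB (mem_image_of_mem _ (mem_image_of_mem (fun q : ℝ × E => q.2 + q.1 • e)
          (show (τ, x) ∈ closedBall (0:ℝ) 1 ×ˢ tsupport k from ⟨ball_subset_closedBall hτ, hx⟩)))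
        simpa using this
      · simp [image_eq_zero_of_notMem_tsupport hx])
    (by
      refine Continuous.integrable_of_hasCompactSupport (by fun_prop) ?_
      refine (hc.comp_left (g := fun t : ℝ => |t|) (by simp)).mul_left)
    (Filter.Eventually.of_forall fun x τ _ => by
      have hl : HasDerivAt (fun t : ℝ => x + t • e) e τ := by
        simpa using ((hasDerivAt_id τ).smul_const e).const_add x
      have h1 := (hu.differentiable one_ne_zero (x + τ • e)).hasFDerivAt
      have h2 : HasDerivAt (fun t : ℝ => u (x + t • e)) (fderiv ℝ u (x + τ • e) e) τ :=
        HasFDerivAt.comp_hasDerivAt τ h1 hl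
      exact h2.mul_const _)
  simpa using hmain.2

theorem fderiv_fderiv_comm {ψ : E → ℝ} (hψ : ContDiff ℝ 2 ψ) (x a b : E) :
    fderiv ℝ (fun y => fderiv ℝ ψ y a) x b = fderiv ℝ (fun y => fderiv ℝ ψ y b) x a := by
  have hd : DifferentiableAt ℝ (fderiv ℝ ψ) x :=
    (hψ.fderiv_right (m := 1) (by norm_num)).differentiable one_ne_zero x
  have key : ∀ w : E, fderiv ℝ (fun y => fderiv ℝ ψ y w) x =
      (fderiv ℝ (fderiv ℝ ψ) x).flip w := by
    intro w
    rw [fderiv_clm_apply hd (differentiableAt_const w)]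
    simp
  rw [key, key]
  simp only [ContinuousLinearMap.flip_apply]
  exact (hψ.contDiffAt.isSymmSndFDerivAt (by simp)).eq b a

theorem contDiff_fderiv_apply {ψ : E → ℝ} (hψ : ContDiff ℝ 2 ψ) (e : E) :
    ContDiff ℝ 1 fun x => fderiv ℝ ψ x e :=
  (hψ.fderiv_right (m := 1) (by norm_num)).clm_apply contDiff_const

/-- Directional derivatives of solutions satisfy the linearized equation. -/
theorem WeakEq.fderiv_apply {U : Set E} (hU : IsOpen U) {ψ : E → ℝ} {g : E → ℝ}
    (hψ : ContDiff ℝ 2 ψ) (hg : ContDiff ℝ 1 g) (hw : WeakEq U ψ g) (e : E) :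
    WeakEq U (fun x => fderiv ℝ ψ x e) (fun x => fderiv ℝ g x e) := by
  intro η h1 h2 h3
  have hψ1 : ContDiff ℝ 1 ψ := hψ.of_le (by norm_num)
  have hη' : ∀ i : Fin N, Continuous (fun y => fderiv ℝ η y (EuclideanSpace.single i (1:ℝ))) :=
    fun i => (h1.continuous_fderiv one_ne_zero).clm_apply continuous_const
  have hcη : ∀ i : Fin N, HasCompactSupport
      (fun y => fderiv ℝ η y (EuclideanSpace.single i (1:ℝ))) := fun i =>
    (h2.fderiv (𝕜 := ℝ)).comp_left (g := fun L : E →L[ℝ] ℝ => L (EuclideanSpace.single i (1:ℝ)))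
      (by simp)
  have hL : HasDerivAt (fun τ : ℝ => ∑ i : Fin N, ∫ x,
      fderiv ℝ ψ (x + τ • e) (EuclideanSpace.single i 1) *
        fderiv ℝ η x (EuclideanSpace.single i 1))
      (∑ i : Fin N, ∫ x, fderiv ℝ (fun y => fderiv ℝ ψ y (EuclideanSpace.single i 1)) x e *
        fderiv ℝ η x (EuclideanSpace.single i 1)) 0 :=
    HasDerivAt.fun_sum fun i _ => hasDerivAt_integral_translate
      (contDiff_fderiv_apply hψ (EuclideanSpace.single i 1)) (hη' i) (hcη i) e
  have hR := hasDerivAt_integral_translate hg h1.continuous h2 e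
  have heq : (fun τ : ℝ => ∑ i : Fin N, ∫ x,
      fderiv ℝ ψ (x + τ • e) (EuclideanSpace.single i 1) *
        fderiv ℝ η x (EuclideanSpace.single i 1)) =ᶠ[nhds 0]
      fun τ : ℝ => ∫ x, g (x + τ • e) * η x := by
    have hcov : ∀ᶠ τ : ℝ in nhds 0, ∀ x ∈ tsupport η, x + τ • e ∈ U := by
      have hj : Continuous fun q : ℝ × E => q.2 + q.1 • e := by fun_prop
      refine h2.eventually_forall_of_forall_eventually (x₀ := (0:ℝ))
        (P := fun τ x => x + τ • e ∈ U) fun x hx => ?_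
      exact (hU.preimage hj).mem_nhds (show (0, x).2 + (0:ℝ) • e ∈ U by simpa using h3 hx)
    filter_upwards [hcov] with τ hτ
    have hw' := hw.comp_isometry hψ1 (LinearIsometryEquiv.refl ℝ E) (τ • e) η h1 h2
      (fun x hx => hτ x hx)
    simp only [LinearIsometryEquiv.coe_refl, id_eq] at hw'
    rw [← hw', ← integral_finsetSum]
    · congr 1; ext x
      have hgr := gradient_comp_isometry (LinearIsometryEquiv.refl ℝ E) (τ • e) (v := ψ) (x := x)
        (hψ1.differentiable one_ne_zero _)
      simp only [LinearIsometryEquiv.coe_refl, id_eq] at hgr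
      change _ = gradient ψ (x + τ • e) at hgr
      rw [hgr]
      have := inner_gradient_eq_sum (fun y => ψ (y + τ • e)) η x
      rw [hgr] at this
      rw [this]
      simp only [fderiv_comp_add_right]
    · intro i _
      have hq := (contDiff_fderiv_apply hψ (EuclideanSpace.single i (1:ℝ))).continuous
      have := hη' i
      exact Continuous.integrable_of_hasCompactSupport (by fun_prop) (hcη i).mul_left
  rw [← (hL.congr_of_eventuallyEq heq.symm).unique hR, ← integral_finsetSum]
  · congr 1; ext x
    rw [inner_gradient_eq_sum]
    exact Finset.sum_congr rfl fun i _ => by rw [fderiv_fderiv_comm hψ]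
  · intro i _
    have hq : Continuous fun x => fderiv ℝ (fun y => fderiv ℝ ψ y (EuclideanSpace.single i 1)) x e :=
      ((contDiff_fderiv_apply hψ (EuclideanSpace.single i (1:ℝ))).continuous_fderiv
        one_ne_zero).clm_apply continuous_const
    exact (hq.mul (hη' i)).integrable_of_hasCompactSupport (hcη i).mul_left

namespace SemilinearSol

variable {Ω : Set (EuclideanSpace ℝ (Fin N))} {ψ : EuclideanSpace ℝ (Fin N) → ℝ} {f : ℝ → ℝ}
variable {e : EuclideanSpace ℝ (Fin N)}

theorem planeRefl_eq (S : SemilinearSol Ω ψ f) (he : ‖e‖ = 1) (hs : SymDir Ω e) :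
    ∀ x ∈ Ω, ψ (planeRefl e 0 x) = ψ x := by
  have half : ∀ e : E, ‖e‖ = 1 → SymDir Ω e → ∀ x ∈ Ω, 0 < inner ℝ x e →
      ψ x ≤ ψ (planeRefl e 0 x) := by
    intro e he hs x hx hxe
    have hc : Continuous fun ν : ℝ => ψ (planeRefl e ν x) := by
      have := S.reg.continuous
      have := continuous_planeRefl (N := N) e
      fun_prop
    have ht : Filter.Tendsto (fun ν : ℝ => ψ (planeRefl e ν x)) (nhdsWithin 0 (Ioi 0))
        (nhds (ψ (planeRefl e 0 x))) := (hc.tendsto _).mono_left nhdsWithin_le_nhds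
    refine ge_of_tendsto ht ?_
    filter_upwards [Ioo_mem_nhdsGT hxe] with ν hν
    exact S.moving_planes he hs hν.1 x hx hν.2
  have two : ∀ x ∈ Ω, ψ x ≤ ψ (planeRefl e 0 x) := by
    intro x hx
    rcases lt_trichotomy (inner ℝ x e) 0 with h | h | h
    · have := half (-e) (by rwa [norm_neg]) hs.neg x hx (by rw [inner_neg_right]; linarith)
      rwa [planeRefl_neg] at this
    · rw [planeRefl_of_inner_eq h]
    · exact half e he hs x hx h
  intro x hx
  refine le_antisymm ?_ (two x hx)
  have := two _ (hs.planeRefl_zero_mem hx)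
  rwa [planeRefl_planeRefl he] at this

theorem coeff_continuous (S : SemilinearSol Ω ψ f) : Continuous fun x => deriv f (ψ x) :=
  (S.freg.continuous_deriv le_rfl).comp S.reg.continuous

theorem coeff_nonneg (S : SemilinearSol Ω ψ f) (x : EuclideanSpace ℝ (Fin N)) :
    0 ≤ deriv f (ψ x) := S.mono.deriv_nonneg

theorem coeff_bound (S : SemilinearSol Ω ψ f) : ∃ M : ℝ, 0 ≤ M ∧ ∀ x ∈ Ω, deriv f (ψ x) ≤ M := by
  obtain ⟨B, hB⟩ := (S.bdd.isCompact_closure.image S.coeff_continuous).isBounded.subset_closedBall 0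
  refine ⟨|B|, abs_nonneg _, fun x hx => ?_⟩
  have := hB (mem_image_of_mem _ (subset_closure hx))
  simp only [mem_closedBall, dist_zero_right, Real.norm_eq_abs] at this
  exact (le_abs_self _).trans (this.trans (le_abs_self _))

theorem slope_reg (S : SemilinearSol Ω ψ f) : ContDiff ℝ 1 fun x => - fderiv ℝ ψ x e :=
  (contDiff_fderiv_apply S.reg e).neg

theorem slope_weq (S : SemilinearSol Ω ψ f) : WeakEq Ω (fun x => - fderiv ℝ ψ x e)
    (fun x => deriv f (ψ x) * - fderiv ℝ ψ x e) := by
  have h := (WeakEq.fderiv_apply S.isOpen S.reg (S.freg.comp S.reg1) S.weq e).neg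
    (contDiff_fderiv_apply S.reg e)
  refine h.congr fun x _ => ?_
  have h1 : HasFDerivAt (f ∘ ψ) (deriv f (ψ x) • fderiv ℝ ψ x) x :=
    (S.freg.differentiable one_ne_zero _).hasDerivAt.comp_hasFDerivAt x
      (S.reg1.differentiable one_ne_zero x).hasFDerivAt
  rw [h1.fderiv]; simp

theorem slope_nonneg (S : SemilinearSol Ω ψ f) (he : ‖e‖ = 1) (hs : SymDir Ω e) :
    ∀ x ∈ Ω, 0 < inner ℝ x e → 0 ≤ - fderiv ℝ ψ x e := by
  intro x hx hxe
  have hl : HasDerivAt (fun t : ℝ => x + t • (-e)) (-e) 0 := by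
    simpa using ((hasDerivAt_id (0:ℝ)).smul_const (-e)).const_add x
  have h1 : HasFDerivAt ψ (fderiv ℝ ψ x) (x + (0:ℝ) • (-e)) := by
    simpa using (S.reg1.differentiable one_ne_zero x).hasFDerivAt
  have h2 : HasDerivAt (fun t : ℝ => ψ (x + t • (-e))) (fderiv ℝ ψ x (-e)) 0 :=
    HasFDerivAt.comp_hasDerivAt (0:ℝ) h1 hl
  rw [← map_neg]
  have h3 := h2.hasDerivWithinAt (s := Ioi 0)
  rw [hasDerivWithinAt_iff_tendsto_slope' (by simp)] at h3
  refine ge_of_tendsto h3 ?_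
  filter_upwards [Ioo_mem_nhdsGT hxe] with t ht
  rw [slope_def_field]
  refine div_nonneg ?_ (by linarith [ht.1])
  have := S.moving_planes he hs (μ := inner ℝ x e - t / 2) (by linarith [ht.1, ht.2]) x hx
    (by linarith [ht.1])
  have e1 : planeRefl e (inner ℝ x e - t / 2) x = x + t • (-e) := by
    rw [planeRefl]; module
  rw [e1] at this
  simp only [zero_smul, add_zero]
  linarith

theorem slope_pos (S : SemilinearSol Ω ψ f) (he : ‖e‖ = 1) (hs : SymDir Ω e) :
    ∀ x ∈ Ω, 0 < inner ℝ x e → 0 < - fderiv ℝ ψ x e := by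
  intro x hx hxe
  have hnn := S.slope_nonneg he hs
  refine lt_of_le_of_ne (hnn x hx hxe) fun heq => ?_
  obtain ⟨t, ht, hin, hfr⟩ := exists_exit S.isOpen S.bdd hx he
  have hinner : ∀ s : ℝ, inner ℝ (x + s • e) e = inner ℝ x e + s := by
    intro s
    rw [inner_add_left, inner_smul_left, real_inner_self_eq_norm_sq, he]; simp
  have hc : Continuous fun s : ℝ => x + s • e := by fun_prop
  have hz := eq_zero_of_superharmonic (S := (fun s : ℝ => x + s • e) '' Ico 0 t) S.dim
    (S.isOpen_cap e 0) (isPreconnected_Ico.image _ hc.continuousOn)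
    (by
      rintro _ ⟨s, hs, rfl⟩
      refine ⟨hin s hs, ?_⟩
      rw [hinner]; linarith [hs.1])
    (S.slope_reg (e := e)) (S.coeff_continuous.mul S.slope_reg.continuous)
    (S.slope_weq.mono fun y hy => hy.1)
    (fun y hy => hnn y hy.1 hy.2)
    (fun y hy => mul_nonneg (S.coeff_nonneg y) (hnn y hy.1 hy.2))
    (x0 := x) ⟨0, ⟨le_rfl, ht⟩, by simp⟩ heq.symm
  have hd : ∀ s : ℝ, HasDerivAt (fun t : ℝ => ψ (x + t • e)) (fderiv ℝ ψ (x + s • e) e) s := by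
    intro s
    have hl : HasDerivAt (fun t : ℝ => x + t • e) e s := by
      simpa using ((hasDerivAt_id s).smul_const e).const_add x
    exact HasFDerivAt.comp_hasDerivAt s
      (S.reg1.differentiable one_ne_zero (x + s • e)).hasFDerivAt hl
  have hconst := constant_of_has_deriv_right_zero (f := fun t : ℝ => ψ (x + t • e)) (a := 0)
    (b := t) (S.reg.continuous.comp hc).continuousOn (fun s hs => by
      have h0 := hz _ ⟨s, hs, rfl⟩
      have h1 := (hd s).hasDerivWithinAt (s := Ici s)
      rwa [neg_eq_zero.mp h0] at h1) t ⟨ht.le, le_rfl⟩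
  simp only [zero_smul, add_zero] at hconst
  rw [S.zero _ hfr] at hconst
  exact absurd hconst (S.pos x hx).ne

end SemilinearSol
end Derivative

section Linearized
variable {N : ℕ}
local notation "E" => EuclideanSpace ℝ (Fin N)

/-- In direction `e` the domain has an extremal boundary point with an interior touching ball. -/
def HasTopPoint (Ω : Set E) (e : E) : Prop :=
  ∃ (y : E) (r : ℝ), 0 < r ∧ y ∈ frontier Ω ∧ (∀ x ∈ Ω, inner ℝ x e ≤ inner ℝ y e) ∧
    ball (y - r • e) r ⊆ Ω

/-- A solution of the linearized equation `-Δφ = f'(ψ) φ` with zero boundary values. -/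
structure LinearizedSol (Ω : Set E) (ψ : E → ℝ) (f : ℝ → ℝ) (φ : E → ℝ) : Prop where
  reg : ContDiff ℝ 1 φ
  weq : WeakEq Ω φ (fun x => deriv f (ψ x) * φ x)
  zero : ∀ x ∈ frontier Ω, φ x = 0

theorem mem_of_mem_closure_of_ne_zero {D : Set E} (hD : IsOpen D) {φ : E → ℝ}
    (h0 : ∀ x ∈ frontier D, φ x = 0) {x : E} (hx : x ∈ closure D) (hne : φ x ≠ 0) : x ∈ D := by
  by_contra h
  exact hne (h0 x (by rw [hD.frontier_eq]; exact ⟨hx, h⟩))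

theorem LinearizedSol.neg {Ω : Set E} {ψ φ : E → ℝ} {f : ℝ → ℝ} (L : LinearizedSol Ω ψ f φ) :
    LinearizedSol Ω ψ f (fun x => - φ x) where
  reg := L.reg.neg
  weq := (L.weq.neg L.reg).congr fun x _ => by ring
  zero := fun x hx => by rw [L.zero x hx, neg_zero]

namespace SemilinearSol

variable {Ω : Set (EuclideanSpace ℝ (Fin N))} {ψ : EuclideanSpace ℝ (Fin N) → ℝ} {f : ℝ → ℝ}
variable {e : EuclideanSpace ℝ (Fin N)}

/-- A nodal domain cannot be contained in a half of a symmetric domain. -/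
theorem nodal_not_in_cap (S : SemilinearSol Ω ψ f) (he : ‖e‖ = 1) (hs : SymDir Ω e)
    (hconn : IsPreconnected {x | x ∈ Ω ∧ 0 < inner ℝ x e}) (hTop : HasTopPoint Ω e)
    {φ : EuclideanSpace ℝ (Fin N) → ℝ} (hφ : ContDiff ℝ 1 φ)
    {D : Set (EuclideanSpace ℝ (Fin N))} (hD : IsOpen D)
    (hDc : D ⊆ {x | x ∈ Ω ∧ 0 < inner ℝ x e}) (hw : WeakEq D φ (fun x => deriv f (ψ x) * φ x))
    (hpos : ∀ x ∈ D, 0 < φ x) (h0 : ∀ x ∈ frontier D, φ x = 0) : D = ∅ := by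
  by_contra hne
  obtain ⟨x1, hx1⟩ := nonempty_iff_ne_empty.mpr hne
  have hDb : Bornology.IsBounded D := S.bdd.subset fun x hx => (hDc hx).1
  set h : E → ℝ := fun x => - fderiv ℝ ψ x e with hh
  have hreg : ContDiff ℝ 1 h := S.slope_reg
  have hhpos : ∀ x ∈ {x | x ∈ Ω ∧ 0 < inner ℝ x e}, 0 < h x := fun x hx =>
    S.slope_pos he hs x hx.1 hx.2
  have hhnn : ∀ x ∈ closure D, 0 ≤ h x := fun x hx =>
    closure_minimal (fun y hy => (hhpos y (hDc hy)).le)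
      (isClosed_le continuous_const hreg.continuous) hx
  have hφnn : ∀ x ∈ closure D, 0 ≤ φ x := fun x hx =>
    closure_minimal (fun y hy => (hpos y hy).le) (isClosed_le continuous_const hφ.continuous) hx
  obtain ⟨M, hM0, hM⟩ := S.coeff_bound
  obtain ⟨δ, hδ, hsmall⟩ := small_max_principle S.dim M
  obtain ⟨K, hKs, hKc, hKm⟩ := (S.isOpen_cap e 0).measurableSet.exists_isCompact_sdiff_lt
    (isBounded_volume_ne_top (S.bdd.subset fun x hx => hx.1))
    (ε := ENNReal.ofReal δ) (by simpa using hδ)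
  have hvreg : ∀ k : ℝ, ContDiff ℝ 1 fun x => k * h x - φ x := fun k =>
    (contDiff_const.mul hreg).sub hφ
  have hcc := S.coeff_continuous
  have hvc : ∀ k : ℝ, Continuous fun x => deriv f (ψ x) * (k * h x - φ x) := fun k =>
    hcc.mul (hvreg k).continuous
  have hvw : ∀ k : ℝ, WeakEq D (fun x => k * h x - φ x)
      (fun x => deriv f (ψ x) * (k * h x - φ x)) := fun k =>
    (((S.slope_weq.mono fun y hy => (hDc hy).1).const_mul hreg k).sub hw
      (contDiff_const.mul hreg) hφ
      (continuous_const.mul (hcc.mul hreg.continuous)) (hcc.mul hφ.continuous)).congr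
      fun x _ => by simp only [hh]; ring
  have hbelow : ∀ k : ℝ, 0 ≤ k → (∀ x ∈ K ∩ closure D, φ x ≤ k * h x) →
      ∀ x ∈ D, φ x ≤ k * h x := by
    intro k hk hKk x hx
    by_cases hxK : x ∈ K
    · exact hKk x ⟨hxK, subset_closure hx⟩
    have hDK : IsOpen (D \ K) := hD.sdiff hKc.isClosed
    have := hsmall (D \ K) (fun x => k * h x - φ x) _ hDK (hDb.subset sdiff_subset)
      (by
        rw [Measure.real]
        refine ENNReal.toReal_lt_of_lt_ofReal (lt_of_le_of_lt (measure_mono ?_) hKm)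
        exact sdiff_subset_sdiff_left hDc)
      (hvreg k) (hvc k) ((hvw k).mono sdiff_subset)
      (fun y hy hneg => by
        have := hM y (hDc hy.1).1
        nlinarith)
      (fun y hy => by
        rw [hDK.frontier_eq] at hy
        have hyD : y ∈ closure D := closure_mono sdiff_subset hy.1
        by_cases hyK : y ∈ K
        · have := hKk y ⟨hyK, hyD⟩
          linarith
        · have : φ y = 0 := h0 y (by
            rw [hD.frontier_eq]
            exact ⟨hyD, fun hyD => hy.2 ⟨hyD, hyK⟩⟩)
          have := mul_nonneg hk (hhnn y hyD)
          linarith) x ⟨hx, hxK⟩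
    linarith
  have hKD : IsCompact (K ∩ closure D) := hKc.inter_right isClosed_closure
  have hKD0 : (K ∩ closure D).Nonempty := by
    by_contra hemp
    rw [not_nonempty_iff_eq_empty] at hemp
    have := hbelow 0 le_rfl (by simp [hemp]) x1 hx1
    have := hpos x1 hx1
    linarith
  obtain ⟨x0, hx0, hmax⟩ := hKD.exists_isMaxOn hKD0 (f := fun x => φ x / h x)
    (hφ.continuous.continuousOn.div hreg.continuous.continuousOn
      fun x hx => (hhpos x (hKs hx.1)).ne')
  set k : ℝ := φ x0 / h x0 with hk
  have hk0 : 0 ≤ k := div_nonneg (hφnn x0 hx0.2) (hhnn x0 hx0.2)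
  have hle : ∀ x ∈ D, φ x ≤ k * h x := hbelow k hk0 fun x hx => by
    have := hmax hx
    simp only [mem_ofPred_eq] at this
    rwa [div_le_iff₀ (hhpos x (hKs hx.1))] at this
  have hkpos : 0 < k := by
    refine lt_of_le_of_ne hk0 fun h => ?_
    have h1 := hle x1 hx1
    have h2 := hpos x1 hx1
    rw [← h, zero_mul] at h1
    linarith
  have hx0e : φ x0 = k * h x0 := by
    rw [hk, div_mul_cancel₀]; exact (hhpos x0 (hKs hx0.1)).ne'
  have hA := eq_zero_near_of_superharmonic S.dim hD (hvreg k) (hvc k) (hvw k)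
    (fun x hx => by have := hle x hx; linarith)
    (fun x hx => mul_nonneg (S.coeff_nonneg x) (by have := hle x hx; linarith))
  have hstep : ∀ x ∈ {x | x ∈ Ω ∧ 0 < inner ℝ x e}, x ∈ closure D → k * h x - φ x = 0 →
      x ∈ {x | x ∈ D ∧ k * h x - φ x = 0} := by
    intro x hx hxD hx'
    refine ⟨mem_of_mem_closure_of_ne_zero hD h0 hxD ?_, hx'⟩
    have := mul_pos hkpos (hhpos x hx)
    intro h; linarith
  have hcl : closure {x | x ∈ D ∧ k * h x - φ x = 0} ⊆ {x | x ∈ closure D ∧ k * h x - φ x = 0} :=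
    closure_minimal (fun x hx => ⟨subset_closure hx.1, hx.2⟩)
      (isClosed_closure.inter (isClosed_eq (hvreg k).continuous continuous_const))
  have hsub := hconn.subset_of_closure_inter_subset hA
    ⟨x0, hKs hx0.1, hstep x0 (hKs hx0.1) hx0.2 (by linarith)⟩
    (fun x hx => hstep x hx.2 (hcl hx.1).1 (hcl hx.1).2)
  obtain ⟨y, r, hr, hyf, hytop, hball⟩ := hTop
  rw [S.isOpen.frontier_eq] at hyf
  have hype : 0 < inner ℝ y e := (hDc hx1).2.trans_le (hytop x1 (hDc hx1).1)
  have hyc : y ∈ closure {x | x ∈ Ω ∧ 0 < inner ℝ x e} := by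
    have h1 : IsOpen {x : E | 0 < inner ℝ x e} :=
      isOpen_lt continuous_const (continuous_id.inner continuous_const)
    have := h1.inter_closure (t := Ω) ⟨hype, hyf.1⟩
    rwa [inter_comm] at this
  have hy := hcl (closure_mono hsub hyc)
  have hφy : φ y = 0 := h0 y (by
    rw [hD.frontier_eq]; exact ⟨hy.1, fun h => hyf.2 (hDc h).1⟩)
  have hhy : h y = 0 := by
    have := hy.2
    rw [hφy, sub_zero] at this
    exact (mul_eq_zero.mp this).resolve_left hkpos.ne'
  have hhopf := hopf_lemma S.dim hr S.reg1 (S.freg.continuous.comp S.reg.continuous)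
    (S.weq.mono hball) (fun x _ => S.fnonneg _) (fun x hx => S.pos x (hball hx))
    (z := y) (S.zero y (by rw [S.isOpen.frontier_eq]; exact hyf))
    (by rw [dist_eq_norm, sub_sub_cancel, norm_smul, he, mul_one, Real.norm_eq_abs, abs_of_pos hr])
  rw [sub_sub_cancel_left, ← smul_neg, map_smul, map_neg, smul_eq_mul] at hhopf
  have : r * h y > 0 := hhopf
  rw [hhy] at this
  linarith

theorem planeRefl_frontier (S : SemilinearSol Ω ψ f) (he : ‖e‖ = 1) (hs : SymDir Ω e)
    {x : EuclideanSpace ℝ (Fin N)} (hx : x ∈ frontier Ω) : planeRefl e 0 x ∈ frontier Ω := by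
  rw [S.isOpen.frontier_eq] at hx ⊢
  refine ⟨?_, fun h => hx.2 ?_⟩
  · have := (continuous_planeRefl (N := N) e).comp (continuous_const (y := (0:ℝ))|>.prodMk continuous_id)
    exact map_mem_closure (f := planeRefl e 0) this hx.1 fun y hy => hs.planeRefl_zero_mem hy
  · have := hs.planeRefl_zero_mem h
    rwa [planeRefl_planeRefl he] at this

theorem linearized_even (S : SemilinearSol Ω ψ f) (he : ‖e‖ = 1) (hs : SymDir Ω e)
    (hconn : IsPreconnected {x | x ∈ Ω ∧ 0 < inner ℝ x e}) (hTop : HasTopPoint Ω e)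
    {φ : EuclideanSpace ℝ (Fin N) → ℝ} (L : LinearizedSol Ω ψ f φ) :
    ∀ x ∈ Ω, φ (planeRefl e 0 x) = φ x := by
  have half : ∀ φ : E → ℝ, LinearizedSol Ω ψ f φ → ∀ x ∈ Ω, 0 < inner ℝ x e →
      φ x ≤ φ (planeRefl e 0 x) := by
    intro φ L x hx hxe
    by_contra! hlt
    set w : E → ℝ := fun x => φ x - φ (planeRefl e 0 x) with hwdef
    have hr : ContDiff ℝ 1 fun x => φ (planeRefl e 0 x) := L.reg.comp (contDiff_planeRefl e 0)
    have hwreg : ContDiff ℝ 1 w := L.reg.sub hr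
    set D : Set E := {x | x ∈ Ω ∧ 0 < inner ℝ x e} ∩ {x | 0 < w x} with hDdef
    have hD : IsOpen D := (S.isOpen_cap e 0).inter (isOpen_lt continuous_const hwreg.continuous)
    have hcl : ∀ x ∈ closure D, x ∈ closure Ω ∧ 0 ≤ inner ℝ x e ∧ 0 ≤ w x := fun x hx =>
      ⟨closure_mono (fun y hy => hy.1.1) hx,
        closure_minimal (t := {x : E | 0 ≤ inner ℝ x e}) (fun y hy => hy.1.2.le)
          (isClosed_le continuous_const (continuous_id.inner continuous_const)) hx,
        closure_minimal (fun y hy => (show 0 < w y from hy.2).le)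
          (isClosed_le continuous_const hwreg.continuous) hx⟩
    have hreflw : WeakEq Ω (fun x => φ (planeRefl e 0 x))
        (fun x => deriv f (ψ x) * φ (planeRefl e 0 x)) :=
      ((L.weq.comp_planeRefl L.reg he 0).mono fun y hy => hs.planeRefl_zero_mem hy).congr
        fun y hy => by rw [S.planeRefl_eq he hs y hy]
    have hemp := S.nodal_not_in_cap he hs hconn hTop hwreg hD inter_subset_left
      (((L.weq.sub hreflw L.reg hr (S.coeff_continuous.mul L.reg.continuous)
        (S.coeff_continuous.mul hr.continuous)).mono fun y hy => hy.1.1).congr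
        fun y _ => by simp only [hwdef]; ring)
      (fun y hy => hy.2)
      (fun y hy => by
        rw [hD.frontier_eq] at hy
        obtain ⟨h1, h2, h3⟩ := hcl y hy.1
        by_cases hyΩ : y ∈ Ω
        · rcases h2.eq_or_lt with h2 | h2
          · simp only [hwdef]
            rw [planeRefl_of_inner_eq h2.symm, sub_self]
          · exact le_antisymm (not_lt.mp fun h => hy.2 ⟨⟨hyΩ, h2⟩, h⟩) h3
        · have hf : y ∈ frontier Ω := by rw [S.isOpen.frontier_eq]; exact ⟨h1, hyΩ⟩
          simp only [hwdef]
          rw [L.zero y hf, L.zero _ (S.planeRefl_frontier he hs hf), sub_self])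
    have : x ∈ D := ⟨⟨hx, hxe⟩, sub_pos.mpr hlt⟩
    rw [hemp] at this
    exact this
  have pos : ∀ x ∈ Ω, 0 < inner ℝ x e → φ (planeRefl e 0 x) = φ x := fun x hx hxe =>
    le_antisymm (by have := half _ L.neg x hx hxe; linarith) (half φ L x hx hxe)
  intro x hx
  rcases lt_trichotomy (inner ℝ x e) 0 with h | h | h
  · have := pos _ (hs.planeRefl_zero_mem hx) (by rw [inner_planeRefl he]; linarith)
    rw [planeRefl_planeRefl he] at this
    exact this.symm
  · rw [planeRefl_of_inner_eq h]
  · exact pos x hx h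

end SemilinearSol
end Linearized

section Truncation
variable {N : ℕ}
local notation "E" => EuclideanSpace ℝ (Fin N)

/-- A smooth monotone truncation converging to the indicator of `(0, ∞)`. -/
def ramp (n : ℕ) (t : ℝ) : ℝ := Real.smoothTransition ((n + 1 : ℝ) * t - 1)

theorem contDiff_ramp (n : ℕ) : ContDiff ℝ 1 (ramp n) :=
  (Real.smoothTransition.contDiff (n := 1)).comp
    ((contDiff_const.mul contDiff_id).sub contDiff_const)

theorem ramp_nonneg (n : ℕ) (t : ℝ) : 0 ≤ ramp n t := Real.smoothTransition.nonneg _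

theorem ramp_le_one (n : ℕ) (t : ℝ) : ramp n t ≤ 1 := Real.smoothTransition.le_one _

theorem ramp_eq_zero {n : ℕ} {t : ℝ} (h : t ≤ 1 / (n + 1 : ℝ)) : ramp n t = 0 := by
  refine Real.smoothTransition.zero_of_nonpos ?_
  rw [le_div_iff₀ (by positivity)] at h
  linarith

theorem hasDerivAt_ramp (n : ℕ) (t : ℝ) : HasDerivAt (ramp n)
    ((n + 1 : ℝ) * deriv Real.smoothTransition ((n + 1 : ℝ) * t - 1)) t := by
  have h1 : HasDerivAt (fun t : ℝ => (n + 1 : ℝ) * t - 1) (n + 1 : ℝ) t := by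
    simpa using ((hasDerivAt_id t).const_mul (n + 1 : ℝ)).sub_const 1
  have h2 := ((Real.smoothTransition.contDiff (n := 1)).differentiable one_ne_zero
    ((n + 1 : ℝ) * t - 1)).hasDerivAt
  have h3 : HasDerivAt (fun t : ℝ => Real.smoothTransition ((n + 1 : ℝ) * t - 1))
      (deriv Real.smoothTransition ((n + 1 : ℝ) * t - 1) * (n + 1 : ℝ)) t :=
    HasDerivAt.comp (h₂ := Real.smoothTransition) t h2 h1
  rw [mul_comm] at h3
  exact h3

theorem deriv_smoothTransition_of_one_lt {s : ℝ} (h : 1 < s) :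
    deriv Real.smoothTransition s = 0 := by
  have : Real.smoothTransition =ᶠ[nhds s] fun _ => 1 := by
    filter_upwards [Ioi_mem_nhds h] with t ht
    exact Real.smoothTransition.one_of_one_le (le_of_lt ht)
  rw [this.deriv_eq]; simp

theorem deriv_smoothTransition_of_neg {s : ℝ} (h : s < 0) :
    deriv Real.smoothTransition s = 0 := by
  have : Real.smoothTransition =ᶠ[nhds s] fun _ => 0 := by
    filter_upwards [Iio_mem_nhds h] with t ht
    exact Real.smoothTransition.zero_of_nonpos (le_of_lt ht)
  rw [this.deriv_eq]; simp

theorem exists_bound_deriv_smoothTransition :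
    ∃ B : ℝ, 0 ≤ B ∧ ∀ s : ℝ, |(s + 1) * deriv Real.smoothTransition s| ≤ B := by
  have hc : Continuous fun s : ℝ => (s + 1) * deriv Real.smoothTransition s :=
    (by fun_prop : Continuous fun s : ℝ => s + 1).mul
      ((Real.smoothTransition.contDiff (n := 1)).continuous_deriv le_rfl)
  obtain ⟨B, hB⟩ := ((isCompact_Icc (a := (0:ℝ)) (b := 1)).image hc).isBounded.subset_closedBall 0
  refine ⟨|B|, abs_nonneg _, fun s => ?_⟩
  by_cases hs : s ∈ Icc (0:ℝ) 1
  · have := hB (mem_image_of_mem _ hs)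
    rw [mem_closedBall, dist_zero_right, Real.norm_eq_abs] at this
    exact this.trans (le_abs_self B)
  · have : deriv Real.smoothTransition s = 0 := by
      rcases lt_or_ge s 0 with h | h
      · exact deriv_smoothTransition_of_neg h
      · exact deriv_smoothTransition_of_one_lt (not_le.mp fun h' => hs ⟨h, h'⟩)
    rw [this, mul_zero, abs_zero]; exact abs_nonneg _

theorem eventually_one_lt_ramp_arg {t : ℝ} (ht : 0 < t) :
    ∀ᶠ n : ℕ in Filter.atTop, 1 < (n + 1 : ℝ) * t - 1 := by
  obtain ⟨m, hm⟩ := exists_nat_gt (2 / t)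
  filter_upwards [Filter.eventually_ge_atTop m] with n hn
  have : (m : ℝ) ≤ n := by exact_mod_cast hn
  rw [div_lt_iff₀ ht] at hm
  nlinarith

theorem eventually_ramp_eq_one {t : ℝ} (ht : 0 < t) : ∀ᶠ n : ℕ in Filter.atTop, ramp n t = 1 := by
  filter_upwards [eventually_one_lt_ramp_arg ht] with n hn
  exact Real.smoothTransition.one_of_one_le hn.le

/-- Dominated convergence on a bounded set for sequences that are eventually constant. -/
theorem tendsto_integral_of_eventually_eq {U : Set E} (hU : MeasurableSet U)
    (hb : Bornology.IsBounded U) {F : ℕ → E → ℝ} {G B : E → ℝ} (hF : ∀ n, Continuous (F n))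
    (hB : Continuous B) (hbound : ∀ n, ∀ x ∈ U, |F n x| ≤ B x)
    (hlim : ∀ x ∈ U, ∀ᶠ n in Filter.atTop, F n x = G x) :
    Filter.Tendsto (fun n => ∫ x in U, F n x) Filter.atTop (nhds (∫ x in U, G x)) := by
  refine tendsto_integral_of_dominated_convergence B (fun n => (hF n).aestronglyMeasurable)
    (integrableOn_of_continuous_of_isBounded hb hB) (fun n => ?_) ?_
  · exact (ae_restrict_iff' hU).mpr (Filter.Eventually.of_forall fun x hx => hbound n x hx)
  · refine (ae_restrict_iff' hU).mpr (Filter.Eventually.of_forall fun x hx => ?_)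
    exact tendsto_const_nhds.congr' ((hlim x hx).mono fun n h => h.symm)

theorem gradient_eq_zero_of_isLocalExtr {φ : E → ℝ} {x : E} (h : IsLocalExtr φ x) :
    gradient φ x = 0 := by
  refine ext_inner_right ℝ fun w => ?_
  rw [inner_gradient_left', h.fderiv_eq_zero]; simp

theorem gradient_eq_zero_of_nonneg_off {Ω K : Set E} (hΩ : IsOpen Ω) (hK : IsCompact K)
    {φ : E → ℝ} (hoff : ∀ x ∈ Ω, x ∉ K → 0 ≤ φ x) {x : E} (hx : x ∈ Ω) (hxK : x ∉ K)
    (h0 : φ x = 0) : gradient φ x = 0 := by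
  refine gradient_eq_zero_of_isLocalExtr (Or.inl ?_)
  filter_upwards [(hΩ.sdiff hK.isClosed).mem_nhds ⟨hx, hxK⟩] with y hy
  rw [h0]; exact hoff y hy.1 hy.2

theorem isCompact_superlevel {Ω : Set E} (hb : Bornology.IsBounded Ω) {φ : E → ℝ}
    (hφ : Continuous φ) (ε : ℝ) : IsCompact {x | x ∈ closure Ω ∧ ε ≤ φ x} :=
  hb.isCompact_closure.inter_right (isClosed_le continuous_const hφ)

theorem superlevel_subset {Ω : Set E} (hΩ : IsOpen Ω) {φ : E → ℝ}
    (hz : ∀ x ∈ frontier Ω, φ x = 0) {ε : ℝ} (hε : 0 < ε) : {x | x ∈ closure Ω ∧ ε ≤ φ x} ⊆ Ω :=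
  fun _ hx => mem_of_mem_closure_of_ne_zero hΩ hz hx.1 (hε.trans_le hx.2).ne'

/-- A function solving an equation in `Ω`, vanishing on `∂Ω` and nonnegative near `∂Ω`, satisfies
the weak inequality against nonnegative test functions that need not vanish on `∂Ω`. -/
theorem WeakEq.integral_inner_le {Ω K : Set E} (hΩ : IsOpen Ω) (hb : Bornology.IsBounded Ω)
    (hK : IsCompact K) (hKΩ : K ⊆ Ω) {φ g η : E → ℝ} (hφ : ContDiff ℝ 1 φ) (hg : Continuous g)
    (hw : WeakEq Ω φ (fun x => g x * φ x)) (hz : ∀ x ∈ frontier Ω, φ x = 0)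
    (hoff : ∀ x ∈ Ω, x ∉ K → 0 ≤ φ x) (hη : ContDiff ℝ 1 η) (hη0 : ∀ x ∈ Ω, 0 ≤ η x) :
    ∫ x in Ω, inner ℝ (gradient φ x) (gradient η x) ≤ ∫ x in Ω, g x * φ x * η x := by
  obtain ⟨L, hL, hKL, hLΩ⟩ := exists_compact_between hK hΩ hKΩ
  obtain ⟨θ, hθ, hθr, hθs, hθ1⟩ := exists_contMDiff_support_eq_eq_one_iff
    (modelWithCornersSelf ℝ E) (n := 1) isOpen_interior hK.isClosed hKL
  have hθ : ContDiff ℝ 1 θ := contMDiff_iff_contDiff.mp hθ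
  have hθ01 : ∀ x, 0 ≤ θ x ∧ θ x ≤ 1 := fun x => hθr ⟨x, rfl⟩
  have hgφ := continuous_gradient hφ
  have hgη := continuous_gradient hη
  have hgθ := continuous_gradient hθ
  have hφc := hφ.continuous
  have hηc := hη.continuous
  have hθc := hθ.continuous
  have hrc : ∀ n, Continuous fun x => ramp n (φ x) := fun n => (contDiff_ramp n).continuous.comp hφc
  have hd : ∀ {u : E → ℝ}, ContDiff ℝ 1 u → ∀ x, DifferentiableAt ℝ u x :=
    fun h x => h.differentiable one_ne_zero x
  set W : ℕ → E → ℝ := fun n x => θ x + (1 - θ x) * ramp n (φ x) with hW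
  have hWc : ∀ n, Continuous (W n) := fun n => by
    have := hrc n
    fun_prop
  have hW01 : ∀ n x, 0 ≤ W n x ∧ W n x ≤ 1 := fun n x => by
    have h1 := ramp_nonneg n (φ x)
    have h2 := ramp_le_one n (φ x)
    have h3 := hθ01 x
    simp only [hW]
    constructor <;> nlinarith
  have hWreg : ∀ n, ContDiff ℝ 1 (W n) := fun n =>
    hθ.add ((contDiff_const.sub hθ).mul ((contDiff_ramp n).comp hφ))
  have hgW : ∀ n x, gradient (W n) x = (1 - ramp n (φ x)) • gradient θ x +
      ((1 - θ x) * ((n + 1 : ℝ) * deriv Real.smoothTransition ((n + 1 : ℝ) * φ x - 1))) •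
        gradient φ x := by
    intro n x
    have e1 : W n = fun x => θ x + (1 - θ x) * ramp n (φ x) := rfl
    have hcr : ContDiff ℝ 1 fun x => ramp n (φ x) := (contDiff_ramp n).comp hφ
    have hsub : gradient (fun x => 1 - θ x) x = - gradient θ x := by
      have := gradient_add' (u := fun _ => (1:ℝ)) (v := fun x => (-1) * θ x) (x := x)
        (differentiableAt_const _) ((hd hθ x).const_mul _)
      rw [gradient_const_mul' (hd hθ x)] at this
      simpa [sub_eq_add_neg, gradient_const] using this
    rw [e1, gradient_add' (hd hθ x) (hd ((contDiff_const.sub hθ).mul hcr) x),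
      gradient_mul' (hd (contDiff_const.sub hθ) x) (hd hcr x), hsub,
      gradient_comp_real (hasDerivAt_ramp n (φ x)) (hd hφ x)]
    module
  have hderiv : ∀ (n : ℕ) (t : ℝ), 0 ≤ (n + 1 : ℝ) * deriv Real.smoothTransition ((n + 1 : ℝ) * t - 1) :=
    fun n t => mul_nonneg (by positivity) Real.smoothTransition.monotone.deriv_nonneg
  have hineq : ∀ n : ℕ, ∫ x in Ω, (W n x * inner ℝ (gradient φ x) (gradient η x) +
      η x * (1 - ramp n (φ x)) * inner ℝ (gradient φ x) (gradient θ x)) ≤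
      ∫ x in Ω, g x * φ x * (η x * W n x) := by
    intro n
    have hKc := hL.union (isCompact_superlevel hb hφc (1 / (n + 1 : ℝ)))
    have htest := hw.test hΩ hKc
      (union_subset hLΩ (superlevel_subset hΩ hz (by positivity)))
      (f := fun x => η x * W n x)
      (fun x hx hxK => by
        simp only [mem_union, not_or] at hxK
        have h1 : θ x = 0 := by
          by_contra h
          have : x ∈ interior L := by rw [← hθs]; exact h
          exact hxK.1 (interior_subset this)
        have h2 : ramp n (φ x) = 0 :=
          ramp_eq_zero (le_of_not_ge fun h => hxK.2 ⟨subset_closure hx, h⟩)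
        simp [hW, h1, h2]) (hη.mul (hWreg n))
    rw [← htest]
    refine setIntegral_mono_on (integrableOn_of_continuous_of_isBounded hb ?_)
      (integrableOn_of_continuous_of_isBounded hb
        (hgφ.inner (continuous_gradient (hη.mul (hWreg n))))) hΩ.measurableSet fun x hx => ?_
    · have := hrc n
      have := hWc n
      have := hgφ.inner (𝕜 := ℝ) hgη
      have := hgφ.inner (𝕜 := ℝ) hgθ
      fun_prop
    · rw [gradient_mul' (hd hη x) (hd (hWreg n) x), hgW]
      simp only [inner_add_right, inner_smul_right, real_inner_self_eq_norm_sq, smul_add, smul_smul]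
      have := mul_nonneg (mul_nonneg (hη0 x hx) (mul_nonneg (sub_nonneg.mpr (hθ01 x).2)
        (hderiv n (φ x)))) (sq_nonneg ‖gradient φ x‖)
      linarith
  refine le_of_tendsto_of_tendsto' (b := Filter.atTop) ?_ ?_ hineq
  · refine tendsto_integral_of_eventually_eq hΩ.measurableSet hb (fun n => ?_)
      (B := fun x => ‖gradient φ x‖ * ‖gradient η x‖ + |η x| * (‖gradient φ x‖ * ‖gradient θ x‖))
      (by fun_prop) ?_ ?_
    · have := hrc n
      have := hWc n
      have := hgφ.inner (𝕜 := ℝ) hgη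
      have := hgφ.inner (𝕜 := ℝ) hgθ
      fun_prop
    · intro n x _
      refine (abs_add_le _ _).trans (add_le_add ?_ ?_)
      · rw [abs_mul, abs_of_nonneg (hW01 n x).1]
        exact (mul_le_of_le_one_left (abs_nonneg _) (hW01 n x).2).trans (abs_real_inner_le_norm _ _)
      · rw [mul_assoc, abs_mul, abs_mul]
        refine mul_le_mul_of_nonneg_left ?_ (abs_nonneg _)
        have h1 : |1 - ramp n (φ x)| ≤ 1 := by
          rw [abs_le]; constructor <;> linarith [ramp_nonneg n (φ x), ramp_le_one n (φ x)]
        exact (mul_le_of_le_one_left (abs_nonneg _) h1).trans (abs_real_inner_le_norm _ _)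
    · intro x hx
      by_cases hxK : x ∈ K
      · have h1 : θ x = 1 := (hθ1 x).mp hxK
        have h2 : gradient θ x = 0 := gradient_eq_zero_of_isLocalExtr
          (Or.inr (Filter.Eventually.of_forall fun y => by rw [h1]; exact (hθ01 y).2))
        exact Filter.Eventually.of_forall fun n => by simp [hW, h1, h2]
      · rcases (hoff x hx hxK).eq_or_lt with h | h
        · have := gradient_eq_zero_of_nonneg_off hΩ hK hoff hx hxK h.symm
          exact Filter.Eventually.of_forall fun n => by simp [this]
        · filter_upwards [eventually_ramp_eq_one h] with n hn
          simp [hW, hn]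
  · refine tendsto_integral_of_eventually_eq hΩ.measurableSet hb (fun n => ?_)
      (B := fun x => |g x * φ x| * |η x|) (by fun_prop) ?_ ?_
    · have := hWc n
      fun_prop
    · intro n x _
      rw [abs_mul, abs_mul (η x), abs_of_nonneg (hW01 n x).1]
      gcongr
      exact mul_le_of_le_one_right (abs_nonneg _) (hW01 n x).2
    · intro x hx
      by_cases hxK : x ∈ K
      · have h1 : θ x = 1 := (hθ1 x).mp hxK
        exact Filter.Eventually.of_forall fun n => by simp [hW, h1]
      · rcases (hoff x hx hxK).eq_or_lt with h | h
        · exact Filter.Eventually.of_forall fun n => by simp [h.symm]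
        · filter_upwards [eventually_ramp_eq_one h] with n hn
          simp [hW, hn]

/-- A function vanishing on `∂Ω` and nonnegative off `K` may be used as a test function for an
equation that is trivial on `K`. -/
theorem WeakEq.integral_inner_eq {Ω K : Set E} (hΩ : IsOpen Ω) (hb : Bornology.IsBounded Ω)
    (hK : IsCompact K) {φ v g : E → ℝ} (hφ : ContDiff ℝ 1 φ) (hv : ContDiff ℝ 1 v)
    (hg : Continuous g) (hw : WeakEq Ω v g) (hz : ∀ x ∈ frontier Ω, φ x = 0)
    (hoff : ∀ x ∈ Ω, x ∉ K → 0 ≤ φ x) (hvK : ∀ x ∈ K, gradient v x = 0) (hgK : ∀ x ∈ K, g x = 0) :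
    ∫ x in Ω, inner ℝ (gradient v x) (gradient φ x) = ∫ x in Ω, g x * φ x := by
  obtain ⟨B, hB0, hB⟩ := exists_bound_deriv_smoothTransition
  have hgφ := continuous_gradient hφ
  have hgv := continuous_gradient hv
  have hφc := hφ.continuous
  have hrc : ∀ n, Continuous fun x => ramp n (φ x) := fun n => (contDiff_ramp n).continuous.comp hφc
  have hreg : ∀ n, ContDiff ℝ 1 fun x => φ x * ramp n (φ x) := fun n =>
    hφ.mul ((contDiff_ramp n).comp hφ)
  have hgr : ∀ n x, gradient (fun x => φ x * ramp n (φ x)) x =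
      (ramp n (φ x) + φ x * ((n + 1 : ℝ) *
        deriv Real.smoothTransition ((n + 1 : ℝ) * φ x - 1))) • gradient φ x := by
    intro n x
    have hcr : ContDiff ℝ 1 fun x => ramp n (φ x) := (contDiff_ramp n).comp hφ
    rw [gradient_mul' (hφ.differentiable one_ne_zero x) (hcr.differentiable one_ne_zero x),
      gradient_comp_real (hasDerivAt_ramp n (φ x)) (hφ.differentiable one_ne_zero x)]
    module
  have heq : ∀ n : ℕ, ∫ x in Ω, inner ℝ (gradient v x) (gradient (fun x => φ x * ramp n (φ x)) x) =
      ∫ x in Ω, g x * (φ x * ramp n (φ x)) := fun n =>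
    hw.test hΩ (isCompact_superlevel hb hφc (1 / (n + 1 : ℝ)))
      (superlevel_subset hΩ hz (by positivity))
      (fun x hx hxK => by
        rw [ramp_eq_zero (le_of_not_ge fun h => hxK ⟨subset_closure hx, h⟩), mul_zero]) (hreg n)
  have h1 : Filter.Tendsto (fun n : ℕ => ∫ x in Ω, inner ℝ (gradient v x)
      (gradient (fun x => φ x * ramp n (φ x)) x)) Filter.atTop
      (nhds (∫ x in Ω, inner ℝ (gradient v x) (gradient φ x))) := by
    refine tendsto_integral_of_eventually_eq hΩ.measurableSet hb
      (fun n => hgv.inner (continuous_gradient (hreg n)))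
      (B := fun x => (1 + B) * (‖gradient v x‖ * ‖gradient φ x‖)) (by fun_prop) ?_ ?_
    · intro n x _
      rw [hgr, inner_smul_right, abs_mul]
      gcongr
      · refine (abs_add_le _ _).trans (add_le_add ?_ ?_)
        · rw [abs_of_nonneg (ramp_nonneg _ _)]; exact ramp_le_one _ _
        · have := hB ((n + 1 : ℝ) * φ x - 1)
          rwa [sub_add_cancel, mul_comm _ (φ x), mul_assoc, mul_comm (φ x) (n + 1 : ℝ)] at this
      · exact abs_real_inner_le_norm _ _
    · intro x hx
      by_cases hxK : x ∈ K
      · exact Filter.Eventually.of_forall fun n => by simp [hvK x hxK]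
      · rcases (hoff x hx hxK).eq_or_lt with h | h
        · have := gradient_eq_zero_of_nonneg_off hΩ hK hoff hx hxK h.symm
          exact Filter.Eventually.of_forall fun n => by rw [hgr]; simp [this]
        · filter_upwards [eventually_ramp_eq_one h, eventually_one_lt_ramp_arg h] with n hn hn'
          rw [hgr, hn, deriv_smoothTransition_of_one_lt hn']; simp
  have h2 : Filter.Tendsto (fun n : ℕ => ∫ x in Ω, g x * (φ x * ramp n (φ x))) Filter.atTop
      (nhds (∫ x in Ω, g x * φ x)) := by
    refine tendsto_integral_of_eventually_eq hΩ.measurableSet hb (fun n => ?_)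
      (B := fun x => |g x| * |φ x|) (by fun_prop) ?_ ?_
    · have := hrc n
      fun_prop
    · intro n x _
      rw [abs_mul, abs_mul, abs_of_nonneg (ramp_nonneg n (φ x))]
      gcongr
      exact mul_le_of_le_one_right (abs_nonneg _) (ramp_le_one _ _)
    · intro x hx
      by_cases hxK : x ∈ K
      · exact Filter.Eventually.of_forall fun n => by simp [hgK x hxK]
      · rcases (hoff x hx hxK).eq_or_lt with h | h
        · exact Filter.Eventually.of_forall fun n => by simp [h.symm]
        · filter_upwards [eventually_ramp_eq_one h] with n hn
          simp [hn]
  simp only [heq] at h1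
  exact tendsto_nhds_unique h1 h2

end Truncation

section Vanishing
variable {N : ℕ}
local notation "E" => EuclideanSpace ℝ (Fin N)

theorem contDiff_two_max_cube : ContDiff ℝ 2 fun t : ℝ => max t 0 ^ 3 := by
  have hd : deriv (fun t : ℝ => max t 0 ^ 3) = fun t => 3 * max t 0 ^ 2 := by
    ext t
    have := (hasDerivAt_max_pow 1 t).deriv
    norm_num at this
    exact this
  have h := contDiff_succ_iff_deriv (𝕜 := ℝ) (n := 1) (f := fun t : ℝ => max t 0 ^ 3)
  rw [show ((1 : WithTop ℕ∞) + 1) = 2 by norm_num] at h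
  rw [h, hd]
  exact ⟨fun t => (hasDerivAt_max_pow 1 t).differentiableAt, by simp,
    contDiff_const.mul (contDiff_max_pow 0)⟩

theorem hasFDerivAt_inner_max_pow (e : E) (b : ℝ) (n : ℕ) (x : E) :
    HasFDerivAt (fun x : E => max (inner ℝ x e - b) 0 ^ (n + 2))
      ((((n : ℝ) + 2) * max (inner ℝ x e - b) 0 ^ (n + 1)) • innerSL ℝ e) x := by
  have h1 : HasFDerivAt (fun x : E => inner ℝ x e - b) (innerSL ℝ e) x := by
    have := ((innerSL ℝ e).hasFDerivAt (x := x)).sub_const b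
    refine this.congr_of_eventuallyEq (Filter.Eventually.of_forall fun y => ?_)
    simp [real_inner_comm]
  exact HasDerivAt.comp_hasFDerivAt x (hasDerivAt_max_pow n (inner ℝ x e - b)) h1

theorem gradient_inner_max_cube (e : E) (b : ℝ) (x : E) :
    gradient (fun x : E => max (inner ℝ x e - b) 0 ^ 3) x =
      (3 * max (inner ℝ x e - b) 0 ^ 2) • e := by
  refine ext_inner_right ℝ fun w => ?_
  rw [inner_gradient_left', (hasFDerivAt_inner_max_pow e b 1 x).fderiv]
  norm_num [inner_smul_left]

theorem contDiff_inner_max_cube (e : E) (b : ℝ) :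
    ContDiff ℝ 2 fun x : E => max (inner ℝ x e - b) 0 ^ 3 :=
  contDiff_two_max_cube.comp ((contDiff_id.inner ℝ contDiff_const).sub contDiff_const)

theorem lapl_inner_max_cube {e : E} (he : ‖e‖ = 1) (b : ℝ) (x : E) :
    lapl (fun x : E => max (inner ℝ x e - b) 0 ^ 3) x = 6 * max (inner ℝ x e - b) 0 := by
  have h1 : ∀ w y : E, fderiv ℝ (fun x : E => max (inner ℝ x e - b) 0 ^ 3) y w =
      (3 * inner ℝ e w) * max (inner ℝ y e - b) 0 ^ 2 := by
    intro w y
    rw [(hasFDerivAt_inner_max_pow e b 1 y).fderiv]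
    norm_num; ring
  have h2 : ∀ w : E, fderiv ℝ (fun y => (3 * inner ℝ e w) * max (inner ℝ y e - b) 0 ^ 2) x w =
      6 * max (inner ℝ x e - b) 0 * inner ℝ e w ^ 2 := by
    intro w
    rw [((hasFDerivAt_inner_max_pow e b 0 x).const_mul (3 * inner ℝ e w)).fderiv]
    norm_num; ring
  simp only [lapl, h1, h2]
  rw [← Finset.mul_sum]
  have : ∑ i, inner ℝ e (EuclideanSpace.single i (1:ℝ)) ^ 2 = 1 := by
    have h3 := EuclideanSpace.real_norm_sq_eq e
    rw [he, one_pow] at h3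
    simp [EuclideanSpace.inner_single_right, ← h3]
  rw [this, mul_one]

/-- If `φ` is nonnegative off `K` and `∫ c φ = 0`, then `φ` vanishes beyond `K` in direction `e`. -/
theorem eq_zero_beyond {Ω K : Set E} (hΩ : IsOpen Ω) (hb : Bornology.IsBounded Ω)
    (hK : IsCompact K) (hKΩ : K ⊆ Ω) {φ g : E → ℝ} (hφ : ContDiff ℝ 1 φ) (hg : Continuous g)
    (hg0 : ∀ x ∈ Ω, 0 ≤ g x) (hw : WeakEq Ω φ (fun x => g x * φ x))
    (hz : ∀ x ∈ frontier Ω, φ x = 0) (hoff : ∀ x ∈ Ω, x ∉ K → 0 ≤ φ x)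
    (hint : ∫ x in Ω, g x * φ x = 0) {e : E} (he : ‖e‖ = 1) {b : ℝ}
    (hKb : ∀ x ∈ K, inner ℝ x e ≤ b) : ∀ x ∈ Ω, b < inner ℝ x e → φ x = 0 := by
  set F : E → ℝ := fun x => max (inner ℝ x e - b) 0 with hF
  have hFc : Continuous F :=
    ((continuous_id.inner continuous_const).sub continuous_const).max continuous_const
  have hF0 : ∀ x, 0 ≤ F x := fun x => le_max_right _ _
  have hFK : ∀ x ∈ K, F x = 0 := fun x hx => max_eq_right (by linarith [hKb x hx])
  have hcub : ContDiff ℝ 1 fun x => F x ^ 3 := (contDiff_inner_max_cube e b).of_le (by norm_num)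
  obtain ⟨M, hM⟩ := (hb.isCompact_closure.image (hFc.pow 3)).isBounded.subset_closedBall 0
  have hMb : ∀ x ∈ Ω, F x ^ 3 ≤ M := fun x hx => by
    have := hM (mem_image_of_mem _ (subset_closure hx))
    rw [mem_closedBall, dist_zero_right, Real.norm_eq_abs] at this
    exact (le_abs_self _).trans this
  have hgF : ∀ x, gradient (fun x => F x ^ 3) x = (3 * F x ^ 2) • e := gradient_inner_max_cube e b
  have hgc := hφ.continuous
  have hgn := continuous_gradient hφ
  have h1 := hw.integral_inner_le hΩ hb hK hKΩ hφ hg hz hoff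
    (η := fun x => M + (-1) * F x ^ 3) (contDiff_const.add (contDiff_const.mul hcub))
    (fun x hx => by have := hMb x hx; linarith)
  have h2 := WeakEq.integral_inner_eq hΩ hb hK hφ hcub (g := fun x => -(6 * F x))
    (by fun_prop)
    (weakEq_of_lapl (contDiff_inner_max_cube e b) fun x _ => by
      rw [lapl_inner_max_cube he])
    hz hoff (fun x hx => by rw [hgF, hFK x hx]; simp) (fun x hx => by simp [hFK x hx])
  have hgη : ∀ x, gradient (fun x => M + (-1) * F x ^ 3) x = - gradient (fun x => F x ^ 3) x := by
    intro x
    have hd := hcub.differentiable one_ne_zero x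
    rw [gradient_add' (differentiableAt_const _) (hd.const_mul _), gradient_const_mul' hd,
      show gradient (fun _ : E => M) x = 0 from gradient_const x M]
    simp
  have hcomm : ∀ x, inner ℝ (gradient φ x) (gradient (fun x => F x ^ 3) x) =
      inner ℝ (gradient (fun x => F x ^ 3) x) (gradient φ x) := fun x => real_inner_comm _ _
  simp only [hgη, inner_neg_right, integral_neg, hcomm] at h1
  rw [h2] at h1
  have i1 : IntegrableOn (fun x => F x * φ x) Ω :=
    integrableOn_of_continuous_of_isBounded hb (by fun_prop)
  have i2 : IntegrableOn (fun x => g x * φ x * F x ^ 3) Ω :=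
    integrableOn_of_continuous_of_isBounded hb (by fun_prop)
  have i3 : IntegrableOn (fun x => g x * φ x) Ω :=
    integrableOn_of_continuous_of_isBounded hb (by fun_prop)
  have e1 : ∫ x in Ω, -(6 * F x) * φ x = -(6 * ∫ x in Ω, F x * φ x) := by
    rw [← integral_const_mul, ← integral_neg]
    congr 1; ext x; ring
  have e2 : ∫ x in Ω, g x * φ x * (M + (-1) * F x ^ 3) = - ∫ x in Ω, g x * φ x * F x ^ 3 := by
    have : (fun x => g x * φ x * (M + (-1) * F x ^ 3)) =
        fun x => M * (g x * φ x) - g x * φ x * F x ^ 3 := by ext x; ring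
    rw [this, integral_sub (i3.const_mul M) i2, integral_const_mul, hint]; ring
  have p1 : ∀ x ∈ Ω, 0 ≤ F x * φ x := fun x hx => by
    by_cases hxK : x ∈ K
    · rw [hFK x hxK, zero_mul]
    · exact mul_nonneg (hF0 x) (hoff x hx hxK)
  have p2 : 0 ≤ ∫ x in Ω, g x * φ x * F x ^ 3 := by
    refine setIntegral_nonneg hΩ.measurableSet fun x hx => ?_
    have := mul_nonneg (mul_nonneg (hg0 x hx) (p1 x hx)) (sq_nonneg (F x))
    linarith
  have p3 : ∫ x in Ω, F x * φ x = 0 := by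
    refine le_antisymm ?_ (setIntegral_nonneg hΩ.measurableSet p1)
    rw [e1, e2] at h1
    linarith
  intro x hx hbx
  have hcont : Continuous fun x => F x * φ x := by fun_prop
  have hae := (setIntegral_eq_zero_iff_of_nonneg_ae
    ((ae_restrict_iff' hΩ.measurableSet).mpr (Filter.Eventually.of_forall p1)) i1).mp p3
  have := Measure.eqOn_open_of_ae_eq hae hΩ hcont.continuousOn continuousOn_const hx
  simp only [Pi.zero_apply] at this
  have hFx : 0 < F x := lt_max_of_lt_left (by linarith)
  exact (mul_eq_zero.mp this).resolve_left hFx.ne'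

end Vanishing

section NodalContact
variable {N : ℕ}
local notation "E" => EuclideanSpace ℝ (Fin N)

/-- `z` is joined to the complement of `Ω` by a segment on which `φ` vanishes. -/
def Escapes (Ω : Set E) (φ : E → ℝ) (z : E) : Prop :=
  ∃ z', z' ∉ Ω ∧ ∀ x ∈ segment ℝ z z', x ∈ Ω → φ x = 0

/-- The positive and the negative nodal regions do not both reach the complement of `Ω`. -/
def NoOppositeEscape (Ω : Set E) (φ : E → ℝ) : Prop :=
  ∀ z₁ ∈ closure {x | x ∈ Ω ∧ 0 < φ x}, ∀ z₂ ∈ closure {x | x ∈ Ω ∧ φ x < 0},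
    Escapes Ω φ z₁ → Escapes Ω φ z₂ → False

theorem Escapes.neg {Ω : Set E} {φ : E → ℝ} {z : E} (h : Escapes Ω φ z) :
    Escapes Ω (fun x => - φ x) z := by
  obtain ⟨z', h1, h2⟩ := h
  exact ⟨z', h1, fun x hx hxΩ => by simp [h2 x hx hxΩ]⟩

theorem NoOppositeEscape.neg {Ω : Set E} {φ : E → ℝ} (h : NoOppositeEscape Ω φ) :
    NoOppositeEscape Ω (fun x => - φ x) := by
  intro z₁ h₁ z₂ h₂ e₁ e₂
  simp only [Left.neg_pos_iff, Left.neg_neg_iff] at h₁ h₂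
  have e₁ := e₁.neg
  have e₂ := e₂.neg
  simp only [neg_neg] at e₁ e₂
  exact h z₂ h₂ z₁ h₁ e₂ e₁

theorem escapes_of_notMem {Ω : Set E} {φ : E → ℝ} {z : E} (h : z ∉ Ω) : Escapes Ω φ z :=
  ⟨z, h, fun x hx hxΩ => by
    rw [segment_same] at hx
    exact absurd (mem_singleton_iff.mp hx ▸ hxΩ) h⟩

namespace SemilinearSol

variable {Ω : Set (EuclideanSpace ℝ (Fin N))} {ψ : EuclideanSpace ℝ (Fin N) → ℝ} {f : ℝ → ℝ}
variable {e : EuclideanSpace ℝ (Fin N)} {φ : EuclideanSpace ℝ (Fin N) → ℝ}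

theorem eq_zero_near (S : SemilinearSol Ω ψ f) (L : LinearizedSol Ω ψ f φ)
    {z : EuclideanSpace ℝ (Fin N)} (hz : z ∈ Ω) (h0 : φ z = 0)
    (hn : z ∉ closure {x | x ∈ Ω ∧ φ x < 0}) :
    ∃ ρ > 0, ball z ρ ⊆ Ω ∧ ∀ x ∈ ball z ρ, φ x = 0 := by
  obtain ⟨ρ, hρ, hb⟩ := Metric.isOpen_iff.mp (S.isOpen.inter isClosed_closure.isOpen_compl) z ⟨hz, hn⟩
  have hnn : ∀ x ∈ ball z ρ, 0 ≤ φ x := fun x hx =>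
    not_lt.mp fun h => (hb hx).2 (subset_closure ⟨(hb hx).1, h⟩)
  refine ⟨ρ, hρ, fun x hx => (hb hx).1, ?_⟩
  exact eq_zero_of_superharmonic S.dim isOpen_ball (convex_ball z ρ).isPreconnected Subset.rfl
    L.reg (S.coeff_continuous.mul L.reg.continuous) (L.weq.mono fun x hx => (hb hx).1) hnn
    (fun x hx => mul_nonneg (S.coeff_nonneg x) (hnn x hx)) (mem_ball_self hρ) h0

theorem eq_zero_near_of_escapes (S : SemilinearSol Ω ψ f) (L : LinearizedSol Ω ψ f φ)
    (hX : NoOppositeEscape Ω φ) {z : EuclideanSpace ℝ (Fin N)} (hz : z ∈ Ω) (h0 : φ z = 0)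
    (hesc : Escapes Ω φ z) : ∃ ρ > 0, ball z ρ ⊆ Ω ∧ ∀ x ∈ ball z ρ, φ x = 0 := by
  by_cases hn : z ∈ closure {x | x ∈ Ω ∧ φ x < 0}
  · have hp : z ∉ closure {x | x ∈ Ω ∧ 0 < φ x} := fun hp => hX z hp z hn hesc hesc
    obtain ⟨ρ, hρ, h1, h2⟩ := S.eq_zero_near L.neg hz (by simp [h0])
      (by simpa only [Left.neg_neg_iff] using hp)
    exact ⟨ρ, hρ, h1, fun x hx => neg_eq_zero.mp (h2 x hx)⟩
  · exact S.eq_zero_near L hz h0 hn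

theorem exists_axis_bound (S : SemilinearSol Ω ψ f) (L : LinearizedSol Ω ψ f φ)
    (hint : ∫ x in Ω, deriv f (ψ x) * φ x = 0) (he : ‖e‖ = 1)
    (hproj : ∀ x ∈ Ω, (inner ℝ x e : ℝ) • e ∈ Ω) (hne : Ω.Nonempty)
    (hcl : closure {x | x ∈ Ω ∧ φ x < 0} ⊆ Ω) :
    ∃ b : ℝ, b • e ∈ Ω ∧ ∀ t : ℝ, t • e ∈ Ω → φ (t • e) ≠ 0 → t ≤ b := by
  have hK : IsCompact (closure {x | x ∈ Ω ∧ φ x < 0}) :=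
    (S.bdd.subset fun x hx => hx.1).isCompact_closure
  have hoff : ∀ x ∈ Ω, x ∉ closure {x | x ∈ Ω ∧ φ x < 0} → 0 ≤ φ x := fun x hx hxK =>
    not_lt.mp fun h => hxK (subset_closure ⟨hx, h⟩)
  have key : ∃ b : ℝ, b • e ∈ Ω ∧ ∀ x ∈ closure {x | x ∈ Ω ∧ φ x < 0}, inner ℝ x e ≤ b := by
    rcases (closure {x | x ∈ Ω ∧ φ x < 0}).eq_empty_or_nonempty with h | h
    · obtain ⟨x, hx⟩ := hne
      exact ⟨_, hproj x hx, by simp [h]⟩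
    · obtain ⟨x, hx, hmax⟩ := hK.exists_isMaxOn h (f := fun x : E => (inner ℝ x e : ℝ))
        (continuous_id.inner continuous_const).continuousOn
      exact ⟨_, hproj x (hcl hx), fun y hy => hmax hy⟩
  obtain ⟨b, hb, hKb⟩ := key
  refine ⟨b, hb, fun t ht hφt => not_lt.mp fun hbt => hφt ?_⟩
  refine eq_zero_beyond S.isOpen S.bdd hK hcl L.reg S.coeff_continuous
    (fun x _ => S.coeff_nonneg x) L.weq L.zero hoff hint he hKb _ ht ?_
  rw [inner_smul_left, real_inner_self_eq_norm_sq, he]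
  simpa using hbt

theorem eq_zero_on_axis (S : SemilinearSol Ω ψ f) (L : LinearizedSol Ω ψ f φ)
    (hint : ∫ x in Ω, deriv f (ψ x) * φ x = 0) (hX : NoOppositeEscape Ω φ) (he : ‖e‖ = 1)
    (hs : SymDir Ω e) (hproj : ∀ x ∈ Ω, (inner ℝ x e : ℝ) • e ∈ Ω) (hne : Ω.Nonempty) :
    ∀ t : ℝ, 0 ≤ t → t • e ∈ Ω → φ (t • e) = 0 := by
  have hsym : ∀ t s : ℝ, t • e ∈ Ω → |s| ≤ |t| → s • e ∈ Ω := by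
    intro t s ht hst
    have := hs _ ht s (by
      rw [inner_smul_left, real_inner_self_eq_norm_sq, he]
      simpa using hst)
    rw [inner_smul_left, real_inner_self_eq_norm_sq, he] at this
    simpa [← add_smul] using this
  have hbd : ∃ b : ℝ, b • e ∈ Ω ∧ ∀ t : ℝ, t • e ∈ Ω → φ (t • e) ≠ 0 → t ≤ b := by
    by_cases hcl : closure {x | x ∈ Ω ∧ φ x < 0} ⊆ Ω
    · exact S.exists_axis_bound L hint he hproj hne hcl
    · obtain ⟨z, hz, hzΩ⟩ := not_subset.mp hcl
      have hcl' : closure {x | x ∈ Ω ∧ -φ x < 0} ⊆ Ω := by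
        intro w hw
        by_contra hwΩ
        simp only [Left.neg_neg_iff] at hw
        exact hX w hw z hz (escapes_of_notMem hwΩ) (escapes_of_notMem hzΩ)
      obtain ⟨b, h1, h2⟩ := S.exists_axis_bound L.neg
        (by simp only [mul_neg, integral_neg, hint, neg_zero]) he hproj hne hcl'
      exact ⟨b, h1, fun t ht hφt => h2 t ht (neg_ne_zero.mpr hφt)⟩
  obtain ⟨b, hb, hT⟩ := hbd
  by_contra! hcon
  obtain ⟨t0, ht0, ht0Ω, ht0φ⟩ := hcon
  set T : Set ℝ := {t | 0 ≤ t ∧ t • e ∈ Ω ∧ φ (t • e) ≠ 0} with hTdef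
  have hTne : T.Nonempty := ⟨t0, ht0, ht0Ω, ht0φ⟩
  have hTb : BddAbove T := ⟨b, fun t ht => hT t ht.2.1 ht.2.2⟩
  set s := sSup T with hsdef
  have hs0 : 0 ≤ s := ht0.trans (le_csSup hTb ⟨ht0, ht0Ω, ht0φ⟩)
  have hsb : s ≤ b := csSup_le hTne fun t ht => hT t ht.2.1 ht.2.2
  have hsΩ : s • e ∈ Ω := hsym b s hb (by
    rw [abs_of_nonneg hs0]; exact hsb.trans (le_abs_self b))
  have hc : Continuous fun t : ℝ => t • e := by fun_prop
  have habove : ∀ t, s < t → t • e ∈ Ω → φ (t • e) = 0 := by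
    intro t hst htΩ
    by_contra h
    exact absurd (le_csSup hTb ⟨hs0.trans hst.le, htΩ, h⟩) (not_le.mpr hst)
  have hφs : φ (s • e) = 0 := by
    by_contra h
    have hopen : IsOpen {t : ℝ | t • e ∈ Ω ∧ φ (t • e) ≠ 0} :=
      (S.isOpen.preimage hc).inter (isOpen_ne_fun (L.reg.continuous.comp hc) continuous_const)
    obtain ⟨ρ, hρ, hball⟩ := Metric.isOpen_iff.mp hopen s ⟨hsΩ, h⟩
    have := hball (show s + ρ / 2 ∈ ball s ρ by
      rw [mem_ball, Real.dist_eq, add_sub_cancel_left, abs_of_pos (by positivity)]; linarith)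
    exact this.2 (habove _ (by linarith) this.1)
  have hesc : Escapes Ω φ (s • e) := by
    obtain ⟨t, ht, _, hfr⟩ := exists_exit S.isOpen S.bdd hsΩ he
    rw [S.isOpen.frontier_eq] at hfr
    refine ⟨_, hfr.2, fun x hx hxΩ => ?_⟩
    rw [segment_eq_image] at hx
    obtain ⟨θ, hθ, rfl⟩ := hx
    have e1 : (1 - θ) • s • e + θ • (s • e + t • e) = (s + θ * t) • e := by module
    simp only [e1] at hxΩ ⊢
    rcases (mul_nonneg hθ.1 ht.le).eq_or_lt with h | h
    · rw [← h, add_zero]; exact hφs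
    · exact habove _ (by linarith) hxΩ
  obtain ⟨ρ, hρ, _, hzero⟩ := S.eq_zero_near_of_escapes L hX hsΩ hφs hesc
  obtain ⟨t, ht, hst⟩ := exists_lt_of_lt_csSup hTne (show s - ρ < sSup T by linarith)
  refine ht.2.2 (hzero _ ?_)
  have := le_csSup hTb ht
  rw [mem_ball, dist_eq_norm, ← sub_smul, norm_smul, he, mul_one, Real.norm_eq_abs, abs_lt]
  constructor <;> linarith

end SemilinearSol
end NodalContact

section BallCase
variable {N : ℕ}
local notation "E" => EuclideanSpace ℝ (Fin N)

theorem symDir_ball (R : ℝ) {e : E} (he : ‖e‖ = 1) : SymDir (ball (0 : E) R) e := by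
  intro x hx t ht
  rw [mem_ball_zero_iff] at hx ⊢
  refine lt_of_le_of_lt ?_ hx
  rw [← abs_of_nonneg (norm_nonneg x), ← abs_of_nonneg (norm_nonneg (x + _)), ← sq_le_sq]
  have h1 := sq_le_sq.mpr ht
  have h2 := norm_add_sq_real x ((t - inner ℝ x e) • e)
  rw [inner_smul_right, norm_smul, he, mul_one, Real.norm_eq_abs, sq_abs] at h2
  rw [h2]
  nlinarith

theorem isPreconnected_cap_ball (R : ℝ) (e : E) :
    IsPreconnected {x | x ∈ ball (0 : E) R ∧ 0 < inner ℝ x e} := by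
  refine ((convex_ball 0 R).inter (t := {x : E | 0 < inner ℝ x e}) ?_).isPreconnected
  simpa only [real_inner_comm] using
    convex_halfSpace_gt (f := fun x : E => (inner ℝ e x : ℝ)) (innerSL ℝ e).isLinear 0

theorem hasTopPoint_ball {R : ℝ} (hR : 0 < R) {e : E} (he : ‖e‖ = 1) :
    HasTopPoint (ball (0 : E) R) e := by
  refine ⟨R • e, R, hR, ?_, ?_, by rw [sub_self]⟩
  · rw [frontier_ball _ hR.ne', mem_sphere_zero_iff_norm, norm_smul, he, mul_one,
      Real.norm_eq_abs, abs_of_pos hR]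
  · intro x hx
    rw [mem_ball_zero_iff] at hx
    rw [inner_smul_left, real_inner_self_eq_norm_sq, he]
    have := real_inner_le_norm x e
    rw [he] at this
    simp only [one_pow, mul_one, conj_trivial] at this ⊢
    linarith

theorem planeRefl_swap {x y : E} (hxy : ‖x‖ = ‖y‖) (hne : x ≠ y) :
    ∃ e : E, ‖e‖ = 1 ∧ planeRefl e 0 x = y := by
  have hn : ‖x - y‖ ≠ 0 := norm_ne_zero_iff.mpr (sub_ne_zero.mpr hne)
  refine ⟨‖x - y‖⁻¹ • (x - y), by rw [norm_smul, norm_inv, norm_norm, inv_mul_cancel₀ hn], ?_⟩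
  have h1 : inner ℝ x (x - y) = ‖x - y‖ ^ 2 / 2 := by
    rw [norm_sub_sq_real, inner_sub_right, real_inner_self_eq_norm_sq, ← hxy]; ring
  rw [planeRefl, inner_smul_right, h1, smul_smul]
  have h2 : 2 * (0 - ‖x - y‖⁻¹ * (‖x - y‖ ^ 2 / 2)) * ‖x - y‖⁻¹ = -1 := by
    field_simp
    ring
  rw [h2]; module

namespace SemilinearSol

variable {R : ℝ} {ψ φ : EuclideanSpace ℝ (Fin N) → ℝ} {f : ℝ → ℝ}

theorem radial_of_ball (hR : 0 < R) (S : SemilinearSol (ball 0 R) ψ f)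
    (L : LinearizedSol (ball 0 R) ψ f φ) :
    ∀ x ∈ ball (0 : E) R, ∀ y, ‖x‖ = ‖y‖ → φ x = φ y := by
  intro x hx y hxy
  by_cases hne : x = y
  · rw [hne]
  obtain ⟨e, he, hr⟩ := planeRefl_swap hxy hne
  rw [← hr]
  exact (S.linearized_even he (symDir_ball R he) (isPreconnected_cap_ball R e)
    (hasTopPoint_ball hR he) L x hx).symm

theorem norm_lt_of_escapes (hR : 0 < R) (S : SemilinearSol (ball 0 R) ψ f)
    (L : LinearizedSol (ball 0 R) ψ f φ) {z : EuclideanSpace ℝ (Fin N)}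
    (hz : Escapes (ball 0 R) φ z) : ∀ x ∈ ball (0 : E) R, φ x ≠ 0 → ‖x‖ < ‖z‖ := by
  intro x hx hφ
  by_contra! hle
  obtain ⟨z', hz', h0⟩ := hz
  rw [mem_ball_zero_iff] at hx
  rw [mem_ball_zero_iff, not_lt] at hz'
  obtain ⟨w, hw, hwx⟩ := (convex_segment z z').isPreconnected.intermediate_value
    (left_mem_segment ℝ z z') (right_mem_segment ℝ z z') (f := fun x => ‖x‖)
    continuous_norm.continuousOn ⟨hle, hx.le.trans hz'⟩
  refine hφ ?_
  rw [S.radial_of_ball hR L x (mem_ball_zero_iff.mpr hx) w hwx.symm]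
  refine h0 w hw (mem_ball_zero_iff.mpr ?_)
  have : ‖w‖ = ‖x‖ := hwx
  rwa [this]

theorem noOppositeEscape_ball (hR : 0 < R) (S : SemilinearSol (ball 0 R) ψ f)
    (L : LinearizedSol (ball 0 R) ψ f φ) : NoOppositeEscape (ball 0 R) φ := by
  intro z₁ h₁ z₂ h₂ e₁ e₂
  have hrad := S.radial_of_ball hR L
  have hφc := L.reg.continuous
  have hn1 := S.norm_lt_of_escapes hR L e₁
  have hn2 := S.norm_lt_of_escapes hR L e₂
  have hle1 : ‖z₁‖ ≤ ‖z₂‖ := closure_minimal (t := {x : E | ‖x‖ ≤ ‖z₂‖})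
    (fun x hx => (hn2 x hx.1 hx.2.ne').le) (isClosed_le continuous_norm continuous_const) h₁
  have hle2 : ‖z₂‖ ≤ ‖z₁‖ := closure_minimal (t := {x : E | ‖x‖ ≤ ‖z₁‖})
    (fun x hx => (hn1 x hx.1 hx.2.ne).le) (isClosed_le continuous_norm continuous_const) h₂
  have heq := le_antisymm hle1 hle2
  set T := ‖z₁‖ with hT
  have hTR : T ≤ R := by
    have : closure {x | x ∈ ball (0 : E) R ∧ 0 < φ x} ⊆ closedBall 0 R :=
      closure_minimal (fun x hx => ball_subset_closedBall hx.1) isClosed_closedBall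
    simpa using this h₁
  obtain ⟨x1, hx1⟩ := closure_nonempty_iff.mp ⟨z₁, h₁⟩
  have hTpos : 0 < T := (norm_nonneg _).trans_lt (hn1 x1 hx1.1 hx1.2.ne')
  obtain ⟨M, hM0, hM⟩ := S.coeff_bound
  obtain ⟨δ, hδ, hsmall⟩ := small_max_principle S.dim M
  obtain ⟨K, hKs, hKc, hKm⟩ := (isOpen_ball (x := (0 : E)) (ε := T)).measurableSet
    |>.exists_isCompact_sdiff_lt (isBounded_volume_ne_top isBounded_ball)
    (ε := ENNReal.ofReal δ) (by simpa using hδ)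
  obtain ⟨s0, hs00, hs0T, hs0⟩ : ∃ s0 : ℝ, 0 ≤ s0 ∧ s0 < T ∧ ∀ x ∈ K, ‖x‖ ≤ s0 := by
    obtain ⟨w, hw, hmax⟩ := (hKc.insert 0).exists_isMaxOn (insert_nonempty 0 K)
      (f := fun x : E => ‖x‖) continuous_norm.continuousOn
    refine ⟨‖w‖, norm_nonneg _, ?_, fun x hx => hmax (mem_insert_of_mem _ hx)⟩
    rcases hw with rfl | hw
    · simpa using hTpos
    · simpa using hKs hw
  have hnear : ∀ z : E, ‖z‖ = T → ∀ P : Set E, z ∈ closure P → ∃ x ∈ P, s0 < ‖x‖ := by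
    intro z hz P hzP
    obtain ⟨x, hx, hxP⟩ := mem_closure_iff.mp hzP {x : E | s0 < ‖x‖}
      (isOpen_lt continuous_const continuous_norm) (by
        show s0 < ‖z‖
        rwa [hz])
    exact ⟨x, hxP, hx⟩
  obtain ⟨x, hx, hxs⟩ := hnear z₁ rfl _ h₁
  obtain ⟨y, hy, hys⟩ := hnear z₂ heq.symm _ h₂
  set u : E := EuclideanSpace.single ⟨0, by have := S.dim; omega⟩ 1 with hu
  have hun : ‖u‖ = 1 := by simp [hu]
  have hnu : ∀ r : ℝ, 0 ≤ r → ‖r • u‖ = r := fun r hr => by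
    rw [norm_smul, hun, mul_one, Real.norm_eq_abs, abs_of_nonneg hr]
  have hφx : 0 < φ (‖x‖ • u) := by
    rw [← hrad x hx.1 _ (hnu _ (norm_nonneg _)).symm]; exact hx.2
  have hφy : φ (‖y‖ • u) < 0 := by
    rw [← hrad y hy.1 _ (hnu _ (norm_nonneg _)).symm]; exact hy.2
  obtain ⟨s, hs, hs'⟩ := (isPreconnected_Ioo (a := s0) (b := T)).intermediate_value
    (f := fun r : ℝ => φ (r • u)) ⟨hys, heq ▸ hn2 y hy.1 hy.2.ne⟩
    ⟨hxs, hn1 x hx.1 hx.2.ne'⟩ (by fun_prop : Continuous fun r : ℝ => φ (r • u)).continuousOn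
    ⟨hφy.le, hφx.le⟩
  set U : Set E := {x | s < ‖x‖ ∧ ‖x‖ < T} with hU
  have hUo : IsOpen U := (isOpen_lt continuous_const continuous_norm).inter
    (isOpen_lt continuous_norm continuous_const)
  have hUsub : U ⊆ ball 0 R := fun w hw => mem_ball_zero_iff.mpr (hw.2.trans_le hTR)
  have hfr : ∀ w ∈ frontier U, φ w = 0 := by
    intro w hw
    rw [hUo.frontier_eq] at hw
    have hcl : s ≤ ‖w‖ ∧ ‖w‖ ≤ T := closure_minimal (t := {w : E | s ≤ ‖w‖ ∧ ‖w‖ ≤ T})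
      (fun w hw => ⟨hw.1.le, hw.2.le⟩)
      ((isClosed_le continuous_const continuous_norm).inter
        (isClosed_le continuous_norm continuous_const)) hw.1
    rcases hcl.1.eq_or_lt with h | h
    · rw [hrad w (mem_ball_zero_iff.mpr (h ▸ hs.2.trans_le hTR)) (s • u)
        (by rw [hnu s (hs00.trans hs.1.le), h])]
      exact hs'
    · have hwT : ‖w‖ = T := le_antisymm hcl.2 (not_lt.mp fun h' => hw.2 ⟨h, h'⟩)
      rcases hTR.eq_or_lt with h' | h'
      · refine L.zero w ?_
        rw [frontier_ball _ hR.ne', mem_sphere_zero_iff_norm, hwT, h']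
      · by_contra hne
        exact absurd (hn1 w (mem_ball_zero_iff.mpr (hwT ▸ h')) hne) (by rw [hwT]; exact lt_irrefl _)
  have hvol : volume.real U < δ := by
    refine ENNReal.toReal_lt_of_lt_ofReal (lt_of_le_of_lt (measure_mono ?_) hKm)
    exact fun w hw => ⟨mem_ball_zero_iff.mpr hw.2, fun hwK =>
      absurd (hs0 w hwK) (not_le.mpr (hs.1.trans hw.1))⟩
  have hnonneg : ∀ φ : E → ℝ, LinearizedSol (ball 0 R) ψ f φ → (∀ w ∈ frontier U, φ w = 0) →
      ∀ w ∈ U, 0 ≤ φ w := fun φ L hfr =>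
    hsmall U φ _ hUo (isBounded_ball.subset hUsub) hvol L.reg
      (S.coeff_continuous.mul L.reg.continuous) (L.weq.mono hUsub)
      (fun w hw hneg => by
        have := hM w (hUsub hw)
        exact mul_le_mul_of_nonpos_right this hneg.le) (fun w hw => (hfr w hw).ge)
  obtain ⟨w, hwU, hw⟩ := mem_closure_iff.mp h₁ {x : E | s < ‖x‖}
    (isOpen_lt continuous_const continuous_norm) hs.2
  have := hnonneg _ L.neg (fun w hw => by simp [hfr w hw]) w ⟨hwU, hn1 w hw.1 hw.2.ne'⟩
  have := hw.2
  linarith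

/-- On a ball, a solution of the linearized equation with `∫ f'(ψ) φ = 0` vanishes. -/
theorem linearized_eq_zero_ball (hR : 0 < R) (S : SemilinearSol (ball 0 R) ψ f)
    (L : LinearizedSol (ball 0 R) ψ f φ) (hint : ∫ x in ball 0 R, deriv f (ψ x) * φ x = 0) :
    ∀ x ∈ ball (0 : E) R, φ x = 0 := by
  set u : E := EuclideanSpace.single ⟨0, by have := S.dim; omega⟩ 1 with hu
  have hun : ‖u‖ = 1 := by simp [hu]
  have hax := S.eq_zero_on_axis L hint (S.noOppositeEscape_ball hR L) hun (symDir_ball R hun)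
    (fun x hx => by
      rw [mem_ball_zero_iff] at hx ⊢
      rw [norm_smul, hun, mul_one, Real.norm_eq_abs]
      have := abs_real_inner_le_norm x u
      rw [hun, mul_one] at this
      linarith) ⟨0, mem_ball_self hR⟩
  intro x hx
  have hn : ‖x‖ = ‖(‖x‖ • u)‖ := by rw [norm_smul, hun, mul_one, norm_norm]
  rw [S.radial_of_ball hR L x hx _ hn]
  refine hax _ (norm_nonneg _) ?_
  rwa [mem_ball_zero_iff, ← hn, ← mem_ball_zero_iff]

end SemilinearSol
end BallCase

section Crossing

open unitInterval in
/-- A nonvanishing continuous complex function on the square has a continuous logarithm. -/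
theorem exists_continuous_log {H : I × I → ℂ} (hc : Continuous H) (h0 : ∀ q, H q ≠ 0) {w : ℂ}
    (hw : Complex.exp w = H (0, 0)) :
    ∃ L : I × I → ℂ, Continuous L ∧ (∀ q, Complex.exp (L q) = H q) ∧ L (0, 0) = w := by
  let Hc : C(I × I, {z : ℂ // z ≠ 0}) := ⟨fun q => ⟨H q, h0 q⟩, hc.subtype_mk _⟩
  let γ : C(I, {z : ℂ // z ≠ 0}) := Hc.comp ⟨fun a => (0, a), by fun_prop⟩
  have cov := Complex.isCoveringMap_exp
  have hγ : γ 0 = ⟨Complex.exp w, w.exp_ne_zero⟩ := Subtype.ext hw.symm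
  let Γ := cov.liftPath γ w hγ
  have hH : ∀ a, Hc (0, a) = ⟨Complex.exp (Γ a), (Γ a).exp_ne_zero⟩ := fun a =>
    (congr_fun (cov.liftPath_lifts γ w hγ) a).symm
  refine ⟨cov.liftHomotopy Hc Γ hH, (cov.liftHomotopy Hc Γ hH).continuous, fun q => ?_, ?_⟩
  · exact congr_arg Subtype.val (congr_fun (cov.liftHomotopy_lifts Hc Γ hH) q)
  · rw [cov.liftHomotopy_zero Hc Γ hH]
    exact cov.liftPath_zero γ w hγ

theorem mem_Icc_of_avoids {X : Type*} [TopologicalSpace X] [PreconnectedSpace X] {θ : X → ℝ}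
    (hθ : Continuous θ) {l u δ : ℝ} (hδ : 0 < δ) (h1 : ∀ t, θ t ∉ Ioo (l - δ) l)
    (h2 : ∀ t, θ t ∉ Ioo u (u + δ)) {t₀ : X} (h0 : θ t₀ ∈ Icc l u) (t : X) : θ t ∈ Icc l u := by
  have hoc := (isPreconnected_range hθ).ordConnected
  constructor
  · by_contra! hlt
    obtain ⟨s, hs⟩ := hoc.out (mem_range_self t) (mem_range_self t₀)
      (show max (θ t) (l - δ / 2) ∈ Icc (θ t) (θ t₀) from
        ⟨le_max_left _ _, max_le (hlt.le.trans h0.1) (by linarith [h0.1])⟩)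
    refine h1 s ?_
    rw [hs]
    exact ⟨lt_max_of_lt_right (by linarith), max_lt hlt (by linarith)⟩
  · by_contra! hlt
    obtain ⟨s, hs⟩ := hoc.out (mem_range_self t₀) (mem_range_self t)
      (show min (θ t) (u + δ / 2) ∈ Icc (θ t₀) (θ t) from
        ⟨le_min (h0.2.trans hlt.le) (by linarith [h0.2]), min_le_left _ _⟩)
    refine h2 s ?_
    rw [hs]
    exact ⟨lt_min hlt (by linarith), min_lt_of_right_lt (by linarith)⟩

open unitInterval Real in
/-- Two paths in the closed quadrant cross: one joins the horizontal axis to the vertical axis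
inside a lower set, the other starts on the horizontal axis closer to the origin and leaves the
lower set. -/
theorem exists_crossing {f g : I → ℂ} (hf : Continuous f) (hg : Continuous g) {a b d : ℝ}
    (ha : 0 ≤ a) (hab : a < b) (hf0 : f 0 = a) (hg0 : g 0 = b)
    (hg1 : g 1 = d * Complex.I) (hfq : ∀ s, 0 ≤ (f s).re ∧ 0 ≤ (f s).im)
    (hgq : ∀ s, 0 ≤ (g s).re ∧ 0 ≤ (g s).im)
    (hout : ∀ t, ¬ ((f 1).re ≤ (g t).re ∧ (f 1).im ≤ (g t).im)) : ∃ s t, f s = g t := by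
  by_contra! hne
  have hexp : Complex.exp (Real.log (b - a) + π * Complex.I) = f (0, 0).1 - g (0, 0).2 := by
    rw [Complex.exp_add, Complex.exp_pi_mul_I, ← Complex.ofReal_exp,
      Real.exp_log (by linarith), hf0, hg0]
    push_cast
    ring
  obtain ⟨L, hL, hLe, hL0⟩ := exists_continuous_log (H := fun q => f q.1 - g q.2)
    (by fun_prop) (fun q => sub_ne_zero.mpr (hne q.1 q.2)) hexp
  set θ : I × I → ℝ := fun q => (L q).im with hθ
  have hθc : Continuous θ := Complex.continuous_im.comp hL
  have h00 : θ (0, 0) = π := by simp [hθ, hL0]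
  have hre : ∀ q, Real.exp (L q).re * cos (θ q) = (f q.1).re - (g q.2).re := fun q => by
    rw [← Complex.exp_re, hLe]; rfl
  have him : ∀ q, Real.exp (L q).re * sin (θ q) = (f q.1).im - (g q.2).im := fun q => by
    rw [← Complex.exp_im, hLe]; rfl
  have hpi := Real.pi_pos
  have hsinpos : ∀ x : ℝ, 0 < x → x < π → 0 < sin x := fun x h1 h2 => sin_pos_of_pos_of_lt_pi h1 h2
  have hsin2 : ∀ x : ℝ, 2 * π < x → x < 3 * π → 0 < sin x := fun x h1 h2 => by
    rw [← sin_sub_two_pi]; exact hsinpos _ (by linarith) (by linarith)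
  have hsin1 : ∀ x : ℝ, π < x → x < 2 * π → sin x < 0 := fun x h1 h2 => by
    have := hsinpos (x - π) (by linarith) (by linarith)
    rw [sin_sub_pi] at this; linarith
  have hsin3 : ∀ x : ℝ, 3 * π < x → x < 4 * π → sin x < 0 := fun x h1 h2 => by
    rw [← sin_sub_two_pi]; exact hsin1 _ (by linarith) (by linarith)
  have hcos1 : ∀ x : ℝ, π / 2 < x → x < 3 * π / 2 → cos x < 0 := fun x h1 h2 =>
    cos_neg_of_pi_div_two_lt_of_lt h1 (by linarith)
  have hcos2 : ∀ x : ℝ, 5 * π / 2 < x → x < 7 * π / 2 → cos x < 0 := fun x h1 h2 => by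
    rw [← cos_sub_two_pi]; exact hcos1 _ (by linarith) (by linarith)
  have nosin : ∀ q, (f q.1).im - (g q.2).im ≤ 0 → ¬ 0 < sin (θ q) := fun q h h' => by
    have := mul_pos (Real.exp_pos (L q).re) h'
    rw [him] at this; linarith
  have nosin' : ∀ q, 0 ≤ (f q.1).im - (g q.2).im → ¬ sin (θ q) < 0 := fun q h h' => by
    have := mul_neg_of_pos_of_neg (Real.exp_pos (L q).re) h'
    rw [him] at this; linarith
  have nocos : ∀ q, 0 ≤ (f q.1).re - (g q.2).re → ¬ cos (θ q) < 0 := fun q h h' => by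
    have := mul_neg_of_pos_of_neg (Real.exp_pos (L q).re) h'
    rw [hre] at this; linarith
  have e1 : θ (0, 1) ∈ Icc π (2 * π) := by
    refine mem_Icc_of_avoids (θ := fun t => θ (0, t)) (t₀ := 0) (by fun_prop) hpi
      (fun t ht => ?_) (fun t ht => ?_) (by rw [h00]; constructor <;> linarith) 1
    · refine nosin (0, t) ?_ (hsinpos _ (by linarith [ht.1]) ht.2)
      simp only [hf0, Complex.ofReal_im]; linarith [(hgq t).2]
    · refine nosin (0, t) ?_ (hsin2 _ ht.1 (by linarith [ht.2]))
      simp only [hf0, Complex.ofReal_im]; linarith [(hgq t).2]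
  have e1' : 3 * π / 2 ≤ θ (0, 1) := by
    by_contra! hlt
    refine nocos (0, 1) ?_ (hcos1 _ (by linarith [e1.1]) hlt)
    simp [hf0, hg1, ha]
  have e2 : θ (1, 1) ∈ Icc (3 * π / 2) (5 * π / 2) := by
    have hnn : ∀ s, 0 ≤ (f s).re - (g 1).re := fun s => by simpa [hg1] using (hfq s).1
    refine mem_Icc_of_avoids (θ := fun s => θ (s, 1)) (t₀ := 0) (by fun_prop) hpi
      (fun s hs => nocos (s, 1) (hnn s) (hcos1 _ (by linarith [hs.1]) hs.2))
      (fun s hs => nocos (s, 1) (hnn s) (hcos2 _ hs.1 (by linarith [hs.2])))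
      ⟨e1', by linarith [e1.2]⟩ 1
  have e3 : θ (1, 0) ∈ Icc (3 * π / 2) (3 * π) := by
    have key : ∀ t, cos (θ (1, t)) < 0 → sin (θ (1, t)) < 0 → False := fun t hc hs => by
      have h1 := mul_neg_of_pos_of_neg (Real.exp_pos (L (1, t)).re) hc
      have h2 := mul_neg_of_pos_of_neg (Real.exp_pos (L (1, t)).re) hs
      rw [hre] at h1
      rw [him] at h2
      exact hout t ⟨by linarith, by linarith⟩
    refine mem_Icc_of_avoids (θ := fun t => θ (1, t)) (t₀ := 1) (by fun_prop) (half_pos hpi)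
      (fun t ht => key t (hcos1 _ (by linarith [ht.1]) ht.2)
        (hsin1 _ (by linarith [ht.1]) (by linarith [ht.2])))
      (fun t ht => key t (hcos2 _ (by linarith [ht.1]) (by linarith [ht.2]))
        (hsin3 _ ht.1 (by linarith [ht.2])))
      ⟨e2.1, by linarith [e2.2]⟩ 0
  have e4 : θ (1, 0) ∈ Icc 0 π := by
    have hnn : ∀ s, 0 ≤ (f s).im - (g 0).im := fun s => by simpa [hg0] using (hfq s).2
    refine mem_Icc_of_avoids (θ := fun s => θ (s, 0)) (t₀ := 0) (by fun_prop) hpi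
      (fun s hs => nosin' (s, 0) (hnn s) ?_)
      (fun s hs => nosin' (s, 0) (hnn s) (hsin1 _ hs.1 (by linarith [hs.2])))
      (by rw [h00]; constructor <;> linarith) 1
    exact sin_neg_of_neg_of_neg_pi_lt hs.2 (by linarith [hs.1])
  linarith [e3.1, e4.2]

end Crossing

section Quadrant

/-- The two coordinate reflections fold the plane onto the closed first quadrant. -/
def foldQuadrant (x : EuclideanSpace ℝ (Fin 2)) : ℂ := ⟨|x 0|, |x 1|⟩

theorem continuous_foldQuadrant : Continuous foldQuadrant := by
  have h : foldQuadrant = fun x => ((|x 0| : ℝ) : ℂ) + ((|x 1| : ℝ) : ℂ) * Complex.I := by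
    ext x
    exact Complex.mk_eq_add_mul_I _ _
  rw [h]
  fun_prop

theorem nodal_regions_cross {Ω D₁ D₂ : Set (EuclideanSpace ℝ (Fin 2))}
    {φ : EuclideanSpace ℝ (Fin 2) → ℝ}
    (hlow : ∀ x ∈ Ω, ∀ y : EuclideanSpace ℝ (Fin 2), |y 0| ≤ |x 0| → |y 1| ≤ |x 1| → y ∈ Ω)
    (heven : ∀ x ∈ Ω, ∀ y : EuclideanSpace ℝ (Fin 2), |y 0| = |x 0| → |y 1| = |x 1| → φ y = φ x)
    (hc₁ : IsPathConnected D₁) (hs₁ : D₁ ⊆ {x | x ∈ Ω ∧ 0 < φ x})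
    (hc₂ : IsPathConnected D₂) (hs₂ : D₂ ⊆ {x | x ∈ Ω ∧ φ x < 0})
    {z : EuclideanSpace ℝ (Fin 2)} (hz : z ∈ closure D₁) (hesc : Escapes Ω φ z)
    {x₁ x₂ y₂ : EuclideanSpace ℝ (Fin 2)} (hx₁ : x₁ ∈ D₁) (hx₁0 : x₁ 1 = 0)
    (hx₂ : x₂ ∈ D₂) (hx₂0 : x₂ 1 = 0) (hy₂ : y₂ ∈ D₂) (hy₂0 : y₂ 0 = 0)
    (hlt : |x₁ 0| < |x₂ 0|) : False := by
  obtain ⟨z', hz', hseg⟩ := hesc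
  obtain ⟨η, hη⟩ := hc₂.joinedIn x₂ hx₂ y₂ hy₂
  have hfold : ∀ x y, foldQuadrant x = foldQuadrant y → |x 0| = |y 0| ∧ |x 1| = |y 1| :=
    fun x y h => ⟨congr_arg Complex.re h, congr_arg Complex.im h⟩
  set K : Set (EuclideanSpace ℝ (Fin 2)) := foldQuadrant ⁻¹' (range fun t => foldQuadrant (η t))
    with hK
  have hKneg : ∀ x ∈ K, x ∈ Ω ∧ φ x < 0 := by
    rintro x ⟨t, ht⟩
    obtain ⟨h1, h2⟩ := hfold _ _ ht
    obtain ⟨h3, h4⟩ := hs₂ (hη t)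
    exact ⟨hlow _ h3 _ h1.ge h2.ge, by rwa [heven _ h3 _ h1.symm h2.symm]⟩
  have hKc : IsClosed K :=
    (isCompact_range (continuous_foldQuadrant.comp η.continuous)).isClosed.preimage
      continuous_foldQuadrant
  have hsegK : ∀ x ∈ segment ℝ z z', x ∉ K := fun x hx hxK =>
    (hKneg x hxK).2.ne (hseg x hx (hKneg x hxK).1)
  obtain ⟨ρ, hρ, hball⟩ := Metric.isOpen_iff.mp hKc.isOpen_compl z
    (hsegK z (left_mem_segment ℝ z z'))
  obtain ⟨w, hw, hwz⟩ := Metric.mem_closure_iff.mp hz ρ hρ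
  have hsegw : ∀ x ∈ segment ℝ w z, x ∉ K := fun x hx =>
    hball ((convex_ball z ρ).segment_subset (by rwa [mem_ball, dist_comm])
      (mem_ball_self hρ) hx)
  have hD₁K : ∀ x ∈ D₁, x ∉ K := fun x hx hxK => (hKneg x hxK).2.not_gt (hs₁ hx).2
  have hA : IsPathConnected (D₁ ∪ (segment ℝ w z ∪ segment ℝ z z')) := by
    refine hc₁.union (IsPathConnected.union ?_ ?_
      ⟨z, right_mem_segment ℝ w z, left_mem_segment ℝ z z'⟩)
      ⟨w, hw, Or.inl (left_mem_segment ℝ w z)⟩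
    · exact (convex_segment w z).isPathConnected ⟨w, left_mem_segment ℝ w z⟩
    · exact (convex_segment z z').isPathConnected ⟨z, left_mem_segment ℝ z z'⟩
  obtain ⟨γ, hγ⟩ := hA.joinedIn x₁ (Or.inl hx₁) z' (Or.inr (Or.inr (right_mem_segment ℝ z z')))
  have hγK : ∀ s, γ s ∉ K := fun s => by
    rcases hγ s with h | h | h
    · exact hD₁K _ h
    · exact hsegw _ h
    · exact hsegK _ h
  obtain ⟨s, t, hst⟩ := exists_crossing (f := fun s => foldQuadrant (γ s))
    (g := fun s => foldQuadrant (η s)) (a := |x₁ 0|) (b := |x₂ 0|) (d := |y₂ 1|)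
    (continuous_foldQuadrant.comp γ.continuous) (continuous_foldQuadrant.comp η.continuous)
    (abs_nonneg _) hlt
    (by simp [foldQuadrant, hx₁0, Complex.ext_iff]) (by simp [foldQuadrant, hx₂0, Complex.ext_iff])
    (by simp [foldQuadrant, hy₂0, Complex.ext_iff])
    (fun s => ⟨abs_nonneg _, abs_nonneg _⟩) (fun s => ⟨abs_nonneg _, abs_nonneg _⟩)
    (fun t h => hz' (by
      rw [γ.target] at h
      exact hlow _ (hs₂ (hη t)).1 _ h.1 h.2))
  exact hγK s ⟨t, hst.symm⟩

end Quadrant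

section Components
variable {N : ℕ}
local notation "E" => EuclideanSpace ℝ (Fin N)

/-- `e` is a unit direction in which the moving plane method applies to `Ω`. -/
structure Admissible (Ω : Set E) (e : E) : Prop where
  unit : ‖e‖ = 1
  sym : SymDir Ω e
  conn : IsPreconnected {x | x ∈ Ω ∧ 0 < inner ℝ x e}
  top : HasTopPoint Ω e

theorem eq_zero_of_mem_frontier_component {Ω : Set E} {φ : E → ℝ} (hΩ : IsOpen Ω)
    (hφ : Continuous φ) (h0 : ∀ x ∈ frontier Ω, φ x = 0) (x : E) :
    ∀ y ∈ frontier (connectedComponentIn {x | x ∈ Ω ∧ 0 < φ x} x), φ y = 0 := by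
  set P : Set E := {x | x ∈ Ω ∧ 0 < φ x} with hP
  have hPo : IsOpen P := hΩ.inter (isOpen_lt continuous_const hφ)
  have hDo : IsOpen (connectedComponentIn P x) := hPo.connectedComponentIn
  intro y hy
  rw [hDo.frontier_eq] at hy
  have hyP : y ∈ closure P := closure_mono (connectedComponentIn_subset P x) hy.1
  by_contra hne
  have hypos : 0 < φ y := lt_of_le_of_ne
    (closure_minimal (fun w hw => (show 0 < φ w from hw.2).le)
      (isClosed_le continuous_const hφ) hyP) (Ne.symm hne)
  have hyΩ : y ∈ Ω := by
    by_contra h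
    refine hne (h0 y ?_)
    rw [hΩ.frontier_eq]
    exact ⟨closure_mono (fun w hw => hw.1) hyP, h⟩
  obtain ⟨w, hw1, hw2⟩ := mem_closure_iff.mp hy.1 _ (hPo.connectedComponentIn (x := y))
    (mem_connectedComponentIn ⟨hyΩ, hypos⟩)
  refine hy.2 ?_
  rw [connectedComponentIn_eq hw2, ← connectedComponentIn_eq hw1]
  exact mem_connectedComponentIn ⟨hyΩ, hypos⟩

namespace SemilinearSol

variable {Ω : Set (EuclideanSpace ℝ (Fin N))} {ψ : EuclideanSpace ℝ (Fin N) → ℝ} {f : ℝ → ℝ}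
variable {e : EuclideanSpace ℝ (Fin N)} {φ : EuclideanSpace ℝ (Fin N) → ℝ}

theorem component_meets_hyperplane (S : SemilinearSol Ω ψ f) (L : LinearizedSol Ω ψ f φ)
    (h₁ : Admissible Ω e) (h₂ : Admissible Ω (-e)) {x : EuclideanSpace ℝ (Fin N)}
    (hx : x ∈ {x | x ∈ Ω ∧ 0 < φ x}) :
    ∃ y ∈ connectedComponentIn {x | x ∈ Ω ∧ 0 < φ x} x, inner ℝ y e = 0 := by
  set P : Set E := {x | x ∈ Ω ∧ 0 < φ x} with hP
  set D := connectedComponentIn P x with hD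
  have hDP : D ⊆ P := connectedComponentIn_subset P x
  have hPo : IsOpen P := S.isOpen.inter (isOpen_lt continuous_const L.reg.continuous)
  have hxD : x ∈ D := mem_connectedComponentIn hx
  have key : ∀ e : E, Admissible Ω e → ¬ ∀ y ∈ D, 0 < inner ℝ y e := fun e h hall => by
    have := S.nodal_not_in_cap h.unit h.sym h.conn h.top L.reg hPo.connectedComponentIn
      (fun y hy => ⟨(hDP hy).1, hall y hy⟩) (L.weq.mono fun y hy => (hDP hy).1)
      (fun y hy => (hDP hy).2)
      (eq_zero_of_mem_frontier_component S.isOpen L.reg.continuous L.zero x)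
    exact (this ▸ hxD : x ∈ (∅ : Set E))
  obtain ⟨a, haD, ha⟩ := not_forall₂.mp (key e h₁)
  obtain ⟨b, hbD, hb⟩ := not_forall₂.mp (key (-e) h₂)
  rw [inner_neg_right] at hb
  obtain ⟨y, hy, hy0⟩ := isPreconnected_connectedComponentIn.intermediate_value haD hbD
    (f := fun y => inner ℝ y e) (continuous_id.inner continuous_const).continuousOn
    (show (0 : ℝ) ∈ _ from ⟨not_lt.mp ha, by linarith⟩)
  exact ⟨y, hy, hy0⟩

theorem exists_component_closure (S : SemilinearSol Ω ψ f) (L : LinearizedSol Ω ψ f φ)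
    {z : EuclideanSpace ℝ (Fin N)} (hz : z ∈ closure {x | x ∈ Ω ∧ 0 < φ x}) :
    ∃ x ∈ {x | x ∈ Ω ∧ 0 < φ x}, z ∈ closure (connectedComponentIn {x | x ∈ Ω ∧ 0 < φ x} x) := by
  set P : Set E := {x | x ∈ Ω ∧ 0 < φ x} with hP
  have hPo : IsOpen P := S.isOpen.inter (isOpen_lt continuous_const L.reg.continuous)
  have hPb : Bornology.IsBounded P := S.bdd.subset fun x hx => hx.1
  obtain ⟨M, hM0, hM⟩ := S.coeff_bound
  obtain ⟨δ, hδ, hsmall⟩ := small_max_principle S.dim M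
  set C : Set (Set E) := connectedComponentIn P '' P with hC
  have hCsub : ∀ D ∈ C, D ⊆ P := by
    rintro _ ⟨x, -, rfl⟩
    exact connectedComponentIn_subset P x
  have hCo : ∀ D ∈ C, IsOpen D := by
    rintro _ ⟨x, -, rfl⟩
    exact hPo.connectedComponentIn
  have hvol : ∀ D ∈ C, ENNReal.ofReal δ ≤ volume D := by
    rintro _ ⟨x, hx, rfl⟩
    set D := connectedComponentIn P x
    have hDP : D ⊆ P := connectedComponentIn_subset P x
    by_contra! hlt
    have := hsmall D (fun y => - φ y) _ hPo.connectedComponentIn (hPb.subset hDP)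
      (ENNReal.toReal_lt_of_lt_ofReal hlt) L.neg.reg
      (S.coeff_continuous.mul L.neg.reg.continuous) (L.neg.weq.mono fun y hy => (hDP hy).1)
      (fun y hy hneg => mul_le_mul_of_nonpos_right (hM y (hDP hy).1) hneg.le)
      (fun y hy => by
        rw [eq_zero_of_mem_frontier_component S.isOpen L.reg.continuous L.zero x y hy, neg_zero])
      x (mem_connectedComponentIn hx)
    have := hx.2
    linarith
  have hdisj : Pairwise (Function.onFun Disjoint fun D : C => (D : Set E)) := by
    rintro ⟨_, x, hx, rfl⟩ ⟨_, y, hy, rfl⟩ hne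
    refine Set.disjoint_left.mpr fun w hw1 hw2 => hne (Subtype.ext ?_)
    exact (connectedComponentIn_eq hw1).trans (connectedComponentIn_eq hw2).symm
  have hfin : C.Finite := by
    have h := Measure.finite_const_le_meas_of_disjoint_iUnion volume
      (ε := ENNReal.ofReal δ) (by simpa using hδ) (fun D : C => (hCo D D.2).measurableSet) hdisj
      (isBounded_volume_ne_top (hPb.subset (iUnion_subset fun D => hCsub D D.2)))
    have huniv : {D : C | ENNReal.ofReal δ ≤ volume (D : Set E)} = univ :=
      eq_univ_of_forall fun D => hvol D D.2
    rw [huniv, finite_univ_iff] at h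
    exact h
  have hcover : P ⊆ ⋃ D ∈ C, D := fun x hx =>
    mem_biUnion (mem_image_of_mem _ hx) (mem_connectedComponentIn hx)
  have := closure_mono hcover hz
  rw [hfin.closure_biUnion] at this
  obtain ⟨_, ⟨x, hx, rfl⟩, hzx⟩ := mem_iUnion₂.mp this
  exact ⟨x, hx, hzx⟩

end SemilinearSol
end Components

section PlaneNodal


variable {Ω : Set (EuclideanSpace ℝ (Fin 2))} {ψ φ : EuclideanSpace ℝ (Fin 2) → ℝ} {f : ℝ → ℝ}

namespace SemilinearSol

theorem exists_nodal_component (S : SemilinearSol Ω ψ f) (L : LinearizedSol Ω ψ f φ)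
    (h₁ : ∀ i, Admissible Ω (EuclideanSpace.single i 1))
    (h₂ : ∀ i, Admissible Ω (-EuclideanSpace.single i 1))
    {z : EuclideanSpace ℝ (Fin 2)} (hz : z ∈ closure {x | x ∈ Ω ∧ 0 < φ x}) :
    ∃ D ⊆ {x | x ∈ Ω ∧ 0 < φ x}, IsPathConnected D ∧ z ∈ closure D ∧
      ∀ i, ∃ y ∈ D, y i = 0 := by
  obtain ⟨x, hx, hzx⟩ := S.exists_component_closure L hz
  have hPo : IsOpen {x | x ∈ Ω ∧ 0 < φ x} :=
    S.isOpen.inter (isOpen_lt continuous_const L.reg.continuous)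
  refine ⟨_, connectedComponentIn_subset _ x, ?_, hzx, fun i => ?_⟩
  · exact hPo.connectedComponentIn.isConnected_iff_isPathConnected.mp
      (isConnected_connectedComponentIn_iff.mpr hx)
  · obtain ⟨y, hy, h0⟩ := S.component_meets_hyperplane L (h₁ i) (h₂ i) hx
    exact ⟨y, hy, by simpa [EuclideanSpace.inner_single_right] using h0⟩

theorem noOppositeEscape_plane (S : SemilinearSol Ω ψ f) (L : LinearizedSol Ω ψ f φ)
    (h₁ : ∀ i, Admissible Ω (EuclideanSpace.single i 1))
    (h₂ : ∀ i, Admissible Ω (-EuclideanSpace.single i 1))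
    (hlow : ∀ x ∈ Ω, ∀ y : EuclideanSpace ℝ (Fin 2), |y 0| ≤ |x 0| → |y 1| ≤ |x 1| → y ∈ Ω)
    (heven : ∀ x ∈ Ω, ∀ y : EuclideanSpace ℝ (Fin 2), |y 0| = |x 0| → |y 1| = |x 1| → φ y = φ x) :
    NoOppositeEscape Ω φ := by
  intro z₁ hz₁ z₂ hz₂ e₁ e₂
  obtain ⟨D₁, hs₁, hc₁, hzD₁, hax₁⟩ := S.exists_nodal_component L h₁ h₂ hz₁
  obtain ⟨D₂, hs₂, hc₂, hzD₂, hax₂⟩ := S.exists_nodal_component L.neg h₁ h₂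
    (z := z₂) (by simpa only [Left.neg_pos_iff] using hz₂)
  obtain ⟨x₁, hx₁, hx₁0⟩ := hax₁ 1
  obtain ⟨x₂, hx₂, hx₂0⟩ := hax₂ 1
  obtain ⟨y₁, hy₁, hy₁0⟩ := hax₁ 0
  obtain ⟨y₂, hy₂, hy₂0⟩ := hax₂ 0
  rcases lt_trichotomy (|x₁ 0|) (|x₂ 0|) with h | h | h
  · exact nodal_regions_cross hlow heven hc₁ hs₁ hc₂
      (by simpa only [Left.neg_pos_iff] using hs₂) hzD₁ e₁ hx₁ hx₁0 hx₂ hx₂0 hy₂ hy₂0 h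
  · have h3 := heven x₁ (hs₁ hx₁).1 x₂ h.symm (by rw [hx₁0, hx₂0])
    have h4 : 0 < - φ x₂ := (hs₂ hx₂).2
    have h5 : 0 < φ x₁ := (hs₁ hx₁).2
    linarith
  · exact nodal_regions_cross hlow (fun x hx y hy0 hy1 => by rw [heven x hx y hy0 hy1]) hc₂ hs₂ hc₁
      (by simpa only [Left.neg_neg_iff] using hs₁) hzD₂ e₂.neg hx₂ hx₂0 hx₁ hx₁0 hy₁ hy₁0 h

/-- In the symmetric plane case, a solution of the linearized equation with `∫ f'(ψ) φ = 0`
vanishes. -/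
theorem linearized_eq_zero_plane (S : SemilinearSol Ω ψ f) (L : LinearizedSol Ω ψ f φ)
    (hint : ∫ x in Ω, deriv f (ψ x) * φ x = 0)
    (h₁ : ∀ i, Admissible Ω (EuclideanSpace.single i 1))
    (h₂ : ∀ i, Admissible Ω (-EuclideanSpace.single i 1)) (hne : Ω.Nonempty)
    (hlow : ∀ x ∈ Ω, ∀ y : EuclideanSpace ℝ (Fin 2), |y 0| ≤ |x 0| → |y 1| ≤ |x 1| → y ∈ Ω) :
    ∀ x ∈ Ω, φ x = 0 := by
  have hrefl : ∀ i, ∀ x ∈ Ω, φ (planeRefl (EuclideanSpace.single i 1) 0 x) = φ x := fun i =>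
    S.linearized_even (h₁ i).unit (h₁ i).sym (h₁ i).conn (h₁ i).top L
  have hrc : ∀ (i j : Fin 2) (x : EuclideanSpace ℝ (Fin 2)),
      planeRefl (EuclideanSpace.single i 1) 0 x j = if j = i then - x j else x j := by
    intro i j x
    by_cases h : j = i
    · subst h
      simp [planeRefl, EuclideanSpace.inner_single_right]
      ring
    · simp [planeRefl, EuclideanSpace.inner_single_right, h]
  have hstep : ∀ i, ∀ x ∈ Ω, ∀ y : EuclideanSpace ℝ (Fin 2), |y i| = |x i| →
      (∀ j, j ≠ i → y j = x j) → φ y = φ x := by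
    intro i x hx y hyi hyj
    rcases abs_eq_abs.mp hyi with h | h
    · congr 1
      ext j
      by_cases hj : j = i
      · rw [hj, h]
      · exact hyj j hj
    · rw [← hrefl i x hx]
      congr 1
      ext j
      rw [hrc]
      split_ifs with hj
      · rw [hj, h]
      · exact hyj j hj
  have heven : ∀ x ∈ Ω, ∀ y : EuclideanSpace ℝ (Fin 2), |y 0| = |x 0| → |y 1| = |x 1| →
      φ y = φ x := by
    intro x hx y h0 h1
    have hw : (!₂[y 0, x 1] : EuclideanSpace ℝ (Fin 2)) ∈ Ω :=
      hlow x hx _ (by simp [h0]) (by simp)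
    rw [hstep 1 _ hw y (by simpa using h1) (fun j hj => by fin_cases j <;> simp_all),
      hstep 0 x hx _ (by simpa using h0) (fun j hj => by fin_cases j <;> simp_all)]
  have hcoord : ∀ (x : EuclideanSpace ℝ (Fin 2)), inner ℝ x (EuclideanSpace.single 0 1) = x 0 :=
    fun x => by simp [EuclideanSpace.inner_single_right]
  have hcoord1 : ∀ (x : EuclideanSpace ℝ (Fin 2)), inner ℝ x (EuclideanSpace.single 1 1) = x 1 :=
    fun x => by simp [EuclideanSpace.inner_single_right]
  have hax := S.eq_zero_on_axis L hint (S.noOppositeEscape_plane L h₁ h₂ hlow heven) (h₁ 0).unit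
    (h₁ 0).sym (fun x hx => hlow x hx _ (by simp [hcoord]) (by simp [hcoord])) hne
  have haxis : ∀ x ∈ Ω, x 1 = 0 → φ x = 0 := by
    intro x hx h1
    have hw : (|x 0| • EuclideanSpace.single 0 1 : EuclideanSpace ℝ (Fin 2)) ∈ Ω :=
      hlow x hx _ (by simp) (by simp)
    exact (heven x hx _ (by simp) (by simp [h1])).symm.trans (hax _ (abs_nonneg _) hw)
  have key : ∀ φ : EuclideanSpace ℝ (Fin 2) → ℝ, LinearizedSol Ω ψ f φ →
      (∀ x ∈ Ω, x 1 = 0 → φ x = 0) → ∀ x ∈ Ω, φ x ≤ 0 := by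
    intro φ L h0 x hx
    by_contra! hpos
    obtain ⟨y, hy, hy0⟩ := S.component_meets_hyperplane L (h₁ 1) (h₂ 1) (x := x) ⟨hx, hpos⟩
    have hyP := connectedComponentIn_subset _ _ hy
    rw [hcoord1] at hy0
    exact hyP.2.ne' (h0 y hyP.1 hy0)
  intro x hx
  have ha := key φ L haxis x hx
  have hb := key _ L.neg (fun y hy h => by rw [haxis y hy h, neg_zero]) x hx
  linarith

end SemilinearSol
end PlaneNodal

section InteriorBall
variable {N : ℕ}
local notation "E" => EuclideanSpace ℝ (Fin N)

theorem exists_quadratic_bound {f : E → ℝ} (hf : ContDiff ℝ 2 f) (y : E) :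
    ∃ C ρ : ℝ, 0 ≤ C ∧ 0 < ρ ∧ ∀ x ∈ ball y ρ,
      |f x - f y - fderiv ℝ f y (x - y)| ≤ C * ‖x - y‖ ^ 2 := by
  obtain ⟨K, t, ht, hK⟩ := (hf.fderiv_right (m := 1) (by norm_num)).contDiffAt
    (x := y) |>.exists_lipschitzOnWith
  obtain ⟨ρ, hρ, hb⟩ := Metric.mem_nhds_iff.mp ht
  refine ⟨K, ρ, K.2, hρ, fun x hx => ?_⟩
  have hsub : closedBall y ‖x - y‖ ⊆ t := (closedBall_subset_ball (mem_ball_iff_norm.mp hx)).trans hb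
  have := (convex_closedBall y ‖x - y‖).norm_image_sub_le_of_norm_hasFDerivWithin_le'
    (f := f) (f' := fderiv ℝ f) (φ := fderiv ℝ f y) (C := K * ‖x - y‖) (x := y) (y := x)
    (fun z _ => (hf.differentiable two_ne_zero z).hasFDerivAt.hasFDerivWithinAt)
    (fun z hz => (hK.norm_sub_le (hsub hz) (mem_of_mem_nhds ht)).trans
      (mul_le_mul_of_nonneg_left (mem_closedBall_iff_norm.mp hz) K.2))
    (mem_closedBall_self (norm_nonneg _)) (mem_closedBall_iff_norm.mpr le_rfl)
  rw [Real.norm_eq_abs] at this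
  rwa [pow_two, ← mul_assoc]

/-- Where a boundary point is given by a `C²` defining function, there is an interior ball
touching the boundary at that point. -/
theorem exists_interior_ball {Ω U : Set E} {f : E → ℝ} {y : E} (hU : IsOpen U) (hyU : y ∈ U)
    (hf : ContDiff ℝ 2 f) (hdf : fderiv ℝ f y ≠ 0) (hΩU : Ω ∩ U = {x ∈ U | f x < 0})
    (hy : f y = 0) : ∃ (n : E) (r : ℝ), ‖n‖ = 1 ∧ 0 < r ∧ ball (y - r • n) r ⊆ Ω := by
  obtain ⟨C, ρ, hC, hρ, hbd⟩ := exists_quadratic_bound hf y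
  obtain ⟨ρ', hρ', hb'⟩ := Metric.isOpen_iff.mp hU y hyU
  set g : E := gradient f y with hg
  have hgn : 0 < ‖g‖ := norm_pos_iff.mpr fun h => hdf (by
    rw [hg, gradient, map_eq_zero_iff _ (LinearIsometryEquiv.injective _)] at h
    exact h)
  set r : ℝ := min (min ρ ρ' / 2) (‖g‖ / (2 * (C + 1))) with hr
  have hr0 : 0 < r := by positivity
  have hr1 : 2 * r ≤ min ρ ρ' := by
    have := min_le_left (min ρ ρ' / 2) (‖g‖ / (2 * (C + 1)))
    linarith
  have hr2 : 2 * r * C ≤ ‖g‖ := by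
    have h1 := min_le_right (min ρ ρ' / 2) (‖g‖ / (2 * (C + 1)))
    rw [← hr, le_div_iff₀ (by positivity)] at h1
    nlinarith
  have hn1 : ‖(‖g‖⁻¹ • g : E)‖ = 1 := by
    rw [norm_smul, norm_inv, norm_norm, inv_mul_cancel₀ hgn.ne']
  refine ⟨‖g‖⁻¹ • g, r, hn1, hr0, fun x hx => ?_⟩
  rw [mem_ball_iff_norm] at hx
  have hxe : x - (y - r • (‖g‖⁻¹ • g)) = (x - y) + r • (‖g‖⁻¹ • g) := by abel
  rw [hxe] at hx
  have hxy : ‖x - y‖ < 2 * r := by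
    have h1 : x - y = ((x - y) + r • (‖g‖⁻¹ • g)) - r • (‖g‖⁻¹ • g) := by abel
    have h2 := norm_sub_le ((x - y) + r • (‖g‖⁻¹ • g)) (r • (‖g‖⁻¹ • g))
    rw [← h1, norm_smul r, hn1, mul_one, Real.norm_eq_abs, abs_of_pos hr0] at h2
    linarith
  have hsq : ‖x - y‖ ^ 2 + 2 * (r * (‖g‖⁻¹ * inner ℝ (x - y) g)) < 0 := by
    have h1 := norm_add_sq_real (x - y) (r • (‖g‖⁻¹ • g))
    rw [inner_smul_right, inner_smul_right, norm_smul r, hn1, mul_one, Real.norm_eq_abs,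
      sq_abs] at h1
    have h2 : ‖(x - y) + r • (‖g‖⁻¹ • g)‖ ^ 2 < r ^ 2 :=
      pow_lt_pow_left₀ hx (norm_nonneg _) two_ne_zero
    linarith
  have hlin : fderiv ℝ f y (x - y) = inner ℝ (x - y) g := by
    rw [real_inner_comm, hg, inner_gradient_left]
  have hmain := (abs_le.mp (hbd x (mem_ball_iff_norm.mpr
    (hxy.trans_le (hr1.trans (min_le_left _ _)))))).2
  rw [hy, hlin] at hmain
  have hneg : 2 * r * inner ℝ (x - y) g < - (‖g‖ * ‖x - y‖ ^ 2) := by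
    have := mul_lt_mul_of_pos_left hsq hgn
    have h3 : ‖g‖ * (‖x - y‖ ^ 2 + 2 * (r * (‖g‖⁻¹ * inner ℝ (x - y) g))) =
        ‖g‖ * ‖x - y‖ ^ 2 + 2 * r * inner ℝ (x - y) g := by field_simp
    linarith
  have hfx : f x < 0 := by
    by_contra! h0
    have h4 := mul_le_mul_of_nonneg_right hr2 (sq_nonneg ‖x - y‖)
    have h5 : inner ℝ (x - y) g ≥ - (C * ‖x - y‖ ^ 2) := by linarith
    have h6 := mul_le_mul_of_nonneg_left h5.le (show 0 ≤ 2 * r by positivity)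
    linarith
  have hxU : x ∈ U := hb' (mem_ball_iff_norm.mpr (hxy.trans_le (hr1.trans (min_le_right _ _))))
  exact (hΩU.symm ▸ (⟨hxU, hfx⟩ : x ∈ {x ∈ U | f x < 0}) : x ∈ Ω ∩ U).1

theorem IsC3Domain.hasTopPoint {Ω : Set E} (h : IsC3Domain Ω) {e : E} (he : ‖e‖ = 1) :
    HasTopPoint Ω e := by
  obtain ⟨hΩ, hconn, hb, hreg⟩ := h
  have hc : Continuous fun x : E => (inner ℝ x e : ℝ) := continuous_id.inner continuous_const
  obtain ⟨y, hy, hmax⟩ := hb.isCompact_closure.exists_isMaxOn hconn.nonempty.closure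
    hc.continuousOn
  have hle : ∀ x ∈ Ω, inner ℝ x e ≤ inner ℝ y e := fun x hx => hmax (subset_closure hx)
  have hee : (inner ℝ e e : ℝ) = 1 := by rw [real_inner_self_eq_norm_sq, he, one_pow]
  have hyΩ : y ∉ Ω := fun hyΩ => by
    obtain ⟨ε, hε, hball⟩ := Metric.isOpen_iff.mp hΩ y hyΩ
    have := hle (y + (ε / 2) • e) (hball (by
      rw [mem_ball_iff_norm, add_sub_cancel_left, norm_smul, he, mul_one, Real.norm_eq_abs,
        abs_of_pos (half_pos hε)]
      linarith))
    rw [inner_add_left, inner_smul_left, hee] at this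
    simp only [conj_trivial, mul_one] at this
    linarith
  have hyf : y ∈ frontier Ω := by rw [hΩ.frontier_eq]; exact ⟨hy, hyΩ⟩
  obtain ⟨U, f, hU, hyU, hf, hdf, hΩU⟩ := hreg y hyf
  have hfy : f y = 0 := by
    refine le_antisymm ?_ (not_lt.mp fun h => hyΩ
      (hΩU.symm ▸ (⟨hyU, h⟩ : y ∈ {y ∈ U | f y < 0}) : y ∈ Ω ∩ U).1)
    have : y ∈ closure (Ω ∩ U) := by
      rw [inter_comm]; exact hU.inter_closure ⟨hyU, hy⟩
    rw [hΩU] at this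
    exact closure_minimal (fun x hx => (show f x < 0 from hx.2).le)
      (isClosed_le hf.continuous continuous_const) this
  obtain ⟨n, r, hn, hr, hball⟩ :=
    exists_interior_ball hU hyU (hf.of_le (by norm_num)) (hdf y hyU) hΩU hfy
  have hne : (inner ℝ n e : ℝ) = 1 := by
    refine le_antisymm ((real_inner_le_norm n e).trans (by rw [hn, he, one_mul])) ?_
    by_contra! hlt
    set s : ℝ := (r + max 0 (r * inner ℝ n e)) / 2 with hs
    have hm : max 0 (r * inner ℝ n e) < r := max_lt hr (by nlinarith)
    have h0 := le_max_left 0 (r * inner ℝ n e)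
    have h1 := le_max_right 0 (r * inner ℝ n e)
    have := hle (y - r • n + s • e) (hball (by
      rw [mem_ball_iff_norm, add_sub_cancel_left, norm_smul, he, mul_one, Real.norm_eq_abs,
        abs_of_pos (by linarith)]
      linarith))
    rw [inner_add_left, inner_sub_left, inner_smul_left, inner_smul_left, hee] at this
    simp only [conj_trivial, mul_one] at this
    linarith
  rw [inner_eq_one_iff_of_norm_eq_one hn he] at hne
  exact ⟨y, r, hr, hyf, hle, hne ▸ hball⟩

theorem symDir_single {Ω : Set E} {i : Fin N} (hrefl : ∀ x ∈ Ω, reflect i x ∈ Ω)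
    (hconv : ∀ x ∈ Ω, ∀ y ∈ Ω, (∀ j : Fin N, j ≠ i → x j = y j) → segment ℝ x y ⊆ Ω) :
    SymDir Ω (EuclideanSpace.single i 1) := by
  intro x hx t ht
  have hr : ∀ j, reflect i x j = if j = i then - x i else x j := fun j => by
    simp [reflect, Function.update_apply]
  have hi : inner ℝ x (EuclideanSpace.single i (1 : ℝ)) = x i := by
    simp [EuclideanSpace.inner_single_right]
  rw [hi] at ht ⊢
  refine hconv x hx _ (hrefl x hx) (fun j hj => by rw [hr, if_neg hj]) ?_
  by_cases h0 : x i = 0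
  · rw [h0, abs_zero, abs_nonpos_iff] at ht
    rw [ht, h0, sub_zero, zero_smul, add_zero]
    exact left_mem_segment ℝ x _
  · have hdiv : |t / x i| ≤ 1 := by
      rw [abs_div]; exact div_le_one_of_le₀ ht (abs_nonneg _)
    obtain ⟨h1, h2⟩ := abs_le.mp hdiv
    refine ⟨(1 + t / x i) / 2, (1 - t / x i) / 2, by linarith, by linarith, by ring, ?_⟩
    ext j
    by_cases hj : j = i
    · subst hj
      simp [hr]
      field_simp
      ring
    · simp [hr, hj]
      ring

theorem mem_of_abs_le {Ω : Set (EuclideanSpace ℝ (Fin 2))}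
    (hs : ∀ i, SymDir Ω (EuclideanSpace.single i 1)) {x y : EuclideanSpace ℝ (Fin 2)} (hx : x ∈ Ω)
    (h0 : |y 0| ≤ |x 0|) (h1 : |y 1| ≤ |x 1|) : y ∈ Ω := by
  have a := hs 0 x hx (y 0) (by simpa [EuclideanSpace.inner_single_right] using h0)
  have b := hs 1 _ a (y 1) (by simpa [EuclideanSpace.inner_single_right] using h1)
  convert b using 1
  ext j
  fin_cases j <;> simp [EuclideanSpace.inner_single_right]

theorem isPreconnected_cap {Ω : Set E} {e : E} (he : ‖e‖ = 1)
    (hproj : ∀ x ∈ Ω, ∀ s ∈ Icc (0 : ℝ) 1, x + s • (inner ℝ x e • e - x) ∈ Ω)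
    (hs : SymDir Ω e) : IsPreconnected {x | x ∈ Ω ∧ 0 < inner ℝ x e} := by
  have hee : (inner ℝ e e : ℝ) = 1 := by rw [real_inner_self_eq_norm_sq, he, one_pow]
  have hpe : ∀ c : ℝ, (inner ℝ (c • e) e : ℝ) = c := fun c => by
    rw [inner_smul_left, hee]; simp
  have hp : ∀ x ∈ Ω, (inner ℝ x e : ℝ) • e ∈ Ω := fun x hx => by
    have := hproj x hx 1 (by simp)
    rwa [one_smul, add_sub_cancel] at this
  have hray : ∀ x ∈ {x | x ∈ Ω ∧ 0 < inner ℝ x e}, ∀ c : ℝ, 0 < c → c ≤ inner ℝ x e →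
      c • e ∈ {x | x ∈ Ω ∧ 0 < inner ℝ x e} := fun x hx c hc hcx => by
    refine ⟨?_, by rwa [hpe]⟩
    have := hs _ (hp x hx.1) c (by rw [hpe, abs_of_pos hc, abs_of_pos hx.2]; exact hcx)
    rwa [hpe, ← add_smul, add_sub_cancel] at this
  have hleg : ∀ x ∈ {x | x ∈ Ω ∧ 0 < inner ℝ x e},
      segment ℝ x ((inner ℝ x e : ℝ) • e) ⊆ {x | x ∈ Ω ∧ 0 < inner ℝ x e} := fun x hx w hw => by
    rw [segment_eq_image'] at hw
    obtain ⟨s, hs, rfl⟩ := hw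
    refine ⟨hproj x hx.1 s hs, ?_⟩
    rw [inner_add_left, inner_smul_left, inner_sub_left, hpe, sub_self, mul_zero, add_zero]
    exact hx.2
  refine isPreconnected_of_forall_pair fun x hx y hy => ?_
  refine ⟨segment ℝ x ((inner ℝ x e : ℝ) • e) ∪
    ((fun c : ℝ => c • e) '' uIcc (inner ℝ x e) (inner ℝ y e) ∪
      segment ℝ y ((inner ℝ y e : ℝ) • e)), ?_, Or.inl (left_mem_segment _ _ _),
    Or.inr (Or.inr (left_mem_segment _ _ _)), ?_⟩
  · refine union_subset (hleg x hx) (union_subset ?_ (hleg y hy))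
    rintro _ ⟨c, hc, rfl⟩
    have hc0 : 0 < c := (lt_min hx.2 hy.2).trans_le hc.1
    rcases le_max_iff.mp hc.2 with h | h
    · exact hray x hx c hc0 h
    · exact hray y hy c hc0 h
  · refine IsPreconnected.union _ (right_mem_segment _ _ _)
      (Or.inl ⟨_, left_mem_uIcc, rfl⟩) (convex_segment _ _).isPreconnected ?_
    exact IsPreconnected.union _ ⟨_, right_mem_uIcc, rfl⟩ (right_mem_segment _ _ _)
      (isPreconnected_uIcc.image _ (by fun_prop)) (convex_segment _ _).isPreconnected

theorem IsC3Domain.admissible {Ω : Set (EuclideanSpace ℝ (Fin 2))} (h : IsC3Domain Ω)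
    (hs : ∀ i, SymDir Ω (EuclideanSpace.single i 1)) (i : Fin 2)
    {e : EuclideanSpace ℝ (Fin 2)}
    (he : e = EuclideanSpace.single i 1 ∨ e = -EuclideanSpace.single i 1) : Admissible Ω e := by
  have hn : ‖e‖ = 1 := by rcases he with rfl | rfl <;> simp
  have hse : SymDir Ω e := by
    rcases he with rfl | rfl
    · exact hs i
    · exact (hs i).neg
  refine ⟨hn, hse, isPreconnected_cap hn (fun x hx s hs' => ?_) hse, h.hasTopPoint hn⟩
  have hpt : (inner ℝ x e : ℝ) • e = EuclideanSpace.single i (x i) := by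
    rcases he with rfl | rfl <;> ext j <;>
      simp [EuclideanSpace.inner_single_right]
  rw [hpt]
  have hcoord : ∀ j, |(x + s • (EuclideanSpace.single i (x i) - x)) j| ≤ |x j| := fun j => by
    by_cases hj : j = i
    · subst hj; simp
    · have : (x + s • (EuclideanSpace.single i (x i) - x)) j = (1 - s) * x j := by
        simp [hj]; ring
      rw [this, abs_mul, abs_of_nonneg (sub_nonneg.mpr hs'.2)]
      exact mul_le_of_le_one_left (abs_nonneg _) (by linarith [hs'.1])
  exact mem_of_abs_le hs hx (hcoord 0) (hcoord 1)

end InteriorBall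

section Reduction
variable {N : ℕ}
local notation "E" => EuclideanSpace ℝ (Fin N)

theorem hasDerivAt_max_rpow {p : ℝ} (hp : 1 < p) (s : ℝ) :
    HasDerivAt (fun s : ℝ => max s 0 ^ p) (p * max s 0 ^ (p - 1)) s := by
  have hp0 : p ≠ 0 := by linarith
  have hp1 : p - 1 ≠ 0 := by linarith
  have hright : 0 ≤ s → HasDerivWithinAt (fun s : ℝ => max s 0 ^ p) (p * max s 0 ^ (p - 1))
      (Ici 0) s := fun hs => by
    rw [max_eq_left hs]
    exact ((Real.hasDerivAt_rpow_const (Or.inr hp.le)).hasDerivWithinAt).congr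
      (fun t ht => by rw [max_eq_left ht]) (by rw [max_eq_left hs])
  have hleft : s ≤ 0 → HasDerivWithinAt (fun s : ℝ => max s 0 ^ p) (p * max s 0 ^ (p - 1))
      (Iic 0) s := fun hs => by
    rw [max_eq_right hs, Real.zero_rpow hp1, mul_zero]
    exact (hasDerivWithinAt_const s _ (0 : ℝ)).congr
      (fun t ht => by rw [max_eq_right ht, Real.zero_rpow hp0])
      (by rw [max_eq_right hs, Real.zero_rpow hp0])
  rcases lt_trichotomy s 0 with h | h | h
  · exact (hleft h.le).hasDerivAt (Iic_mem_nhds h)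
  · have := (hleft h.le).union (hright h.ge)
    rwa [Iic_union_Ici, hasDerivWithinAt_univ] at this
  · exact (hright h.le).hasDerivAt (Ici_mem_nhds h)

/-- The nonlinearity of problem `(P)_λ`. -/
def nonlin (p lam α t : ℝ) : ℝ := max (α + lam * t) 0 ^ p

theorem hasDerivAt_nonlin {p : ℝ} (hp : 1 < p) (lam α t : ℝ) :
    HasDerivAt (nonlin p lam α) (p * lam * max (α + lam * t) 0 ^ (p - 1)) t := by
  have h1 : HasDerivAt (fun t : ℝ => α + lam * t) lam t := by
    simpa using ((hasDerivAt_id t).const_mul lam).const_add α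
  have h2 : HasDerivAt (nonlin p lam α) (p * max (α + lam * t) 0 ^ (p - 1) * lam) t :=
    HasDerivAt.comp (h₂ := fun s : ℝ => max s 0 ^ p) t (hasDerivAt_max_rpow hp (α + lam * t)) h1
  exact h2.congr_deriv (by ring)

theorem contDiff_nonlin {p : ℝ} (hp : 1 < p) (lam α : ℝ) : ContDiff ℝ 1 (nonlin p lam α) := by
  rw [contDiff_one_iff_deriv]
  refine ⟨fun t => (hasDerivAt_nonlin hp lam α t).differentiableAt, ?_⟩
  rw [funext fun t => (hasDerivAt_nonlin hp lam α t).deriv]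
  exact continuous_const.mul (Continuous.rpow_const (by fun_prop) fun t => Or.inr (by linarith))

theorem lapl_eq_zero_of_eqOn {Ω : Set E} (hΩ : IsOpen Ω) {v : E → ℝ} (h : ∀ x ∈ Ω, v x = 0) :
    ∀ x ∈ Ω, lapl v x = 0 := by
  have h1 : ∀ x ∈ Ω, fderiv ℝ v x = 0 := fun x hx => by
    have : v =ᶠ[nhds x] fun _ => 0 := by filter_upwards [hΩ.mem_nhds hx] with y hy using h y hy
    rw [this.fderiv_eq, fderiv_const_apply]
  intro x hx
  refine Finset.sum_eq_zero fun i _ => ?_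
  have : (fun y => fderiv ℝ v y (EuclideanSpace.single i (1 : ℝ))) =ᶠ[nhds x] fun _ => 0 := by
    filter_upwards [hΩ.mem_nhds hx] with y hy
    rw [h1 y hy]; rfl
  rw [this.fderiv_eq, fderiv_const_apply]; rfl

theorem IsSol.semilinearSol (hN : 2 ≤ N) {Ω : Set E} {p lam α : ℝ} {ψ : E → ℝ} (hp : 1 < p)
    (hlam : 0 < lam) (hΩ : IsOpen Ω) (hconn : IsPreconnected Ω) (hb : Bornology.IsBounded Ω)
    (h : IsSol Ω p lam α ψ) : SemilinearSol Ω ψ (nonlin p lam α) := by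
  obtain ⟨hreg, heq, h0, hint⟩ := h
  have hF : ∀ t, 0 ≤ nonlin p lam α t := fun t => Real.rpow_nonneg (le_max_right _ _) _
  have hreg1 : ContDiff ℝ 1 ψ := hreg.of_le (by norm_num)
  have hFc : Continuous fun x => nonlin p lam α (ψ x) :=
    (contDiff_nonlin hp lam α).continuous.comp hreg.continuous
  have hw : WeakEq Ω ψ (fun x => nonlin p lam α (ψ x)) := weakEq_of_lapl hreg heq
  have hnn := weak_max_principle hN hΩ hb hreg1 hFc hw (fun x _ _ => hF _)
    (fun x hx => (h0 x hx).ge)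
  refine ⟨hN, hΩ, hb, hreg, contDiff_nonlin hp lam α, fun s t hst => ?_, hF, hw, h0,
    fun x hx => lt_of_le_of_ne (hnn x hx) fun hx0 => ?_⟩
  · refine Real.rpow_le_rpow (le_max_right _ _) (max_le_max_right _ ?_) (by linarith)
    have := mul_le_mul_of_nonneg_left hst hlam.le
    linarith
  · have hz := eq_zero_of_superharmonic hN hΩ hconn subset_rfl hreg1 hFc hw hnn
      (fun x _ => hF _) hx hx0.symm
    have hzero : ∫ x in Ω, max (α + lam * ψ x) 0 ^ p = 0 := by
      refine setIntegral_eq_zero_of_forall_eq_zero fun y hy => ?_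
      rw [← heq y hy, lapl_eq_zero_of_eqOn hΩ hz y hy, neg_zero]
    rw [hzero] at hint
    exact zero_ne_one hint

theorem continuous_Vfun {p lam α : ℝ} {ψ : E → ℝ} (hp : 1 < p) (hψ : Continuous ψ) :
    Continuous (Vfun p lam α ψ) :=
  Continuous.rpow_const (by fun_prop) fun x => Or.inr (by linarith)

theorem IsSol.mV_ne_zero {Ω : Set E} {p lam α : ℝ} {ψ : E → ℝ} (hp : 1 < p)
    (hb : Bornology.IsBounded Ω) (h : IsSol Ω p lam α ψ) : mV Ω p lam α ψ ≠ 0 := by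
  obtain ⟨hreg, -, -, hint⟩ := h
  intro h0
  have hV : 0 ≤ Vfun p lam α ψ := fun x => Real.rpow_nonneg (le_max_right _ _) _
  rw [mV, integral_eq_zero_iff_of_nonneg hV
    (integrableOn_of_continuous_of_isBounded hb (continuous_Vfun hp hreg.continuous))] at h0
  have hzero : ∫ x in Ω, max (α + lam * ψ x) 0 ^ p = 0 := by
    refine integral_eq_zero_of_ae ?_
    filter_upwards [h0] with x hx
    have hx' : max (α + lam * ψ x) 0 ^ (p - 1) = 0 := hx
    have hbase := (Real.rpow_eq_zero (le_max_right _ _) (by linarith)).mp hx'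
    rw [hbase, Real.zero_rpow (by linarith)]; rfl
  rw [hzero] at hint
  exact zero_ne_one hint

/-- Some nontrivial combination of two solutions of the linearized problem has vanishing weighted
average, and then solves the linearized equation without the nonlocal term. -/
theorem IsSol.exists_combination {Ω : Set E} {p lam α : ℝ} {ψ φ₁ φ₂ : E → ℝ}
    (hp : 1 < p) (hb : Bornology.IsBounded Ω) (h : IsSol Ω p lam α ψ)
    (hφ₁reg : ContDiff ℝ 2 φ₁) (hφ₁bd : ∀ x ∈ frontier Ω, φ₁ x = 0)
    (hφ₁eq : ∀ x ∈ Ω,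
      -lapl φ₁ x = p * lam * (Vfun p lam α ψ x * (φ₁ x - avgV Ω p lam α ψ φ₁)))
    (hφ₂reg : ContDiff ℝ 2 φ₂) (hφ₂bd : ∀ x ∈ frontier Ω, φ₂ x = 0)
    (hφ₂eq : ∀ x ∈ Ω,
      -lapl φ₂ x = p * lam * (Vfun p lam α ψ x * (φ₂ x - avgV Ω p lam α ψ φ₂))) :
    ∃ a b : ℝ, (a ≠ 0 ∨ b ≠ 0) ∧
      LinearizedSol Ω ψ (nonlin p lam α) (fun x => a * φ₁ x + b * φ₂ x) ∧
      ∫ x in Ω, deriv (nonlin p lam α) (ψ x) * (a * φ₁ x + b * φ₂ x) = 0 := by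
  set A₁ := avgV Ω p lam α ψ φ₁ with hA₁
  set A₂ := avgV Ω p lam α ψ φ₂ with hA₂
  obtain ⟨a, b, hab, h0⟩ : ∃ a b : ℝ, (a ≠ 0 ∨ b ≠ 0) ∧ a * A₁ + b * A₂ = 0 := by
    by_cases h1 : A₁ = 0
    · exact ⟨1, 0, Or.inl one_ne_zero, by rw [h1]; ring⟩
    · exact ⟨A₂, -A₁, Or.inr (neg_ne_zero.mpr h1), by ring⟩
  have hV := continuous_Vfun (lam := lam) (α := α) hp h.1.continuous
  have hm := h.mV_ne_zero hp hb
  have hder : ∀ x, deriv (nonlin p lam α) (ψ x) = p * lam * Vfun p lam α ψ x := fun x =>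
    (hasDerivAt_nonlin hp lam α (ψ x)).deriv
  have hr₁ : ContDiff ℝ 1 φ₁ := hφ₁reg.of_le (by norm_num)
  have hr₂ : ContDiff ℝ 1 φ₂ := hφ₂reg.of_le (by norm_num)
  have hc₁ := hr₁.continuous
  have hc₂ := hr₂.continuous
  refine ⟨a, b, hab, ⟨(contDiff_const.mul hr₁).add (contDiff_const.mul hr₂), ?_, fun x hx => ?_⟩, ?_⟩
  · refine ((((weakEq_of_lapl hφ₁reg hφ₁eq).const_mul hr₁ a).add
      ((weakEq_of_lapl hφ₂reg hφ₂eq).const_mul hr₂ b) (contDiff_const.mul hr₁)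
      (contDiff_const.mul hr₂) (by fun_prop) (by fun_prop))).congr fun x _ => ?_
    rw [hder]
    linear_combination (- (p * lam * Vfun p lam α ψ x)) * h0
  · rw [hφ₁bd x hx, hφ₂bd x hx, mul_zero, mul_zero, add_zero]
  · have e₁ : ∫ x in Ω, Vfun p lam α ψ x * φ₁ x = A₁ * mV Ω p lam α ψ := by
      rw [hA₁, avgV, div_mul_cancel₀ _ hm]
    have e₂ : ∫ x in Ω, Vfun p lam α ψ x * φ₂ x = A₂ * mV Ω p lam α ψ := by
      rw [hA₂, avgV, div_mul_cancel₀ _ hm]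
    have hfun : (fun x => deriv (nonlin p lam α) (ψ x) * (a * φ₁ x + b * φ₂ x)) = fun x =>
        p * lam * a * (Vfun p lam α ψ x * φ₁ x) + p * lam * b * (Vfun p lam α ψ x * φ₂ x) := by
      ext x
      rw [hder]
      ring
    rw [hfun, integral_add
      (integrableOn_of_continuous_of_isBounded hb (by fun_prop))
      (integrableOn_of_continuous_of_isBounded hb (by fun_prop)),
      integral_const_mul, integral_const_mul, e₁, e₂]
    linear_combination (p * lam * mV Ω p lam α ψ) * h0

end Reduction

theorem stmt13 (N : ℕ) (hN : 2 ≤ N) (p : ℝ) (hp1 : 1 < p)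
    (hpN : N = 2 ∨ p < (N : ℝ) / ((N : ℝ) - 2)) (lam : ℝ) (hlam : 0 < lam)
    (Ω : Set (EuclideanSpace ℝ (Fin N)))
    (hΩ : (∃ R : ℝ, 0 < R ∧ Ω = ball (0 : EuclideanSpace ℝ (Fin N)) R) ∨
      (N = 2 ∧ IsC3Domain Ω ∧
        (∀ (i : Fin N), ∀ x ∈ Ω, reflect i x ∈ Ω) ∧
        (∀ (i : Fin N), ∀ x ∈ Ω, ∀ y ∈ Ω,
          (∀ j : Fin N, j ≠ i → x j = y j) → segment ℝ x y ⊆ Ω)))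
    (α : ℝ) (ψ φ₁ φ₂ : EuclideanSpace ℝ (Fin N) → ℝ)
    (hsol : IsSol Ω p lam α ψ)
    (hφ₁reg : ContDiff ℝ 2 φ₁) (hφ₁bd : ∀ x ∈ frontier Ω, φ₁ x = 0)
    (hφ₁eq : ∀ x ∈ Ω,
      -lapl φ₁ x = p * lam * (Vfun p lam α ψ x * (φ₁ x - avgV Ω p lam α ψ φ₁)))
    (hφ₂reg : ContDiff ℝ 2 φ₂) (hφ₂bd : ∀ x ∈ frontier Ω, φ₂ x = 0)
    (hφ₂eq : ∀ x ∈ Ω,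
      -lapl φ₂ x = p * lam * (Vfun p lam α ψ x * (φ₂ x - avgV Ω p lam α ψ φ₂))) :
    ∃ a b : ℝ, (a ≠ 0 ∨ b ≠ 0) ∧ ∀ x ∈ closure Ω, a * φ₁ x + b * φ₂ x = 0 := by
  have hdom : IsOpen Ω ∧ IsConnected Ω ∧ Bornology.IsBounded Ω := by
    rcases hΩ with ⟨R, hR, rfl⟩ | ⟨-, h, -⟩
    · exact ⟨isOpen_ball, (convex_ball 0 R).isConnected ⟨0, mem_ball_self hR⟩, isBounded_ball⟩
    · exact ⟨h.1, h.2.1, h.2.2.1⟩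
  obtain ⟨hopen, hconn, hb⟩ := hdom
  have S := hsol.semilinearSol hN hp1 hlam hopen hconn.isPreconnected hb
  obtain ⟨a, b, hab, L, hint⟩ := hsol.exists_combination hp1 hb hφ₁reg hφ₁bd hφ₁eq
    hφ₂reg hφ₂bd hφ₂eq
  have hzero : ∀ x ∈ Ω, a * φ₁ x + b * φ₂ x = 0 := by
    rcases hΩ with ⟨R, hR, rfl⟩ | ⟨rfl, h, hrefl, hconv⟩
    · exact S.linearized_eq_zero_ball hR L hint
    · have hs : ∀ i, SymDir Ω (EuclideanSpace.single i 1) := fun i =>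
        symDir_single (hrefl i) (hconv i)
      exact S.linearized_eq_zero_plane L hint (fun i => h.admissible hs i (Or.inl rfl))
        (fun i => h.admissible hs i (Or.inr rfl)) hconn.nonempty
        (fun x hx y h0 h1 => mem_of_abs_le hs hx h0 h1)
  refine ⟨a, b, hab, fun x hx => ?_⟩
  by_cases hxΩ : x ∈ Ω
  · exact hzero x hxΩ
  · exact L.zero x (by rw [hopen.frontier_eq]; exact ⟨hx, hxΩ⟩)

end
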